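/- Let K be a field equipped with two commuting ring endomorphisms φ and σ such that every a ∈ K with φ^m(a) = a for some m ≥ 1 satisfies φ(a) = a, and σ maps k := K^φ onto itself. Let A ∈ GL_n(K) and let R₁ and R₂ be two σ-PV rings over K for the same equation φ(y) = A y, with constant fields k₁ := R₁^{Φ₁} and k₂ := R₂^{Φ₂} (each a field extension of k). Then there exist: a commutative ring k' with a ring endomorphism σ' which is a σ'-pseudo field (σ'-simple, Noetherian, every non-zero-divisor a unit); injective ring homomorphisms from k, k₁, and k₂ into k' commuting with the respective σ-actions and compatible over k; such that k' is finitely σ'-generated over k (every element of k' is a quotient a·b^{-1}, with b a unit, of elements of the k-subalgebra generated by the σ'-orbits of some finite subset of k'); k' is constrained over k (for every finite tuple a of elements of k' there is a non-zero-divisor b ∈ k' such that the zero ideal is the only σ'-pseudo prime ideal of the k-subalgebra of k' generated by the σ'-orbits of the coordinates of a and of b^{-1}); and a ring isomorphism ψ : R₁ ⊗_{k₁} k' → R₂ ⊗_{k₂} k' that is compatible with the K ⊗_k k'-algebra structures and commutes with the endomorphisms Φ₁ ⊗ id and Φ₂ ⊗ id as well as with Σ₁ ⊗ σ' and Σ₂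 ⊗ σ'. -/

import Mathlib

open scoped TensorProduct

/-- A `φ`-ring `R` is `φ`-simple if the zero ideal and the whole ring are its only
`φ`-ideals (ideals `I` with `φ(I) ⊆ I`). -/
def DiffSimple {R : Type*} [CommRing R] (φ : R →+* R) : Prop :=
  (⊥ : Ideal R) ≠ ⊤ ∧ ∀ I : Ideal R, (∀ x ∈ I, φ x ∈ I) → I = ⊥ ∨ I = ⊤

/-- An ideal `p` of a ring with endomorphism `σ` is `σ`-pseudo prime if
`p = q ∩ σ⁻¹(q) ∩ … ∩ σ^{-(d-1)}(q)` for some `d ≥ 1` and some `σ^d`-prime ideal `q`. -/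
def PseudoPrime {R : Type*} [CommRing R] (σ : R →+* R) (p : Ideal R) : Prop :=
  ∃ d : ℕ, 1 ≤ d ∧ ∃ q : Ideal R, q.IsPrime ∧ Ideal.comap (σ ^ d) q = q ∧
    p = ⨅ i ∈ Finset.range d, Ideal.comap (σ ^ i) q

/-- A ring with endomorphism `φ` is a `φ`-pseudo domain if its zero ideal is
`φ`-pseudo prime. -/
def PseudoDomain {R : Type*} [CommRing R] (φ : R →+* R) : Prop :=
  PseudoPrime φ (⊥ : Ideal R)

/-- A `σ`-pseudo field is a `σ`-simple Noetherian ring (with endomorphism `σ`) in which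
every non-zero-divisor is a unit. -/
def PseudoField (R : Type*) [CommRing R] (σ : R →+* R) : Prop :=
  DiffSimple σ ∧ IsNoetherianRing R ∧ ∀ x ∈ nonZeroDivisors R, IsUnit x

/-- The subring of `φ`-constants of a ring with endomorphism `φ`. -/
def constSubring {R : Type*} [CommRing R] (φ : R →+* R) : Subring R :=
  RingHom.eqLocus φ (RingHom.id R)

/-- The restriction of `σ'` to the subring of `Φ`-constants, for commuting `Φ`, `σ'`. -/
def resEndo {R : Type*} [CommRing R] (Φ σ' : R →+* R)
    (h : ∀ x : R, Φ (σ' x) = σ' (Φ x)) :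
    ↥(constSubring Φ) →+* ↥(constSubring Φ) where
  toFun x := ⟨σ' ↑x, by
    have hx : Φ ↑x = ↑x := x.2
    exact (h ↑x).trans (congrArg σ' hx)⟩
  map_one' := by ext; simp
  map_mul' a b := by ext; simp
  map_zero' := by ext; simp
  map_add' a b := by ext; simp

open Polynomial in
theorem eval₂_eq_zero_of_minimal_root {A T Ω : Type*} [CommRing A] [Field T] [Field Ω]
    (e : A →+* T) (e' : A →+* Ω) (hk : ∀ a, e a = 0 → e' a = 0) (x : T) (y : Ω) (G : A[X])
    (hG : G.map e ≠ 0) (hGx : G.eval₂ e x = 0)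
    (hmin : ∀ P : A[X], P.map e ≠ 0 → P.eval₂ e x = 0 →
      (G.map e).natDegree ≤ (P.map e).natDegree)
    (hy : G.eval₂ e' y = 0) (hl : e' (G.coeff (G.map e).natDegree) ≠ 0)
    (P : A[X]) (hP : P.eval₂ e x = 0) : P.eval₂ e' y = 0 := by
  obtain ⟨m, hm⟩ : ∃ m, (P.map e).natDegree < m := ⟨_, Nat.lt_succ_self _⟩
  induction m generalizing P with
  | zero => omega
  | succ m ih =>
    by_cases h0 : P.map e = 0
    · have : P.map e' = 0 := by
        ext k
        have := congrArg (fun q => q.coeff k) h0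
        simp only [coeff_map, coeff_zero] at this ⊢
        exact hk _ this
      rw [← eval_map, this, eval_zero]
    set n := (G.map e).natDegree with hn
    set d := (P.map e).natDegree with hd
    have hnd : n ≤ d := hmin P h0 hP
    set P' : A[X] := C (G.coeff n) * P - C (P.coeff d) * X ^ (d - n) * G with hP'
    have hP'x : P'.eval₂ e x = 0 := by
      simp [hP', eval₂_sub, eval₂_mul, hP, hGx]
    have hP'y : P'.eval₂ e' y = e' (G.coeff n) * P.eval₂ e' y := by
      simp [hP', eval₂_sub, eval₂_mul, hy]
    have hGc : e (G.coeff n) ≠ 0 := by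
      have : (G.map e).leadingCoeff ≠ 0 := leadingCoeff_ne_zero.mpr hG
      rwa [leadingCoeff, coeff_map] at this
    have hPc : e (P.coeff d) ≠ 0 := by
      have : (P.map e).leadingCoeff ≠ 0 := leadingCoeff_ne_zero.mpr h0
      rwa [leadingCoeff, coeff_map] at this
    have key : P'.eval₂ e' y = 0 := by
      by_cases h1 : P'.map e = 0
      · have : P'.map e' = 0 := by
          ext k
          have := congrArg (fun q => q.coeff k) h1
          simp only [coeff_map, coeff_zero] at this ⊢
          exact hk _ this
        rw [← eval_map, this, eval_zero]
      · apply ih P' hP'x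
        have hlt : (P'.map e).degree < (C (e (G.coeff n)) * P.map e).degree := by
          have hmap : P'.map e = C (e (G.coeff n)) * P.map e
              - C (e (P.coeff d)) * X ^ (d - n) * G.map e := by
            simp [hP', Polynomial.map_sub, Polynomial.map_mul]
          rw [hmap]
          have hX : C (e (P.coeff d)) * X ^ (d - n) ≠ 0 :=
            mul_ne_zero (C_ne_zero.mpr hPc) (pow_ne_zero _ X_ne_zero)
          apply degree_sub_lt_left
          · rw [degree_C_mul hGc, degree_mul, degree_C_mul hPc, degree_X_pow,
              degree_eq_natDegree hG, degree_eq_natDegree h0, ← hn, ← hd]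
            norm_cast
            omega
          · exact mul_ne_zero (C_ne_zero.mpr hGc) h0
          · simp only [leadingCoeff_mul, leadingCoeff_C, leadingCoeff_X_pow, mul_one]
            rw [leadingCoeff, leadingCoeff, coeff_map, coeff_map, ← hn, ← hd, mul_comm]
        rw [degree_C_mul hGc] at hlt
        have := natDegree_lt_natDegree h1 hlt
        omega
    rw [hP'y] at key
    exact (mul_eq_zero.mp key).resolve_left hl

/-- The endomorphism of `B[X₀, X₁, …]` that applies `τ` to the coefficients and sends
`Xᵢ` to `Xᵢ₊ₛ`. -/
noncomputable def seqShift {B : Type*} [CommRing B] (τ : B →+* B) (s : ℕ) :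
    MvPolynomial ℕ B →+* MvPolynomial ℕ B :=
  MvPolynomial.eval₂Hom (MvPolynomial.C.comp τ) (fun i => MvPolynomial.X (i + s))

@[simp] theorem seqShift_C {B : Type*} [CommRing B] (τ : B →+* B) (s : ℕ) (x : B) :
    seqShift τ s (MvPolynomial.C x) = MvPolynomial.C (τ x) := by
  simp [seqShift]

@[simp] theorem seqShift_X {B : Type*} [CommRing B] (τ : B →+* B) (s i : ℕ) :
    seqShift τ s (MvPolynomial.X i : MvPolynomial ℕ B) = MvPolynomial.X (i + s) := by
  simp [seqShift]

theorem seqShift_iterate {B : Type*} [CommRing B] (τ : B →+* B) (s n : ℕ)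
    (p : MvPolynomial ℕ B) : (seqShift τ s)^[n] p = seqShift (τ ^ n) (s * n) p := by
  induction n with
  | zero =>
    have : seqShift (τ ^ 0) (s * 0) = RingHom.id (MvPolynomial ℕ B) := by
      apply MvPolynomial.ringHom_ext <;> simp
    rw [this]; rfl
  | succ n ih =>
    rw [Function.iterate_succ_apply', ih]
    have : (seqShift τ s).comp (seqShift (τ ^ n) (s * n)) = seqShift (τ ^ (n + 1)) (s * (n + 1)) := by
      apply MvPolynomial.ringHom_ext
      · intro x
        simp [pow_succ']
      · intro i
        simp [mul_add, add_assoc]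
    rw [← this]; rfl

/-- Polynomials in the first `r` variables. -/
noncomputable abbrev firstVars (B : Type*) [CommRing B] (r : ℕ) :
    Subalgebra B (MvPolynomial ℕ B) :=
  MvPolynomial.supported B (Set.Iio r)

theorem firstVars_mono {B : Type*} [CommRing B] {r r' : ℕ} (h : r ≤ r') :
    firstVars B r ≤ firstVars B r' :=
  MvPolynomial.supported_mono (Set.Iio_subset_Iio h)

theorem exists_mem_firstVars {B : Type*} [CommRing B] (p : MvPolynomial ℕ B) :
    ∃ r, p ∈ firstVars B r := by
  refine ⟨p.vars.sup id + 1, ?_⟩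
  rw [MvPolynomial.mem_supported]
  intro i hi
  exact Nat.lt_succ_of_le (Finset.le_sup (f := id) hi)

theorem X_mem_firstVars {B : Type*} [CommRing B] {r i : ℕ} (h : i < r) :
    (MvPolynomial.X i : MvPolynomial ℕ B) ∈ firstVars B r :=
  Algebra.subset_adjoin ⟨i, h, rfl⟩

theorem seqShift_mem_firstVars {B : Type*} [CommRing B] (τ : B →+* B) (s : ℕ) {r : ℕ}
    {p : MvPolynomial ℕ B} (hp : p ∈ firstVars B r) : seqShift τ s p ∈ firstVars B (r + s) := by
  induction hp using Algebra.adjoin_induction with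
  | mem x hx =>
    obtain ⟨i, hi, rfl⟩ := hx
    rw [seqShift_X]
    exact X_mem_firstVars (by simpa using hi)
  | algebraMap x =>
    rw [MvPolynomial.algebraMap_eq, seqShift_C]
    exact (firstVars B (r + s)).algebraMap_mem _
  | add x y _ _ hx hy => rw [map_add]; exact add_mem hx hy
  | mul x y _ _ hx hy => rw [map_mul]; exact mul_mem hx hy

theorem seqShift_iterate_mem_firstVars {B : Type*} [CommRing B] (τ : B →+* B) (s n : ℕ) {r : ℕ}
    {p : MvPolynomial ℕ B} (hp : p ∈ firstVars B r) :
    (seqShift τ s)^[n] p ∈ firstVars B (r + s * n) := by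
  rw [seqShift_iterate]
  exact seqShift_mem_firstVars _ _ hp

theorem exists_eval_X_of_mem_firstVars {B : Type*} [CommRing B] {i : ℕ} {p : MvPolynomial ℕ B}
    (hp : p ∈ firstVars B (i + 1)) :
    ∃ P : Polynomial (firstVars B i), Polynomial.aeval (MvPolynomial.X i) P = p := by
  have : firstVars B (i + 1) ≤ ((Polynomial.aeval (R := firstVars B i)
      (MvPolynomial.X i : MvPolynomial ℕ B)).range).restrictScalars B := by
    apply Algebra.adjoin_le
    rintro _ ⟨j, hj, rfl⟩
    rcases Nat.lt_succ_iff_lt_or_eq.mp hj with h | rfl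
    · exact ⟨Polynomial.C ⟨_, X_mem_firstVars h⟩, by simp⟩
    · exact ⟨Polynomial.X, by simp⟩
  obtain ⟨P, hP⟩ := this hp
  exact ⟨P, hP⟩

theorem aeval_X_mem_firstVars {B : Type*} [CommRing B] {i : ℕ} (P : Polynomial (firstVars B i)) :
    Polynomial.aeval (MvPolynomial.X i : MvPolynomial ℕ B) P ∈ firstVars B (i + 1) := by
  rw [Polynomial.aeval_eq_sum_range]
  refine sum_mem fun k _ => ?_
  rw [Algebra.smul_def]
  exact mul_mem (firstVars_mono (Nat.le_succ i) (P.coeff k).2)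
    (pow_mem (X_mem_firstVars (Nat.lt_succ_self i)) _)

/-- The shift as a map from polynomials in `i` variables to polynomials in `i + s` variables. -/
noncomputable def seqShiftVars {B : Type*} [CommRing B] (τ : B →+* B) (s i : ℕ) :
    firstVars B i →+* firstVars B (i + s) :=
  ((seqShift τ s).comp (firstVars B i).val.toRingHom).codRestrict (firstVars B (i + s))
    fun x => seqShift_mem_firstVars τ s x.2

theorem aeval_map_seqShiftVars {B : Type*} [CommRing B] (τ : B →+* B) (s i : ℕ)
    (P : Polynomial (firstVars B i)) :
    Polynomial.aeval (MvPolynomial.X (i + s) : MvPolynomial ℕ B) (P.map (seqShiftVars τ s i)) =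
      seqShift τ s (Polynomial.aeval (MvPolynomial.X i) P) := by
  rw [Polynomial.aeval_def, Polynomial.eval₂_map, Polynomial.aeval_def, Polynomial.hom_eval₂,
    seqShift_X]
  rfl

theorem aeval_seqShift {B T : Type*} [CommRing B] [CommRing T] [Algebra B T] (τB : B →+* B)
    (τ : T →+* T) (hτ : ∀ x, τ (algebraMap B T x) = algebraMap B T (τB x)) (b : ℕ → T) (s : ℕ)
    (hb : ∀ i, b (i + s) = τ (b i)) (p : MvPolynomial ℕ B) :
    MvPolynomial.aeval b (seqShift τB s p) = τ (MvPolynomial.aeval b p) := by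
  have : ((MvPolynomial.aeval b : MvPolynomial ℕ B →ₐ[B] T) : _ →+* T).comp (seqShift τB s) =
      τ.comp (MvPolynomial.aeval b : MvPolynomial ℕ B →ₐ[B] T) := by
    apply MvPolynomial.ringHom_ext
    · intro x; simp [hτ]
    · intro i; simp [hb]
  exact RingHom.congr_fun this p

theorem aeval_seqShift_iterate {B T : Type*} [CommRing B] [CommRing T] [Algebra B T]
    (τB : B →+* B)
    (τ : T →+* T) (hτ : ∀ x, τ (algebraMap B T x) = algebraMap B T (τB x)) (b : ℕ → T) (s : ℕ)
    (hb : ∀ i, b (i + s) = τ (b i)) (n : ℕ) (p : MvPolynomial ℕ B) :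
    MvPolynomial.aeval b ((seqShift τB s)^[n] p) = τ^[n] (MvPolynomial.aeval b p) := by
  induction n with
  | zero => rfl
  | succ n ih =>
    rw [Function.iterate_succ_apply', Function.iterate_succ_apply',
      aeval_seqShift τB τ hτ b s hb, ih]

theorem exists_forall_ge_add_eq {α : Type*} [LinearOrder α] [WellFoundedLT α] (f : ℕ → α)
    {s : ℕ} (hs : 1 ≤ s) (hf : ∀ i, f (i + s) ≤ f i) : ∃ r, ∀ i, r ≤ i → f (i + s) = f i := by
  have hmono : ∀ c m n, m ≤ n → f (c + s * n) ≤ f (c + s * m) := by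
    intro c m n hmn
    induction hmn with
    | refl => exact le_rfl
    | step _ ih => exact le_trans (by rw [Nat.mul_succ, ← add_assoc]; exact hf _) ih
  have : ∀ c, ∃ n, ∀ m, f (c + s * n) ≤ f (c + s * m) := by
    intro c
    obtain ⟨_, ⟨n, rfl⟩, hmin⟩ := WellFounded.has_min (wellFounded_lt (α := α))
      (Set.range fun n => f (c + s * n)) ⟨_, ⟨0, rfl⟩⟩
    exact ⟨n, fun m => not_lt.mp (hmin _ ⟨m, rfl⟩)⟩
  choose N hN using this
  refine ⟨s * ((Finset.range s).sup N + 1), fun i hi => ?_⟩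
  have hc : i % s < s := Nat.mod_lt _ hs
  have hNc : N (i % s) ≤ i / s := by
    have h1 : N (i % s) ≤ (Finset.range s).sup N := Finset.le_sup (Finset.mem_range.mpr hc)
    have h2 : (Finset.range s).sup N + 1 ≤ i / s := by
      rw [Nat.le_div_iff_mul_le hs, mul_comm]; exact hi
    omega
  have hi' : i % s + s * (i / s) = i := Nat.mod_add_div i s
  refine le_antisymm (hf i) ?_
  calc f i = f (i % s + s * (i / s)) := by rw [hi']
    _ ≤ f (i % s + s * N (i % s)) := hmono _ _ _ hNc
    _ ≤ f (i % s + s * (i / s + 1)) := hN _ _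
    _ = f (i + s) := by rw [Nat.mul_succ, ← add_assoc, hi']

section Window

variable {B T : Type*} [CommRing B] [Field T] [Algebra B T]

/-- Evaluation of polynomials in the first `i` variables along a sequence. -/
noncomputable def evalVars (b : ℕ → T) (i : ℕ) : firstVars B i →+* T :=
  (MvPolynomial.aeval b : MvPolynomial ℕ B →ₐ[B] T).toRingHom.comp
    (firstVars B i).val.toRingHom

/-- `P` is a nontrivial algebraic relation of `b i` over the preceding elements. -/
def IsRelation (b : ℕ → T) (i : ℕ) (P : Polynomial (firstVars B i)) : Prop :=
  P.map (evalVars b i) ≠ 0 ∧ P.eval₂ (evalVars b i) (b i) = 0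

/-- The degree of `b i` over the preceding elements. -/
noncomputable def relDegree (B : Type*) {T : Type*} [CommRing B] [Field T] [Algebra B T]
    (b : ℕ → T) (i : ℕ) : ℕ∞ :=
  sInf {n | ∃ P : Polynomial (firstVars B i), IsRelation b i P ∧
    n = (P.map (evalVars b i)).natDegree}

theorem relDegree_le {b : ℕ → T} {i : ℕ} {P : Polynomial (firstVars B i)}
    (h : IsRelation b i P) : relDegree B b i ≤ (P.map (evalVars b i)).natDegree :=
  sInf_le ⟨P, h, rfl⟩

theorem exists_relation_of_relDegree_ne_top {b : ℕ → T} {i : ℕ} (h : relDegree B b i ≠ ⊤) :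
    ∃ P : Polynomial (firstVars B i), IsRelation b i P ∧
      relDegree B b i = (P.map (evalVars b i)).natDegree := by
  have hne : {n : ℕ∞ | ∃ P : Polynomial (firstVars B i), IsRelation b i P ∧
    n = (P.map (evalVars b i)).natDegree}.Nonempty := by
    by_contra hemp
    rw [Set.not_nonempty_iff_eq_empty] at hemp
    apply h
    rw [relDegree, hemp, sInf_empty]
  exact csInf_mem hne

theorem eval₂_evalVars (b : ℕ → T) (i : ℕ) (P : Polynomial (firstVars B i)) :
    P.eval₂ (evalVars b i) (b i) =
      MvPolynomial.aeval b (Polynomial.aeval (MvPolynomial.X i : MvPolynomial ℕ B) P) := by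
  rw [Polynomial.aeval_def]
  have := Polynomial.hom_eval₂ P (algebraMap (firstVars B i) (MvPolynomial ℕ B))
    ((MvPolynomial.aeval b : MvPolynomial ℕ B →ₐ[B] T) : MvPolynomial ℕ B →+* T)
    (MvPolynomial.X i)
  simp only [RingHom.coe_coe, MvPolynomial.aeval_X] at this
  rw [this]
  rfl

variable (τB : B →+* B) (τ : T →+* T)

theorem evalVars_comp_seqShiftVars
    (hτ : ∀ x, τ (algebraMap B T x) = algebraMap B T (τB x))
    {b : ℕ → T} {s : ℕ} (hb : ∀ i, b (i + s) = τ (b i)) (i : ℕ) :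
    (evalVars b (i + s)).comp (seqShiftVars τB s i) = τ.comp (evalVars b i) := by
  ext x
  exact aeval_seqShift τB τ hτ b s hb _

theorem IsRelation.shift
    (hτ : ∀ x, τ (algebraMap B T x) = algebraMap B T (τB x))
    {b : ℕ → T} {s : ℕ} (hb : ∀ i, b (i + s) = τ (b i))
    {i : ℕ} {P : Polynomial (firstVars B i)} (h : IsRelation b i P) :
    IsRelation b (i + s) (P.map (seqShiftVars τB s i)) ∧
    ((P.map (seqShiftVars τB s i)).map (evalVars b (i + s))).natDegree =
      (P.map (evalVars b i)).natDegree := by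
  have h1 : (P.map (seqShiftVars τB s i)).map (evalVars b (i + s)) =
      (P.map (evalVars b i)).map τ := by
    rw [Polynomial.map_map, evalVars_comp_seqShiftVars τB τ hτ hb, ← Polynomial.map_map]
  refine ⟨⟨?_, ?_⟩, ?_⟩
  · rw [h1]
    exact (Polynomial.map_ne_zero_iff τ.injective).mpr h.1
  · rw [eval₂_evalVars, aeval_map_seqShiftVars, aeval_seqShift τB τ hτ b s hb,
      ← eval₂_evalVars, h.2, map_zero]
  · rw [h1, Polynomial.natDegree_map]

theorem relDegree_add_le
    (hτ : ∀ x, τ (algebraMap B T x) = algebraMap B T (τB x))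
    {b : ℕ → T} {s : ℕ} (hb : ∀ i, b (i + s) = τ (b i)) (i : ℕ) :
    relDegree B b (i + s) ≤ relDegree B b i := by
  by_cases h : relDegree B b i = ⊤
  · rw [h]; exact le_top
  · obtain ⟨P, hP, hd⟩ := exists_relation_of_relDegree_ne_top h
    obtain ⟨h1, h2⟩ := hP.shift τB τ hτ hb
    rw [hd, ← h2]
    exact relDegree_le h1

end Window

theorem iterate_shift_seq {T : Type*} [Semiring T] (τ : T →+* T) {b : ℕ → T} {s : ℕ}
    (hb : ∀ i, b (i + s) = τ (b i)) (n i : ℕ) : b (i + s * n) = (τ ^ n) (b i) := by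
  induction n with
  | zero => simp
  | succ n ih =>
    rw [Nat.mul_succ, ← add_assoc, hb, ih, pow_succ']; rfl

theorem iterate_comm_algebraMap {B T : Type*} [CommRing B] [CommRing T] [Algebra B T]
    (τB : B →+* B) (τ : T →+* T) (hτ : ∀ x, τ (algebraMap B T x) = algebraMap B T (τB x))
    (n : ℕ) (x : B) : (τ ^ n) (algebraMap B T x) = algebraMap B T ((τB ^ n) x) := by
  induction n with
  | zero => simp
  | succ n ih =>
    rw [pow_succ', pow_succ']
    exact (congrArg τ ih).trans (hτ _)

theorem hom_aeval_X {B Ω : Type*} [CommRing B] [CommRing Ω] (e' : MvPolynomial ℕ B →+* Ω) (i : ℕ)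
    (P : Polynomial (firstVars B i)) :
    P.eval₂ (e'.comp (firstVars B i).val.toRingHom) (e' (MvPolynomial.X i)) =
      e' (Polynomial.aeval (MvPolynomial.X i : MvPolynomial ℕ B) P) := by
  rw [Polynomial.aeval_def, Polynomial.hom_eval₂]
  rfl

/-- A specialization of a sequence that is recurrent under an endomorphism can be checked on
the shifts of a fixed finite window. -/
theorem exists_window {B T : Type*} [CommRing B] [Field T] [Algebra B T]
    (τB : B →+* B) (τ : T →+* T) (hτ : ∀ x, τ (algebraMap B T x) = algebraMap B T (τB x))
    {b : ℕ → T} {s : ℕ} (hs : 1 ≤ s) (hb : ∀ i, b (i + s) = τ (b i)) :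
    ∃ (r : ℕ) (f : MvPolynomial ℕ B), f ∈ firstVars B r ∧ MvPolynomial.aeval b f ≠ 0 ∧
      ∀ (Ω : Type u) [Field Ω] (e' : MvPolynomial ℕ B →+* Ω),
        (∀ j, ∀ p ∈ firstVars B r, MvPolynomial.aeval b p = 0 → e' ((seqShift τB s)^[j] p) = 0) →
        (∀ j, e' ((seqShift τB s)^[j] f) ≠ 0) →
        ∀ p, MvPolynomial.aeval b p = 0 → e' p = 0 := by
  obtain ⟨r, hr⟩ := exists_forall_ge_add_eq (relDegree B b) hs (relDegree_add_le τB τ hτ hb)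
  have hr' : ∀ i, r ≤ i → ∀ j, relDegree B b (i + s * j) = relDegree B b i := by
    intro i hi j
    induction j with
    | zero => rfl
    | succ j ih => rw [Nat.mul_succ, ← add_assoc, hr _ (by omega), ih]
  have hex : ∀ i, ∃ P : Polynomial (firstVars B i), relDegree B b i ≠ ⊤ →
      IsRelation b i P ∧ relDegree B b i = (P.map (evalVars b i)).natDegree := by
    intro i
    by_cases h : relDegree B b i = ⊤
    · exact ⟨0, fun h' => absurd h h'⟩
    · obtain ⟨P, hP⟩ := exists_relation_of_relDegree_ne_top h
      exact ⟨P, fun _ => hP⟩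
  choose G hG using hex
  classical
  let l : ℕ → MvPolynomial ℕ B := fun i =>
    if relDegree B b i = ⊤ then 1 else ((G i).coeff ((G i).map (evalVars b i)).natDegree : firstVars B i)
  have hl : ∀ i, MvPolynomial.aeval b (l i) ≠ 0 := by
    intro i
    by_cases h : relDegree B b i = ⊤
    · simp [l, h]
    · simp only [l, h, if_false]
      have h1 := (hG i h).1.1
      have h2 : ((G i).map (evalVars b i)).leadingCoeff ≠ 0 :=
        Polynomial.leadingCoeff_ne_zero.mpr h1
      rw [Polynomial.leadingCoeff, Polynomial.coeff_map] at h2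
      exact h2
  have hlm : ∀ i, l i ∈ firstVars B i := by
    intro i
    by_cases h : relDegree B b i = ⊤
    · simp only [l, h, if_true]; exact one_mem _
    · simp only [l, h, if_false]; exact SetLike.coe_mem _
  refine ⟨r + s, ∏ i ∈ Finset.range (r + s), l i, ?_, ?_, ?_⟩
  · exact prod_mem fun i hi => firstVars_mono (Finset.mem_range.mp hi).le (hlm i)
  · rw [map_prod]
    exact Finset.prod_ne_zero_iff.mpr fun i _ => hl i
  · intro Ω _ e' hwin hf
    have hle : ∀ j, ∀ i < r + s, e' (seqShift (τB ^ j) (s * j) (l i)) ≠ 0 := by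
      intro j i hi
      have := hf j
      rw [seqShift_iterate, map_prod, map_prod] at this
      exact Finset.prod_ne_zero_iff.mp this i (Finset.mem_range.mpr hi)
    have main : ∀ i, ∀ p ∈ firstVars B i, MvPolynomial.aeval b p = 0 → e' p = 0 := by
      intro i
      induction i with
      | zero =>
        intro p hp
        exact hwin 0 p (firstVars_mono (Nat.zero_le _) hp)
      | succ i ih =>
        intro p hp h0
        by_cases hi : i + 1 ≤ r + s
        · exact hwin 0 p (firstVars_mono hi hp) h0
        obtain ⟨i0, j, h1, h2, rfl⟩ : ∃ i0 j, r ≤ i0 ∧ i0 < r + s ∧ i = i0 + s * j := by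
          refine ⟨r + (i - r) % s, (i - r) / s, Nat.le_add_right _ _, ?_, ?_⟩
          · exact Nat.add_lt_add_left (Nat.mod_lt _ hs) _
          · have := Nat.mod_add_div (i - r) s
            omega
        obtain ⟨P, rfl⟩ := exists_eval_X_of_mem_firstVars hp
        rw [← eval₂_evalVars] at h0
        rw [← hom_aeval_X]
        have hdeg := hr' i0 h1 j
        have hk : ∀ a, evalVars b (i0 + s * j) a = 0 →
            e'.comp (firstVars B (i0 + s * j)).val.toRingHom a = 0 := fun a ha => ih a a.2 ha
        by_cases htop : relDegree B b i0 = ⊤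
        · have hz : P.map (evalVars b (i0 + s * j)) = 0 := by
            by_contra hne
            have := relDegree_le (B := B) (b := b) (P := P) ⟨hne, h0⟩
            rw [hdeg, htop] at this
            exact absurd this (by simp)
          have : P.map (e'.comp (firstVars B (i0 + s * j)).val.toRingHom) = 0 := by
            ext k
            have := congrArg (fun q => q.coeff k) hz
            simp only [Polynomial.coeff_map, Polynomial.coeff_zero] at this ⊢
            exact hk _ this
          rw [← Polynomial.eval_map, this, Polynomial.eval_zero]
        · obtain ⟨hrel, hn⟩ := hG i0 htop
          obtain ⟨hs1, hs2⟩ := hrel.shift (τB ^ j) (τ ^ j) (iterate_comm_algebraMap τB τ hτ j)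
            (iterate_shift_seq τ hb j)
          refine eval₂_eq_zero_of_minimal_root (evalVars b (i0 + s * j)) _ hk (b (i0 + s * j)) _
            ((G i0).map (seqShiftVars (τB ^ j) (s * j) i0)) hs1.1 hs1.2 ?_ ?_ ?_ P h0
          · intro P' hP' hP'0
            have := relDegree_le (B := B) (b := b) (P := P') ⟨hP', hP'0⟩
            rw [hdeg, hn] at this
            rw [hs2]
            exact_mod_cast this
          · rw [hom_aeval_X, aeval_map_seqShiftVars, ← seqShift_iterate]
            apply hwin j _ (firstVars_mono (by omega) (aeval_X_mem_firstVars _))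
            rw [← eval₂_evalVars]
            exact hrel.2
          · have := hle j i0 h2
            simp only [l, htop, if_false] at this
            rw [hs2, Polynomial.coeff_map]
            exact this
    intro p
    obtain ⟨i, hi⟩ := exists_mem_firstVars p
    exact main i p hi

/-- An extension of a domain embeds into any algebraically closed extension of at least the
same transcendence degree. -/
theorem nonempty_algHom_of_trdeg_le {R Ω Ω' : Type u} [CommRing R] [IsDomain R] [Field Ω]
    [Field Ω'] [Algebra R Ω] [Algebra R Ω'] [FaithfulSMul R Ω] [FaithfulSMul R Ω']
    [IsAlgClosed Ω'] (h : Algebra.trdeg R Ω ≤ Algebra.trdeg R Ω') : Nonempty (Ω →ₐ[R] Ω') := by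
  obtain ⟨s, hs⟩ := exists_isTranscendenceBasis R Ω
  obtain ⟨t, ht⟩ := exists_isTranscendenceBasis R Ω'
  have hst : Cardinal.mk s ≤ Cardinal.mk t := by
    rw [hs.cardinalMk_eq_trdeg, ht.cardinalMk_eq_trdeg]; exact h
  obtain ⟨j⟩ := hst
  let A := Algebra.adjoin R (Set.range ((↑) : s → Ω))
  have hj : AlgebraicIndependent R (fun x : s => ((j x : t) : Ω')) := ht.1.comp j j.injective
  let f : A →ₐ[R] Ω' := (MvPolynomial.aeval fun x : s => ((j x : t) : Ω')).comp
    hs.1.aevalEquiv.symm.toAlgHom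
  have hf : Function.Injective f := by
    have : Function.Injective (MvPolynomial.aeval (R := R) fun x : s => ((j x : t) : Ω')) := hj
    exact this.comp hs.1.aevalEquiv.symm.injective
  let : Algebra A Ω' := f.toRingHom.toAlgebra
  have : IsScalarTower R A Ω' := IsScalarTower.of_algebraMap_eq fun x => (f.commutes x).symm
  have : Algebra.IsAlgebraic A Ω := hs.isAlgebraic
  have : Module.IsTorsionFree A Ω' := by
    rw [Module.isTorsionFree_iff_algebraMap_injective]
    exact hf
  exact ⟨(IsAlgClosed.lift (R := A) (S := Ω) (M := Ω')).restrictScalars R⟩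

/-- A partial homomorphism between extensions of a field `κ` extends to the whole field when the
target is algebraically closed of large enough transcendence degree. -/
theorem exists_extend_of_trdeg_le {κ Q Ω Ω' : Type u} [Field κ] [CommRing Q] [Field Ω] [Field Ω']
    [IsAlgClosed Ω'] [Algebra κ Ω] [Algebra κ Ω']
    (hfin : Algebra.trdeg κ Ω < Cardinal.aleph0)
    (hle : Algebra.trdeg κ Ω ≤ Algebra.trdeg κ Ω') (c : κ →+* Q)
    (a : Q →+* Ω) (b : Q →+* Ω') (hab : ∀ x, a x = 0 ↔ b x = 0)
    (ha : ∀ x, a (c x) = algebraMap κ Ω x)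
    (hb : ∀ x, b (c x) = algebraMap κ Ω' x) :
    ∃ τ' : Ω →+* Ω', ∀ x, τ' (a x) = b x := by
  let R := Q ⧸ RingHom.ker a
  have : (RingHom.ker a).IsPrime := RingHom.ker_isPrime a
  have : IsDomain R := Ideal.Quotient.isDomain (RingHom.ker a)
  let a' : R →+* Ω := RingHom.kerLift a
  have ha' : Function.Injective a' := RingHom.kerLift_injective a
  let b' : R →+* Ω' := Ideal.Quotient.lift (RingHom.ker a) b fun x hx => (hab x).mp hx
  have hb' : Function.Injective b' := by
    rw [injective_iff_map_eq_zero]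
    intro x hx
    obtain ⟨x, rfl⟩ := Ideal.Quotient.mk_surjective x
    have : b x = 0 := hx
    exact Ideal.Quotient.eq_zero_iff_mem.mpr ((hab x).mpr this)
  let : Algebra R Ω := a'.toAlgebra
  let : Algebra κ R := ((Ideal.Quotient.mk (RingHom.ker a)).comp c).toAlgebra
  let : Algebra R Ω' := b'.toAlgebra
  have : IsScalarTower κ R Ω := IsScalarTower.of_algebraMap_eq fun x => (ha x).symm
  have : IsScalarTower κ R Ω' := IsScalarTower.of_algebraMap_eq fun x => (hb x).symm
  have f1 : FaithfulSMul R Ω := (faithfulSMul_iff_algebraMap_injective _ _).mpr ha'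
  have f2 : FaithfulSMul R Ω' := (faithfulSMul_iff_algebraMap_injective _ _).mpr hb'
  have key : Algebra.trdeg R Ω ≤ Algebra.trdeg R Ω' := by
    have e1 := _root_.trdeg_add_eq κ R (A := Ω)
    have e2 := _root_.trdeg_add_eq κ R (A := Ω')
    rw [← e1, ← e2] at hle
    refine (Cardinal.add_le_add_iff_of_lt_aleph0 (γ := Algebra.trdeg κ R) ?_).mp
      ((add_comm _ _).trans_le (hle.trans_eq (add_comm _ _)))
    exact lt_of_le_of_lt (self_le_add_right _ _) (e1 ▸ hfin)
  obtain ⟨F⟩ := nonempty_algHom_of_trdeg_le key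
  refine ⟨F.toRingHom, fun x => ?_⟩
  exact F.commutes (Ideal.Quotient.mk _ x)

/-- A partial endomorphism of an algebraically closed field of finite transcendence degree
over a field `κ`, semilinear over an endomorphism of `κ`, extends to the whole field. -/
theorem exists_extend_endo {κ Q Ω : Type u} [Field κ] [CommRing Q] [Field Ω] [IsAlgClosed Ω]
    [Algebra κ Ω] (hfin : Algebra.trdeg κ Ω < Cardinal.aleph0) (τ : κ →+* κ) (c : κ →+* Q)
    (a b : Q →+* Ω) (hab : ∀ x, a x = 0 ↔ b x = 0)
    (ha : ∀ x, a (c x) = algebraMap κ Ω x)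
    (hb : ∀ x, b (c x) = algebraMap κ Ω (τ x)) :
    ∃ τ' : Ω →+* Ω, ∀ x, τ' (a x) = b x := by
  have hle : Algebra.trdeg κ Ω ≤
      @Algebra.trdeg κ Ω _ _ ((algebraMap κ Ω).comp τ).toAlgebra := by
    obtain ⟨s, hs⟩ := exists_isTranscendenceBasis κ Ω
    have : @AlgebraicIndependent s κ Ω (fun x : s => (x : Ω)) _ _
        ((algebraMap κ Ω).comp τ).toAlgebra := by
      refine @AlgebraicIndependent.of_ringHom_of_comp_eq s κ Ω (fun x : s => (x : Ω)) _ _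
        ((algebraMap κ Ω).comp τ).toAlgebra κ Ω _ _ _ _ _ _ _ _ _ τ (RingHom.id Ω) hs.1
        τ.injective ?_
      ext x; rfl
    rw [← hs.cardinalMk_eq_trdeg]
    exact @AlgebraicIndependent.cardinalMk_le_trdeg κ Ω _ _ ((algebraMap κ Ω).comp τ).toAlgebra
      _ _ _ this
  exact @exists_extend_of_trdeg_le κ Q Ω Ω _ _ _ _ _ _ ((algebraMap κ Ω).comp τ).toAlgebra
    hfin hle c a b hab ha hb

theorem map_aeval_eq_of_mem_firstVars {κ M Λ : Type*} [CommRing κ] [CommRing M] [CommRing Λ]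
    [Algebra κ M] [Algebra κ Λ] (f : M →ₐ[κ] Λ) {x : ℕ → M} {y : ℕ → Λ} {r : ℕ}
    (h : ∀ i < r, f (x i) = y i) {p : MvPolynomial ℕ κ} (hp : p ∈ firstVars κ r) :
    f (MvPolynomial.aeval x p) = MvPolynomial.aeval y p := by
  induction hp using Algebra.adjoin_induction with
  | mem x hx =>
    obtain ⟨i, hi, rfl⟩ := hx
    simpa using h i hi
  | algebraMap x => simp
  | add x y _ _ hx hy => simp only [map_add, hx, hy]
  | mul x y _ _ hx hy => simp only [map_mul, hx, hy]

/-- A finite window of a sequence whose relations are invariant under the shift prolongs to a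
sequence that is recurrent under an endomorphism. -/
theorem exists_prolongation {κ Λ : Type u} [Field κ] [Field Λ] [Algebra κ Λ] (τ : κ →+* κ)
    {s : ℕ} (hs : 1 ≤ s) (r : ℕ) (y : ℕ → Λ)
    (hy : ∀ p ∈ firstVars κ r, MvPolynomial.aeval y p = 0 ↔
      MvPolynomial.aeval y (seqShift τ s p) = 0) :
    ∃ (Ω : Type u) (_ : Field Ω) (_ : Algebra κ Ω) (τ' : Ω →+* Ω) (x : ℕ → Ω),
      (∀ c, τ' (algebraMap κ Ω c) = algebraMap κ Ω (τ c)) ∧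
      (∀ i, x (i + s) = τ' (x i)) ∧
      (∀ p ∈ firstVars κ (r + s), MvPolynomial.aeval x p = 0 ↔ MvPolynomial.aeval y p = 0) ∧
      Algebra.trdeg κ Ω < Cardinal.aleph0 ∧ Algebra.trdeg κ Ω ≤
        Algebra.trdeg κ (IntermediateField.adjoin κ (y '' Set.Iio (r + s))) := by
  classical
  let M := IntermediateField.adjoin κ (y '' Set.Iio (r + s))
  let Ω := AlgebraicClosure M
  let yM : ℕ → M := fun i => if h : i < r + s then
    ⟨y i, IntermediateField.subset_adjoin κ _ ⟨i, h, rfl⟩⟩ else 0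
  have hyM : ∀ p ∈ firstVars κ (r + s), M.val (MvPolynomial.aeval yM p) =
      MvPolynomial.aeval y p := fun p hp =>
    map_aeval_eq_of_mem_firstVars M.val (fun i hi => by simp [yM, hi]) hp
  let y' : ℕ → Ω := fun i => algebraMap M Ω (yM i)
  have hy' : ∀ p : MvPolynomial ℕ κ, MvPolynomial.aeval y' p =
      algebraMap M Ω (MvPolynomial.aeval yM p) := by
    intro p
    exact (MvPolynomial.comp_aeval_apply (f := yM) (IsScalarTower.toAlgHom κ M Ω) p).symm
  have hzero : ∀ p ∈ firstVars κ (r + s), MvPolynomial.aeval y' p = 0 ↔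
      MvPolynomial.aeval y p = 0 := by
    intro p hp
    rw [hy', ← hyM p hp, map_eq_zero]
    exact (map_eq_zero_iff M.val M.val.injective).symm
  have hfg : Algebra.trdeg κ Ω = Algebra.trdeg κ M := by
    rw [← trdeg_add_eq κ M (A := Ω), trdeg_eq_zero_iff (R := M) (A := Ω) |>.2 inferInstance, add_zero]
  have : Finite (y '' Set.Iio (r + s)) := ((Set.finite_Iio _).image y)
  have hess : Algebra.EssFiniteType κ M := by
    rw [IntermediateField.essFiniteType_iff]
    exact IntermediateField.fg_adjoin_of_finite ((Set.finite_Iio _).image y)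
  have hfin : Algebra.trdeg κ Ω < Cardinal.aleph0 := by
    rw [hfg]
    exact finTrdeg_iff_trdeg.mp inferInstance
  obtain ⟨τ', hτ'⟩ := exists_extend_endo hfin τ (algebraMap κ (firstVars κ r))
    ((MvPolynomial.aeval y' : MvPolynomial ℕ κ →ₐ[κ] Ω).toRingHom.comp
      (firstVars κ r).val.toRingHom)
    (((MvPolynomial.aeval y' : MvPolynomial ℕ κ →ₐ[κ] Ω).toRingHom.comp (seqShift τ s)).comp
      (firstVars κ r).val.toRingHom)
    (fun x => (hzero _ (firstVars_mono (Nat.le_add_right _ _) x.2)).trans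
      ((hy _ x.2).trans (hzero _ (seqShift_mem_firstVars τ s x.2)).symm))
    (fun c => by simp) (fun c => by simp)
  have hC : ∀ c, τ' (algebraMap κ Ω c) = algebraMap κ Ω (τ c) := by
    intro c
    simpa using hτ' (algebraMap κ _ c)
  have hX : ∀ i < r, τ' (y' i) = y' (i + s) := by
    intro i hi
    simpa using hτ' ⟨_, X_mem_firstVars hi⟩
  let x : ℕ → Ω := fun i => τ'^[i / s] (y' (i % s))
  have hx : ∀ i, x (i + s) = τ' (x i) := by
    intro i
    simp only [x]
    rw [Nat.add_div_right _ hs, Nat.add_mod_right, Function.iterate_succ_apply']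
  have hxy : ∀ i, i < r + s → x i = y' i := by
    intro i
    induction i using Nat.strong_induction_on with
    | _ i ih =>
      intro hi
      by_cases h : i < s
      · simp [x, Nat.div_eq_of_lt h, Nat.mod_eq_of_lt h]
      · obtain ⟨j, rfl⟩ := Nat.exists_eq_add_of_le' (not_lt.mp h)
        rw [hx, ih j (by omega) (by omega), hX j (by omega)]
  refine ⟨Ω, inferInstance, inferInstance, τ', x, hC, hx, fun p hp => ?_, hfin, ?_⟩
  · rw [← hzero p hp, ← map_aeval_eq_of_mem_firstVars (AlgHom.id κ Ω) (x := x) (y := y') hxy hp]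
    rfl
  · exact hfg.le

/-- If finitely many algebraically independent elements are algebraic over an equally indexed
family, then that family is algebraically independent as well. -/
theorem algebraicIndependent_of_isAlgebraic_adjoin {κ Λ ι : Type*} [Field κ] [Field Λ]
    [Algebra κ Λ] [Finite ι] {u v : ι → Λ} (hu : AlgebraicIndependent κ u)
    (h : ∀ a, IsAlgebraic (Algebra.adjoin κ (Set.range v)) (u a)) :
    AlgebraicIndependent κ v := by
  have hui : Function.Injective u := hu.injective
  have h1 : (AlgebraicIndependent.matroid κ Λ).Indep (Set.range u) :=
    AlgebraicIndependent.matroid_indep_iff.mpr hu.to_subtype_range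
  have h2 : Set.range u ⊆ (AlgebraicIndependent.matroid κ Λ).closure (Set.range v) := by
    rw [AlgebraicIndependent.matroid_closure_eq]
    rintro _ ⟨a, rfl⟩
    exact h a
  have h3 := h1.encard_le_eRk_of_subset h2
  rw [Matroid.eRk_closure_eq] at h3
  have h4 : (Set.range u).encard = ENat.card ι := by
    rw [← Set.image_univ, hui.encard_image, Set.encard_univ]
  have h5 : (Set.range v).encard ≤ ENat.card ι := by
    rw [← Set.image_univ, ← Set.encard_univ]
    exact Set.encard_image_le _ _
  rw [h4] at h3
  have h6 := Matroid.eRk_le_encard (AlgebraicIndependent.matroid κ Λ) (Set.range v)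
  have h7 : (Set.range v).encard = ENat.card ι := le_antisymm h5 (h3.trans h6)
  have h8 : (AlgebraicIndependent.matroid κ Λ).Indep (Set.range v) := by
    rw [Matroid.indep_iff_eRk_eq_encard_of_finite (Set.finite_range v)]
    exact le_antisymm h6 (h7.trans_le h3)
  have hvi : Function.Injective v := by
    rw [← Set.injOn_univ]
    refine Set.Finite.injOn_of_encard_image_eq Set.finite_univ ?_
    rw [Set.image_univ, h7, Set.encard_univ]
  exact AlgebraicIndependent.of_subtype_range hvi (AlgebraicIndependent.matroid_indep_iff.mp h8)

/-- Existence of places: a homomorphism from a subring of a field `T` to a field `L` extends to a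
valuation ring of `T`, after enlarging `L`. -/
theorem exists_place {A T L : Type u} [CommRing A] [Field T] [Field L] (j : A →+* T)
    (hj : Function.Injective j) (ρ : A →+* L) :
    ∃ (Λ : Type u) (_ : Field Λ) (i : L →+* Λ) (O : Subring T) (H : O →+* Λ),
      (∀ a, ∃ h : j a ∈ O, H ⟨j a, h⟩ = i (ρ a)) ∧
      (∀ x : O, H x ≠ 0 → (x : T)⁻¹ ∈ O) ∧
      (∀ x : T, IsIntegral O x → x ∈ O) := by
  have : (RingHom.ker ρ).IsPrime := RingHom.ker_isPrime ρ
  let R := Localization.AtPrime (RingHom.ker ρ)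
  have hne : ∀ y : (RingHom.ker ρ).primeCompl, ρ y ≠ 0 := fun y hy => y.2 hy
  let f : R →+* T := IsLocalization.lift (M := (RingHom.ker ρ).primeCompl) (g := j) (by
    intro y
    refine IsUnit.mk0 _ fun h => hne y ?_
    rw [(map_eq_zero_iff j hj).mp h, map_zero])
  let g : R →+* L := IsLocalization.lift (M := (RingHom.ker ρ).primeCompl) (g := ρ)
    fun y => IsUnit.mk0 _ (hne y)
  have hg : ∀ x : R, g x ≠ 0 → IsUnit x := by
    intro x hx
    obtain ⟨a, s, rfl⟩ := IsLocalization.exists_mk'_eq (RingHom.ker ρ).primeCompl x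
    rw [IsLocalization.AtPrime.isUnit_mk'_iff (S := R) (RingHom.ker ρ)]
    intro ha
    apply hx
    simp only [g, IsLocalization.lift_mk']
    rw [(RingHom.mem_ker).mp ha, zero_mul]
  have : IsLocalHom g := ⟨fun x hx => hg x hx.ne_zero⟩
  obtain ⟨O, hO, hloc⟩ := IsLocalRing.exists_factor_valuationRing f
  let fO : R →+* O := f.codRestrict O.toSubring hO
  have hloc' : IsLocalHom fO := hloc
  let E := IsLocalRing.ResidueField R
  let : Algebra E (IsLocalRing.ResidueField O) := (IsLocalRing.ResidueField.map fO).toAlgebra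
  let : Algebra E L := (IsLocalRing.ResidueField.lift g).toAlgebra
  let D := (IsLocalRing.ResidueField O) ⊗[E] L
  obtain ⟨m, hm⟩ := Ideal.exists_maximal D
  let : Field (D ⧸ m) := Ideal.Quotient.field m
  let H : O →+* D ⧸ m := ((Ideal.Quotient.mk m).comp
      (Algebra.TensorProduct.includeLeft : IsLocalRing.ResidueField O →ₐ[E] D).toRingHom).comp
      (IsLocalRing.residue O)
  have hfj : ∀ a, f (algebraMap A R a) = j a := fun a => IsLocalization.lift_eq _ a
  refine ⟨D ⧸ m, inferInstance, (Ideal.Quotient.mk m).comp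
    (Algebra.TensorProduct.includeRight : L →ₐ[E] D).toRingHom, O.toSubring, H, ?_, ?_, ?_⟩
  · intro a
    refine ⟨hfj a ▸ hO _, ?_⟩
    have h1 : (⟨j a, hfj a ▸ hO _⟩ : O) = fO (algebraMap A R a) := Subtype.ext (hfj a).symm
    have h2 : ρ a = g (algebraMap A R a) := (IsLocalization.lift_eq _ a).symm
    refine (congrArg H h1).trans ?_
    rw [h2]
    have h3 := (Algebra.TensorProduct.includeLeft : IsLocalRing.ResidueField O →ₐ[E] D).commutes
      (IsLocalRing.residue R (algebraMap A R a))
    have h4 := (Algebra.TensorProduct.includeRight : L →ₐ[E] D).commutes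
      (IsLocalRing.residue R (algebraMap A R a))
    exact congrArg (Ideal.Quotient.mk m) (h3.trans h4.symm)
  · intro x hx
    have hu : IsUnit (x : O) := by
      by_contra hn
      apply hx
      have : IsLocalRing.residue O x = 0 := (IsLocalRing.residue_eq_zero_iff _).mpr
        ((IsLocalRing.mem_maximalIdeal _).mpr hn)
      simp only [H, RingHom.comp_apply, this, map_zero]
    obtain ⟨y, hy⟩ := hu.exists_right_inv
    have : (x : T) * (y : T) = 1 := congrArg Subtype.val hy
    rw [inv_eq_of_mul_eq_one_right this]
    exact y.2
  · intro x hx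
    exact LocalSubring.mem_of_isMax_of_isIntegral O.isMax_toLocalSubring hx

theorem exists_eval₂_eq_zero_of_isAlgebraic_adjoin {B T ι : Type*} [CommRing B] [CommRing T]
    [Algebra B T] {z : ι → T} {x : T} (h : IsAlgebraic (Algebra.adjoin B (Set.range z)) x) :
    ∃ P : Polynomial (MvPolynomial ι B),
      P.eval₂ (MvPolynomial.aeval z : MvPolynomial ι B →ₐ[B] T).toRingHom x = 0 ∧
      MvPolynomial.aeval z P.leadingCoeff ≠ 0 := by
  rw [Algebra.adjoin_range_eq_range_aeval] at h
  obtain ⟨p, hp0, hp⟩ := h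
  let f := (MvPolynomial.aeval z : MvPolynomial ι B →ₐ[B] T).rangeRestrict.toRingHom
  have hf : Function.Surjective f := AlgHom.rangeRestrict_surjective _
  obtain ⟨P, hP, hdeg⟩ := Polynomial.exists_degree_eq_of_mem_lifts
    ((Polynomial.lifts_iff_coeff_lifts p).mpr fun n => hf (p.coeff n) : p ∈ Polynomial.lifts f)
  have hlc : f P.leadingCoeff = p.leadingCoeff := by
    rw [← hP, Polynomial.leadingCoeff, ← Polynomial.coeff_map, hP, Polynomial.natDegree,
      hdeg]
    rfl
  refine ⟨P, ?_, fun h => hp0 ?_⟩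
  · rw [← hP, Polynomial.aeval_def, Polynomial.eval₂_map] at hp
    exact hp
  · rw [← Polynomial.leadingCoeff_eq_zero, ← hlc]
    exact Subtype.ext h

theorem mem_of_eval₂_eq_zero {C T : Type*} [CommRing C] [Field T] {O : Subring T}
    (hO : ∀ x : T, IsIntegral O x → x ∈ O) (ρ : C →+* O) (f : C →+* T) (τ : T →+* T)
    (hρ : ∀ c, (ρ c : T) = τ (f c)) {x : T} {P : Polynomial C} (hP : P.eval₂ f x = 0)
    (h0 : ρ P.leadingCoeff ≠ 0) (hinv : (ρ P.leadingCoeff : T)⁻¹ ∈ O) : τ x ∈ O := by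
  have h1 : Polynomial.aeval (τ x) (P.map ρ) = 0 := by
    rw [Polynomial.aeval_def, Polynomial.eval₂_map]
    have : (algebraMap O T).comp ρ = τ.comp f := RingHom.ext hρ
    rw [this, ← Polynomial.hom_eval₂, hP, map_zero]
  have h2 := isIntegral_leadingCoeff_smul _ _ h1
  rw [Polynomial.leadingCoeff_map_of_leadingCoeff_ne_zero _ h0] at h2
  have h3 := O.mul_mem hinv (hO _ h2)
  have h4 : (ρ P.leadingCoeff : T) ≠ 0 := fun h => h0 (Subtype.ext h)
  rwa [Subring.smul_def, smul_eq_mul, inv_mul_cancel_left₀ h4] at h3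

/-- Let `z` be algebraically independent over `B` such that `z` and `τ z` are algebraic over each
other. For generic homomorphisms from `B` to a field there is a place whose values on the
orbit of `z` are algebraically independent and which is finite on the orbits of any given finite
set of algebraic elements. -/
theorem exists_place_orbit {B T : Type u} {ι : Type u} [Finite ι] [CommRing B] [IsDomain B]
    [Field T] [Algebra B T] [FaithfulSMul B T]
    (τB : B →+* B) (τ : T →+* T) (hτ : ∀ x, τ (algebraMap B T x) = algebraMap B T (τB x))
    (z : ι → T) (hz : AlgebraicIndependent B z)
    (hz1 : ∀ a, IsAlgebraic (Algebra.adjoin B (Set.range z)) (τ (z a)))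
    (hz2 : ∀ a, IsAlgebraic (Algebra.adjoin B (Set.range fun a => τ (z a))) (z a))
    (X : Finset T) (hX : ∀ x ∈ X, IsAlgebraic (Algebra.adjoin B (Set.range z)) x) :
    ∃ g : B, g ≠ 0 ∧ ∀ (κ : Type u) [Field κ] (hB : B →+* κ), (∀ j, hB (τB^[j] g) ≠ 0) →
      ∃ (Λ : Type u) (_ : Field Λ) (_ : Algebra κ Λ) (O : Subring T) (H : O →+* Λ),
        (∀ b, ∃ h : algebraMap B T b ∈ O, H ⟨algebraMap B T b, h⟩ = algebraMap κ Λ (hB b)) ∧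
        (∀ x : O, H x ≠ 0 → (x : T)⁻¹ ∈ O) ∧
        (∀ j, ∀ x ∈ X, τ^[j] x ∈ O) ∧
        ∃ zO : ℕ → ι → O, (∀ j a, (zO j a : T) = τ^[j] (z a)) ∧
          ∀ j, AlgebraicIndependent κ (fun a => H (zO j a)) := by
  classical
  have := Fintype.ofFinite ι
  choose G hG hGlc using fun a => exists_eval₂_eq_zero_of_isAlgebraic_adjoin (hz2 a)
  let c : ι → T := fun a => MvPolynomial.aeval (fun a => τ (z a)) (G a).leadingCoeff
  have hc : ∀ a, IsAlgebraic (Algebra.adjoin B (Set.range z)) (c a)⁻¹ := by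
    intro a
    apply IsAlgebraic.inv
    have h1 : c a ∈ Algebra.adjoin B (Set.range fun a => τ (z a)) := by
      rw [Algebra.adjoin_range_eq_range_aeval]
      exact ⟨_, rfl⟩
    have h2 : Algebra.adjoin B (Set.range fun a => τ (z a)) ≤
        (Subalgebra.algebraicClosure (Algebra.adjoin B (Set.range z)) T).restrictScalars B := by
      apply Algebra.adjoin_le
      rintro _ ⟨a, rfl⟩
      exact hz1 a
    exact h2 h1
  let X' : Finset T := X ∪ (Finset.univ.image fun a => τ (z a)) ∪
    (Finset.univ.image fun a => (c a)⁻¹)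
  have hX' : ∀ x : X', IsAlgebraic (Algebra.adjoin B (Set.range z)) (x : T) := by
    rintro ⟨x, hx⟩
    simp only [X', Finset.mem_union, Finset.mem_image, Finset.mem_univ, true_and] at hx
    rcases hx with (hx | ⟨a, rfl⟩) | ⟨a, rfl⟩
    · exact hX x hx
    · exact hz1 a
    · exact hc a
  choose P hP hPlc using fun x => exists_eval₂_eq_zero_of_isAlgebraic_adjoin (hX' x)
  let F : MvPolynomial ι B := ∏ x, (P x).leadingCoeff
  have hF : F ≠ 0 := Finset.prod_ne_zero_iff.mpr fun x _ h => hPlc x (by rw [h, map_zero])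
  obtain ⟨m, hm⟩ := MvPolynomial.ne_zero_iff.mp hF
  refine ⟨F.coeff m, hm, fun κ _ hB hg => ?_⟩
  let L := FractionRing (MvPolynomial ι κ)
  obtain ⟨Λ, _, i, O, H, hO1, hO2, hO3⟩ := exists_place
    (MvPolynomial.aeval z : MvPolynomial ι B →ₐ[B] T).toRingHom hz
    ((algebraMap (MvPolynomial ι κ) L).comp (MvPolynomial.map hB))
  let : Algebra κ Λ := (i.comp ((algebraMap (MvPolynomial ι κ) L).comp MvPolynomial.C)).toAlgebra
  have hOB : ∀ b, ∃ h : algebraMap B T b ∈ O,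
      H ⟨algebraMap B T b, h⟩ = algebraMap κ Λ (hB b) := by
    intro b
    have h := hO1 (MvPolynomial.C b)
    simp only [AlgHom.toRingHom_eq_coe, RingHom.coe_coe, MvPolynomial.aeval_C,
      RingHom.comp_apply, MvPolynomial.map_C] at h
    exact h
  choose hOB hHB using hOB
  refine ⟨Λ, inferInstance, inferInstance, O, H, fun b => ⟨hOB b, hHB b⟩, hO2, ?_⟩
  let cO : B →+* O := (algebraMap B T).codRestrict O hOB
  have hHcO : ∀ b, H (cO b) = algebraMap κ Λ (hB b) := hHB
  have hstep : ∀ j (zO : ι → O), (∀ a, (zO a : T) = τ^[j] (z a)) →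
      AlgebraicIndependent κ (fun a => H (zO a)) → ∀ x : X', τ^[j] x ∈ O := by
    intro j zO hzO hind x
    let ρ : MvPolynomial ι B →+* O := MvPolynomial.eval₂Hom (cO.comp (τB ^ j)) zO
    have hρ : ∀ p, (ρ p : T) = (τ ^ j) (MvPolynomial.aeval z p) := by
      intro p
      have : O.subtype.comp ρ = (τ ^ j).comp
          (MvPolynomial.aeval z : MvPolynomial ι B →ₐ[B] T).toRingHom := by
        apply MvPolynomial.ringHom_ext
        · intro b
          simpa [ρ, cO, RingHom.coe_pow] using (iterate_comm_algebraMap τB τ hτ j b).symm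
        · intro a
          simp [ρ, hzO, RingHom.coe_pow]
      exact RingHom.congr_fun this p
    have hρF : H (ρ F) ≠ 0 := by
      have h1 : ∀ p, H (ρ p) = MvPolynomial.aeval (fun a => H (zO a))
          (MvPolynomial.map (hB.comp (τB ^ j)) p) := by
        intro p
        have : H.comp ρ = ((MvPolynomial.aeval (fun a => H (zO a)) : MvPolynomial ι κ →ₐ[κ] Λ) :
            MvPolynomial ι κ →+* Λ).comp (MvPolynomial.map (hB.comp (τB ^ j))) := by
          apply MvPolynomial.ringHom_ext
          · intro b
            simpa [ρ] using hHcO ((τB ^ j) b)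
          · intro a
            simp [ρ]
        exact RingHom.congr_fun this p
      rw [h1]
      intro h0
      have h2 := hind.eq_zero_of_aeval_eq_zero _ h0
      have h3 := congrArg (MvPolynomial.coeff m) h2
      rw [MvPolynomial.coeff_map, MvPolynomial.coeff_zero] at h3
      exact hg j (by simpa [RingHom.coe_pow] using h3)
    have hlc : H (ρ (P x).leadingCoeff) ≠ 0 := by
      intro h0
      apply hρF
      have : (P x).leadingCoeff ∣ F := Finset.dvd_prod_of_mem _ (Finset.mem_univ x)
      obtain ⟨q, hq⟩ := this
      rw [hq, map_mul, map_mul, h0, zero_mul]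
    have := mem_of_eval₂_eq_zero hO3 ρ
      (MvPolynomial.aeval z : MvPolynomial ι B →ₐ[B] T).toRingHom (τ ^ j) hρ (hP x)
      (fun h => hlc (by rw [h, map_zero])) (hO2 _ hlc)
    simpa [RingHom.coe_pow] using this
  have hind : ∀ j, ∃ zO : ι → O, (∀ a, (zO a : T) = τ^[j] (z a)) ∧
      AlgebraicIndependent κ (fun a => H (zO a)) := by
    intro j
    induction j with
    | zero =>
      have h := fun a => hO1 (MvPolynomial.X a)
      simp only [AlgHom.toRingHom_eq_coe, RingHom.coe_coe, MvPolynomial.aeval_X,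
        RingHom.comp_apply, MvPolynomial.map_X] at h
      choose h1 h2 using h
      refine ⟨fun a => ⟨z a, h1 a⟩, fun a => rfl, ?_⟩
      have h3 : (fun a => H ⟨z a, h1 a⟩) =
          fun a => i (algebraMap _ L (MvPolynomial.X a)) := funext h2
      rw [h3]
      have h4 : ∀ p : MvPolynomial ι κ, MvPolynomial.aeval
          (fun a => i (algebraMap (MvPolynomial ι κ) L (MvPolynomial.X a))) p =
          i (algebraMap _ L p) := by
        intro p
        have : (MvPolynomial.aeval (fun a => i (algebraMap (MvPolynomial ι κ) L
            (MvPolynomial.X a))) : MvPolynomial ι κ →ₐ[κ] Λ).toRingHom =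
            i.comp (algebraMap _ L) := by
          apply MvPolynomial.ringHom_ext
          · intro b
            simp; rfl
          · intro a
            simp
        exact RingHom.congr_fun this p
      intro p q hpq
      rw [h4, h4] at hpq
      exact IsFractionRing.injective _ L (i.injective hpq)
    | succ j ih =>
      obtain ⟨zO, hzO, hi⟩ := ih
      have hmem := hstep j zO hzO hi
      have h1 : ∀ a, τ^[j + 1] (z a) ∈ O := fun a => by
        rw [Function.iterate_succ_apply]
        exact hmem ⟨τ (z a), by simp [X']⟩
      refine ⟨fun a => ⟨_, h1 a⟩, fun a => rfl, ?_⟩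
      refine algebraicIndependent_of_isAlgebraic_adjoin hi fun a => ?_
      let ρ : MvPolynomial ι B →+* O :=
        MvPolynomial.eval₂Hom (cO.comp (τB ^ j)) (fun a => ⟨_, h1 a⟩)
      have hρ : ∀ p, (ρ p : T) = (τ ^ j) (MvPolynomial.aeval (fun a => τ (z a)) p) := by
        intro p
        have : O.subtype.comp ρ = (τ ^ j).comp
            (MvPolynomial.aeval (fun a => τ (z a)) : MvPolynomial ι B →ₐ[B] T).toRingHom := by
          apply MvPolynomial.ringHom_ext
          · intro b
            simpa [ρ, cO, RingHom.coe_pow] using (iterate_comm_algebraMap τB τ hτ j b).symm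
          · intro a
            simp [ρ, RingHom.coe_pow]
        exact RingHom.congr_fun this p
      let v : ι → Λ := fun a => H ⟨_, h1 a⟩
      have hv : ∀ p, H (ρ p) ∈ Algebra.adjoin κ (Set.range v) := by
        intro p
        have : H (ρ p) = MvPolynomial.aeval v (MvPolynomial.map (hB.comp (τB ^ j)) p) := by
          have : H.comp ρ = ((MvPolynomial.aeval v : MvPolynomial ι κ →ₐ[κ] Λ) :
              MvPolynomial ι κ →+* Λ).comp (MvPolynomial.map (hB.comp (τB ^ j))) := by
            apply MvPolynomial.ringHom_ext
            · intro b
              simpa [ρ] using hHcO ((τB ^ j) b)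
            · intro a
              simp [ρ, v]
          exact RingHom.congr_fun this p
        rw [this, Algebra.adjoin_range_eq_range_aeval]
        exact ⟨_, rfl⟩
      have hlc : H (ρ (G a).leadingCoeff) ≠ 0 := by
        have h2 := hmem ⟨(c a)⁻¹, by simp [X']⟩
        have h3 : ρ (G a).leadingCoeff * ⟨_, h2⟩ = 1 := by
          apply Subtype.ext
          have h4 : (ρ (G a).leadingCoeff : T) = τ^[j] (c a) := by
            rw [hρ, RingHom.coe_pow]
          change (ρ (G a).leadingCoeff : T) * τ^[j] (c a)⁻¹ = 1
          rw [h4, ← iterate_map_mul, mul_inv_cancel₀ (hGlc a), iterate_map_one]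
        intro h0
        have := congrArg H h3
        rw [map_mul, h0, zero_mul, map_one] at this
        exact zero_ne_one this
      let ρ' : MvPolynomial ι B →+* Algebra.adjoin κ (Set.range v) :=
        (H.comp ρ).codRestrict _ hv
      refine ⟨(G a).map ρ', ?_, ?_⟩
      · intro h0
        apply hlc
        have := congrArg (fun p => (Polynomial.coeff p (G a).natDegree)) h0
        simp only [Polynomial.coeff_map, Polynomial.coeff_zero] at this
        exact congrArg Subtype.val this
      · rw [Polynomial.aeval_def, Polynomial.eval₂_map]
        have h2 : (algebraMap (Algebra.adjoin κ (Set.range v)) Λ).comp ρ' = H.comp ρ := rfl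
        rw [h2, ← Polynomial.hom_eval₂]
        convert map_zero H
        apply Subtype.ext
        have h3 : O.subtype ((G a).eval₂ ρ (zO a)) =
            (G a).eval₂ (O.subtype.comp ρ) (O.subtype (zO a)) :=
          Polynomial.hom_eval₂ _ ρ O.subtype _
        have h4 : O.subtype.comp ρ = (τ ^ j).comp
            (MvPolynomial.aeval (fun a => τ (z a)) : MvPolynomial ι B →ₐ[B] T).toRingHom :=
          RingHom.ext hρ
        have h5 : O.subtype (zO a) = (τ ^ j) (z a) := by
          rw [RingHom.coe_pow]; exact hzO a
        refine h3.trans ?_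
        rw [h4, h5, ← Polynomial.hom_eval₂, hG, map_zero]
        rfl
  choose zO hzO hzi using hind
  refine ⟨fun j x hx => hstep j (zO j) (hzO j) (hzi j) ⟨x, by simp [X', hx]⟩, zO, hzO, hzi⟩

theorem IsAlgebraic.adjoin_map_endo {B T : Type*} [CommRing B] [Field T] [Algebra B T]
    (τB : B →+* B) (τ : T →+* T) (hτ : ∀ x, τ (algebraMap B T x) = algebraMap B T (τB x))
    {I : Set T} {x : T} (h : IsAlgebraic (Algebra.adjoin B I) x) :
    IsAlgebraic (Algebra.adjoin B (τ '' I)) (τ x) := by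
  have hmem : ∀ y : Algebra.adjoin B I, τ y ∈ Algebra.adjoin B (τ '' I) := by
    rintro ⟨y, hy⟩
    induction hy using Algebra.adjoin_induction with
    | mem x hx => exact Algebra.subset_adjoin ⟨x, hx, rfl⟩
    | algebraMap b => simp only [hτ]; exact Subalgebra.algebraMap_mem _ _
    | add x y _ _ hx hy => simp only [map_add]; exact add_mem hx hy
    | mul x y _ _ hx hy => simp only [map_mul]; exact mul_mem hx hy
  let f : Algebra.adjoin B I →+* Algebra.adjoin B (τ '' I) :=
    (τ.comp (Algebra.adjoin B I).val.toRingHom).codRestrict _ hmem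
  have hf : Function.Injective f := fun a b hab =>
    Subtype.ext (τ.injective (congrArg Subtype.val hab))
  obtain ⟨p, hp0, hp⟩ := h
  refine ⟨p.map f, (Polynomial.map_ne_zero_iff hf).mpr hp0, ?_⟩
  rw [Polynomial.aeval_def, Polynomial.eval₂_map]
  have : (algebraMap (Algebra.adjoin B (τ '' I)) T).comp f =
    τ.comp (algebraMap (Algebra.adjoin B I) T) := rfl
  rw [this, ← Polynomial.hom_eval₂, ← Polynomial.aeval_def, hp, map_zero]

/-- Far enough along a recurrent sequence, its tails have a transcendence basis which is
interalgebraic with its image under the endomorphism. -/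
theorem exists_stable_basis {B T : Type u} [CommRing B] [IsDomain B]
    [Field T] [Algebra B T] [FaithfulSMul B T] (hfin : Algebra.trdeg B T < Cardinal.aleph0)
    (τB : B →+* B) (τ : T →+* T) (hτ : ∀ x, τ (algebraMap B T x) = algebraMap B T (τB x))
    {x : ℕ → T} {s : ℕ} (hx : ∀ i, x (i + s) = τ (x i)) :
    ∃ (q : ℕ) (ι : Type u) (_ : Finite ι) (idx : ι → ℕ),
      AlgebraicIndependent B (fun a => x (idx a + s * q)) ∧
      (∀ a, IsAlgebraic (Algebra.adjoin B (Set.range fun a => τ (x (idx a + s * q))))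
        (x (idx a + s * q))) ∧
      ∀ i, IsAlgebraic (Algebra.adjoin B (Set.range fun a => x (idx a + s * q)))
        (x (i + s * q)) := by
  let M := AlgebraicIndependent.matroid B T
  have hME : M.E = Set.univ := rfl
  let X : ℕ → Set T := fun q => Set.range fun i => x (i + s * q)
  have hXs : ∀ q, X (q + 1) = τ '' X q := by
    intro q
    ext t
    simp only [X, Set.mem_range, Set.mem_image, exists_exists_eq_and]
    refine exists_congr fun i => ?_
    rw [← hx, mul_add, mul_one, add_assoc]
  have hXle : ∀ q, X (q + 1) ⊆ X q := by
    rintro q _ ⟨i, rfl⟩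
    exact ⟨i + s, by simp only [mul_add, mul_one]; congr 1; ring⟩
  obtain ⟨q, hq⟩ : ∃ q, ∀ q', M.eRk (X q) ≤ M.eRk (X q') :=
    ⟨_, fun q' => Function.argmin_le (fun q => M.eRk (X q)) q'⟩
  obtain ⟨I, hI⟩ := M.exists_isBasis (X q)
  have hI' := AlgebraicIndependent.matroid_isBasis_iff.mp hI
  have hIfin : I.Finite := by
    have h1 : AlgebraicIndependent B ((↑) : I → T) := hI'.1
    have := h1.cardinalMk_le_trdeg
    exact Set.finite_coe_iff.mp (Cardinal.lt_aleph0_iff_finite.mp (this.trans_lt hfin))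
  have hcl : X (q + 1) ⊆ M.closure (τ '' I) := by
    rw [hXs, AlgebraicIndependent.matroid_closure_eq]
    rintro _ ⟨y, hy, rfl⟩
    exact (hI'.2.2 y hy).adjoin_map_endo τB τ hτ
  have hτI : τ '' I ⊆ X q := ((Set.image_mono hI'.2.1).trans_eq (hXs q).symm).trans (hXle q)
  have h1 : M.eRk (X q) ≤ M.eRk (τ '' I) := by
    rw [← M.eRk_closure_eq (τ '' I)]
    exact (hq (q + 1)).trans (M.eRk_mono hcl)
  have h2 : M.closure (τ '' I) = M.closure (X q) :=
    (M.isRkFinite_of_finite (hIfin.image τ)).closure_eq_closure_of_subset_of_eRk_ge_eRk hτI h1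
  choose idx hidx using fun a : I => hI'.2.1 a.2
  have hfun : (fun a : I => x (idx a + s * q)) = (fun a : I => (a : T)) := funext hidx
  have hfun' : (Set.range fun a : I => τ (x (idx a + s * q))) = τ '' I := by
    simp only [hidx]
    rw [Set.image_eq_range]
  refine ⟨q, I, hIfin.to_subtype, idx, ?_, fun a => ?_, fun i => ?_⟩
  · rw [hfun]; exact hI'.1
  · rw [hfun']
    have h3 : x (idx a + s * q) ∈ M.closure (τ '' I) := by
      rw [h2]
      exact M.subset_closure (X q) (Set.subset_univ _) ⟨idx a, rfl⟩
    rw [AlgebraicIndependent.matroid_closure_eq] at h3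
    exact h3
  · rw [hfun, Subtype.range_coe]
    exact hI'.2.2 _ ⟨i, rfl⟩

/-- A prime ideal is minimal over a smaller ideal `J` when it meets a subring `A` trivially and
the quotient by `J` is generated by elements which are algebraic over `A`. -/
theorem mem_minimalPrimes_of_isAlgebraic {κ A Q : Type*} [Field κ] [CommRing A] [IsDomain A]
    [CommRing Q] [Algebra κ A] [Algebra κ Q] [Algebra A Q] [IsScalarTower κ A Q]
    {X : Set Q} (hX : Algebra.adjoin κ X = ⊤) {J p : Ideal Q} [hp : p.IsPrime] (hJp : J ≤ p)
    (hpA : ∀ a : A, algebraMap A Q a ∈ p → a = 0)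
    (halg : ∀ x ∈ X, ∃ P : Polynomial A, P ≠ 0 ∧ Polynomial.aeval x P ∈ J) :
    p ∈ J.minimalPrimes := by
  refine ⟨⟨hp, hJp⟩, fun p' hp' hle => ?_⟩
  obtain ⟨hp'1, hJp'⟩ := hp'
  have : IsDomain (Q ⧸ p') := Ideal.Quotient.isDomain p'
  have htop : ∀ q : Q, IsAlgebraic A (Ideal.Quotient.mk p' q) := by
    intro q
    have hq : q ∈ Algebra.adjoin κ X := hX ▸ Algebra.mem_top
    induction hq using Algebra.adjoin_induction with
    | mem x hx =>
      obtain ⟨P, hP0, hP⟩ := halg x hx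
      refine ⟨P, hP0, ?_⟩
      have : Polynomial.aeval (Ideal.Quotient.mk p' x) P =
          Ideal.Quotient.mk p' (Polynomial.aeval x P) :=
        Polynomial.aeval_algHom_apply (Ideal.Quotient.mkₐ A p') x P
      rw [this, Ideal.Quotient.eq_zero_iff_mem]
      exact hJp' hP
    | algebraMap c =>
      rw [IsScalarTower.algebraMap_apply κ A Q]
      exact isAlgebraic_algebraMap (R := A) (A := Q ⧸ p') _
    | add x y _ _ hx hy => rw [map_add]; exact hx.add hy
    | mul x y _ _ hx hy => rw [map_mul]; exact hx.mul hy
  intro q hq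
  by_contra hqn
  have h1 : Ideal.Quotient.mk p' q ≠ 0 := fun h => hqn (Ideal.Quotient.eq_zero_iff_mem.mp h)
  have h2 := Ideal.comap_ne_bot_of_algebraic_mem (R := A) (I := p.map (Ideal.Quotient.mk p')) h1
    (Ideal.mem_map_of_mem _ hq) (htop q)
  apply h2
  rw [eq_bot_iff]
  intro a ha
  refine hpA a ?_
  rw [Ideal.mem_comap] at ha
  exact (Ideal.mem_quotient_iff_mem hle).mp ha

/-- The relations among windows of a sequence are eventually periodic, provided all windows are
algebraic over independent subfamilies in a uniform way. -/
theorem exists_periodic_window {κ Λ ι : Type*} [Field κ] [Field Λ] [Algebra κ Λ] (τ : κ →+* κ)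
    (s L : ℕ) (y : ℕ → Λ) (idx : ι → ℕ) (hidx : ∀ a, idx a < L)
    (hind : ∀ j, AlgebraicIndependent κ fun a => y (idx a + s * j))
    (P : ℕ → Polynomial (MvPolynomial ι κ)) (hP0 : ∀ l < L, P l ≠ 0)
    (hP : ∀ l < L, ∀ j, MvPolynomial.aeval y ((seqShift τ s)^[j]
      ((P l).eval₂ (MvPolynomial.rename idx : MvPolynomial ι κ →ₐ[κ] MvPolynomial ℕ κ).toRingHom
        (MvPolynomial.X l))) = 0) :
    ∃ i n, 1 ≤ n ∧ ∀ p ∈ firstVars κ L, MvPolynomial.aeval y ((seqShift τ s)^[i] p) = 0 ↔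
      MvPolynomial.aeval y ((seqShift τ s)^[i + n] p) = 0 := by
  let Q := MvPolynomial (Fin L) κ
  let A := MvPolynomial ι κ
  let R : Q →ₐ[κ] MvPolynomial ℕ κ := MvPolynomial.rename Fin.val
  let idx' : ι → Fin L := fun a => ⟨idx a, hidx a⟩
  let : Algebra A Q := (MvPolynomial.rename idx' : A →ₐ[κ] Q).toRingHom.toAlgebra
  have : IsScalarTower κ A Q := IsScalarTower.of_algebraMap_eq
    fun x => ((MvPolynomial.rename idx' : A →ₐ[κ] Q).commutes x).symm
  have hRA : ∀ a : A, R (algebraMap A Q a) = MvPolynomial.rename idx a := fun a =>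
    MvPolynomial.rename_rename _ _ _
  let f : ℕ → Q →+* Λ := fun j => ((MvPolynomial.aeval y : MvPolynomial ℕ κ →ₐ[κ] Λ).toRingHom.comp
    (seqShift τ s ^ j)).comp R.toRingHom
  have hf : ∀ j q, f j q = MvPolynomial.aeval y ((seqShift τ s)^[j] (R q)) := by
    intro j q
    simp [f, RingHom.coe_pow]
  let p : ℕ → Ideal Q := fun j => RingHom.ker (f j)
  let J : Ideal Q := ⨅ j, p j
  have hmin : ∀ j, p j ∈ J.minimalPrimes := by
    intro j
    have : (p j).IsPrime := RingHom.ker_isPrime _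
    refine mem_minimalPrimes_of_isAlgebraic (κ := κ) (A := A) (X := Set.range MvPolynomial.X)
      MvPolynomial.adjoin_range_X (iInf_le _ _) ?_ ?_
    · intro a ha
      have h1 : MvPolynomial.aeval y ((seqShift τ s)^[j] (MvPolynomial.rename idx a)) = 0 := by
        rw [← hRA, ← hf]; exact ha
      have h2 : MvPolynomial.aeval y ((seqShift τ s)^[j] (MvPolynomial.rename idx a)) =
          MvPolynomial.aeval (fun a => y (idx a + s * j)) (MvPolynomial.map (τ ^ j) a) := by
        rw [seqShift_iterate]
        have : ((MvPolynomial.aeval y : MvPolynomial ℕ κ →ₐ[κ] Λ).toRingHom.comp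
            (seqShift (τ ^ j) (s * j))).comp
            (MvPolynomial.rename idx : A →ₐ[κ] MvPolynomial ℕ κ).toRingHom =
            (MvPolynomial.aeval (fun a => y (idx a + s * j)) : A →ₐ[κ] Λ).toRingHom.comp
              (MvPolynomial.map (τ ^ j)) := by
          apply MvPolynomial.ringHom_ext
          · intro b
            simp
          · intro a
            simp
        exact RingHom.congr_fun this a
      rw [h2] at h1
      have h3 := (hind j).eq_zero_of_aeval_eq_zero _ h1
      exact (map_eq_zero_iff _ (MvPolynomial.map_injective _ (τ ^ j).injective)).mp h3
    · rintro _ ⟨l, rfl⟩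
      refine ⟨P l, hP0 l l.2, ?_⟩
      rw [Ideal.mem_iInf]
      intro j
      rw [RingHom.mem_ker, hf]
      have : R (Polynomial.aeval (MvPolynomial.X l) (P l)) = (P l).eval₂
          (MvPolynomial.rename idx : MvPolynomial ι κ →ₐ[κ] MvPolynomial ℕ κ).toRingHom
          (MvPolynomial.X (l : ℕ)) := by
        rw [Polynomial.aeval_def]
        have h1 := Polynomial.hom_eval₂ (P l) (algebraMap A Q) R.toRingHom (MvPolynomial.X l)
        have h2 : R.toRingHom.comp (algebraMap A Q) =
          (MvPolynomial.rename idx : MvPolynomial ι κ →ₐ[κ] MvPolynomial ℕ κ).toRingHom :=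
          RingHom.ext hRA
        have h3 : R.toRingHom (MvPolynomial.X l) = MvPolynomial.X (l : ℕ) :=
          MvPolynomial.rename_X _ _
        rw [h2, h3] at h1
        exact h1
      rw [this]
      exact hP l l.2 j
  have hfin : Finite J.minimalPrimes := Ideal.finite_minimalPrimes_of_isNoetherianRing Q J
  obtain ⟨i, j, hij, heq⟩ := Finite.exists_ne_map_eq_of_infinite
    (fun j => (⟨p j, hmin j⟩ : J.minimalPrimes))
  have heq' : p i = p j := congrArg Subtype.val heq
  have key : ∀ i j, p i = p j → ∀ q ∈ firstVars κ L,
      MvPolynomial.aeval y ((seqShift τ s)^[i] q) = 0 ↔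
      MvPolynomial.aeval y ((seqShift τ s)^[j] q) = 0 := by
    intro i j h q hq
    have hq' : q ∈ R.range := by
      have : firstVars κ L ≤ R.range := by
        apply Algebra.adjoin_le
        rintro _ ⟨l, hl, rfl⟩
        exact ⟨MvPolynomial.X ⟨l, hl⟩, MvPolynomial.rename_X _ _⟩
      exact this hq
    obtain ⟨q, rfl⟩ := hq'
    change MvPolynomial.aeval y ((seqShift τ s)^[i] (R q)) = 0 ↔
      MvPolynomial.aeval y ((seqShift τ s)^[j] (R q)) = 0
    rw [← hf, ← hf, ← RingHom.mem_ker, ← RingHom.mem_ker]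
    exact iff_of_eq (congrArg (fun I => q ∈ I) h)
  rcases Nat.lt_or_gt_of_ne hij with h | h
  · refine ⟨i, j - i, by omega, ?_⟩
    rw [Nat.add_sub_cancel' h.le]
    exact key i j heq'
  · refine ⟨j, i - j, by omega, ?_⟩
    rw [Nat.add_sub_cancel' h.le]
    exact key j i heq'.symm

theorem trdeg_adjoin_le_of_isAlgebraic {κ Λ ι : Type u} [Field κ] [Field Λ] [Algebra κ Λ]
    (z : ι → Λ) (W : Set Λ) (hW : ∀ w ∈ W, IsAlgebraic (Algebra.adjoin κ (Set.range z)) w) :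
    Algebra.trdeg κ (IntermediateField.adjoin κ W) ≤ Cardinal.mk ι := by
  let S := Algebra.adjoin κ (Set.range z)
  let A := Subalgebra.algebraicClosure S Λ
  have hSA : Algebra.trdeg κ A ≤ Cardinal.mk ι := by
    have h1 : Algebra.trdeg κ S ≤ Cardinal.mk ι := by
      have : Function.Surjective ((MvPolynomial.aeval z : MvPolynomial ι κ →ₐ[κ] Λ).codRestrict S
          (fun x => by
            change _ ∈ Algebra.adjoin κ (Set.range z)
            rw [Algebra.adjoin_range_eq_range_aeval]; exact ⟨x, rfl⟩)) := by
        rintro ⟨x, hx⟩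
        have hx' := hx
        change _ ∈ Algebra.adjoin κ (Set.range z) at hx'
        rw [Algebra.adjoin_range_eq_range_aeval] at hx'
        obtain ⟨p, hp⟩ := hx'
        exact ⟨p, Subtype.ext hp⟩
      refine (trdeg_le_of_surjective _ this).trans ?_
      rw [MvPolynomial.trdeg_of_isDomain, Cardinal.lift_id]
    have hf : FaithfulSMul S A := (faithfulSMul_iff_algebraMap_injective S A).mpr
      fun x y h => Subtype.ext (congrArg (fun t : A => (t : Λ)) h)
    have h2 := trdeg_add_eq (R := κ) (S := S) (A := A)
    rw [← h2, trdeg_eq_zero (R := S) (A := A), add_zero]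
    exact h1
  refine (trdeg_le_of_injective (A' := A)
    (((IntermediateField.adjoin κ W).val).codRestrict (A.restrictScalars κ) ?_) ?_).trans hSA
  · intro x
    let A' : IntermediateField κ Λ := { A.restrictScalars κ with
      inv_mem' := fun x hx => IsAlgebraic.inv hx }
    have : IntermediateField.adjoin κ W ≤ A' := IntermediateField.adjoin_le_iff.mpr hW
    exact this x.2
  · intro x y h
    exact Subtype.ext (congrArg (fun t : A.restrictScalars κ => (t : Λ)) h)

theorem isAlgebraic_adjoin_of_eval₂_eq_zero {B T ι : Type*} [CommRing B] [CommRing T]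
    [Algebra B T] {z : ι → T} (hz : AlgebraicIndependent B z) {x : T}
    {P : Polynomial (MvPolynomial ι B)} (hP0 : P ≠ 0)
    (hP : P.eval₂ (MvPolynomial.aeval z : MvPolynomial ι B →ₐ[B] T).toRingHom x = 0) :
    IsAlgebraic (Algebra.adjoin B (Set.range z)) x := by
  have h : ∀ x, (MvPolynomial.aeval z : MvPolynomial ι B →ₐ[B] T) x ∈
      Algebra.adjoin B (Set.range z) := fun x => by
    rw [Algebra.adjoin_range_eq_range_aeval]; exact ⟨x, rfl⟩
  let f := (MvPolynomial.aeval z : MvPolynomial ι B →ₐ[B] T).codRestrict _ h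
  refine ⟨P.map f.toRingHom, ?_, ?_⟩
  · rw [Ne, Polynomial.map_eq_zero_iff]
    · exact hP0
    · intro x y hxy
      exact hz (congrArg Subtype.val hxy)
  · rw [Polynomial.aeval_def, Polynomial.eval₂_map]
    exact hP

/-- The sequence of variables of the window shifts back to the window up to algebraicity. -/
theorem isAlgebraic_of_window {κ Λ ι : Type*} [Field κ] [Field Λ] [Algebra κ Λ]
    {s L : ℕ} (hs : 1 ≤ s) (v : ℕ → Λ) (idx : ι → ℕ) (hidx : ∀ a, idx a + s < L)
    (hsL : s ≤ L)
    (h : ∀ j, ∀ l < L, IsAlgebraic (Algebra.adjoin κ (Set.range fun a => v (idx a + s * j)))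
      (v (l + s * j))) (l : ℕ) :
    IsAlgebraic (Algebra.adjoin κ (Set.range fun a => v (idx a))) (v l) := by
  have hA : ∀ j, ∀ l < L, IsAlgebraic (Algebra.adjoin κ (Set.range fun a => v (idx a)))
      (v (l + s * j)) := by
    intro j
    induction j with
    | zero => intro l hl; simpa using h 0 l hl
    | succ j ih =>
      intro l hl
      refine (h (j + 1) l hl).adjoin_of_forall_isAlgebraic ?_
      rintro _ ⟨⟨a, rfl⟩, -⟩
      have := ih (idx a + s) (hidx a)
      rwa [show idx a + s + s * j = idx a + s * (j + 1) by ring] at this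
  have := hA (l / s) (l % s) ((Nat.mod_lt _ hs).trans_le hsL)
  rwa [Nat.mod_add_div] at this

/-- Evaluation of a polynomial over `B` at a sequence in a `κ`-algebra, through `B → κ`. -/
noncomputable def specEval {B κ Λ : Type*} [CommRing B] [CommRing κ] [CommRing Λ] [Algebra κ Λ]
    (hB : B →+* κ) (u : ℕ → Λ) : MvPolynomial ℕ B →+* Λ :=
  (MvPolynomial.aeval u : MvPolynomial ℕ κ →ₐ[κ] Λ).toRingHom.comp (MvPolynomial.map hB)

theorem map_seqShift_iterate {B κ : Type*} [CommRing B] [CommRing κ] (τB : B →+* B) (τκ : κ →+* κ)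
    (hB : B →+* κ) (s d : ℕ) (h : ∀ c, hB ((τB ^ d) c) = τκ (hB c)) (j : ℕ)
    (p : MvPolynomial ℕ B) :
    (seqShift τκ (s * d))^[j] (MvPolynomial.map hB p) =
      MvPolynomial.map hB ((seqShift τB s)^[d * j] p) := by
  have h1 : (seqShift τκ (s * d)).comp (MvPolynomial.map hB) =
      (MvPolynomial.map hB).comp (seqShift (τB ^ d) (s * d)) := by
    apply MvPolynomial.ringHom_ext
    · intro c; simp only [RingHom.comp_apply, MvPolynomial.map_C, seqShift_C, h]
    · intro i; simp
  induction j with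
  | zero => rfl
  | succ j ih =>
    rw [Function.iterate_succ_apply', ih]
    refine (RingHom.congr_fun h1 _).trans ?_
    rw [RingHom.comp_apply, ← seqShift_iterate, ← Function.iterate_add_apply]
    rw [Nat.mul_succ, add_comm (d * j)]

theorem exists_prolongation_twist {κ Λ ι : Type u} [Field κ] [Field Λ] (τ : κ →+* κ)
    (f : κ →+* Λ) {s S L : ℕ} (hs : 1 ≤ s) (hsL : s ≤ L) (hS : 1 ≤ S) (v : ℕ → Λ)
    (hv : ∀ p ∈ firstVars κ L, MvPolynomial.eval₂Hom f v p = 0 ↔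
      MvPolynomial.eval₂Hom f v (seqShift τ S p) = 0)
    (idx : ι → ℕ) (hidx : ∀ a, idx a + s < L)
    (hind : ∀ j, Function.Injective (MvPolynomial.eval₂Hom f fun a => v (idx a + s * j)))
    (Q : ℕ → ℕ → Polynomial (MvPolynomial ι κ)) (hQ0 : ∀ j, ∀ l < L, Q j l ≠ 0)
    (hQ : ∀ j, ∀ l < L, (Q j l).eval₂ (MvPolynomial.eval₂Hom f fun a => v (idx a + s * j))
      (v (l + s * j)) = 0) :
    ∃ (Ω : Type u) (_ : Field Ω) (_ : Algebra κ Ω) (τ' : Ω →+* Ω) (x : ℕ → Ω),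
      (∀ c, τ' (algebraMap κ Ω c) = algebraMap κ Ω (τ c)) ∧
      (∀ i, x (i + S) = τ' (x i)) ∧
      (∀ p ∈ firstVars κ (L + S), MvPolynomial.aeval x p = 0 ↔
        MvPolynomial.eval₂Hom f v p = 0) ∧
      Algebra.trdeg κ Ω ≤ Cardinal.mk ι := by
  let : Algebra κ Λ := f.toAlgebra
  obtain ⟨Ω, _, _, τ', x, h1, h2, h3, -, h5⟩ := exists_prolongation τ hS L v hv
  refine ⟨Ω, inferInstance, inferInstance, τ', x, h1, h2, h3, h5.trans
    (trdeg_adjoin_le_of_isAlgebraic (fun a => v (idx a)) _ ?_)⟩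
  rintro _ ⟨l, -, rfl⟩
  exact isAlgebraic_of_window hs v idx hidx hsL (fun j l hl =>
    isAlgebraic_adjoin_of_eval₂_eq_zero (hind j) (hQ0 j l hl) (hQ j l hl)) l

theorem exists_periodic_specialization {B κ Λ ι : Type u} [CommRing B] [Field κ] [Field Λ]
    [Algebra κ Λ] (τB : B →+* B) (τκ : κ →+* κ) (hB : B →+* κ) {d : ℕ} (hd : 1 ≤ d)
    (hcompat : ∀ c, hB ((τB ^ d) c) = τκ (hB c)) {s L : ℕ} (hs : 1 ≤ s) (hsL : s ≤ L)
    (u : ℕ → Λ) (idx : ι → ℕ) (hidx : ∀ a, idx a + s < L)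
    (hind : ∀ j, AlgebraicIndependent κ fun a => u (idx a + s * j))
    (P : ℕ → Polynomial (MvPolynomial ι B))
    (hP0 : ∀ l < L, ∀ j, (P l).map (MvPolynomial.map (hB.comp (τB ^ j))) ≠ 0)
    (hP : ∀ l < L, ∀ j, specEval hB u ((seqShift τB s)^[j] ((P l).eval₂
      (MvPolynomial.rename idx : MvPolynomial ι B →ₐ[B] MvPolynomial ℕ B).toRingHom
        (MvPolynomial.X l))) = 0) :
    ∃ (Ω : Type u) (_ : Field Ω) (_ : Algebra κ Ω) (τ'' : Ω →+* Ω) (N : ℕ)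
      (e : MvPolynomial ℕ B →+* Ω), 1 ≤ N ∧
      (∀ c, e (MvPolynomial.C c) = algebraMap κ Ω (hB c)) ∧
      (∀ p, e ((seqShift τB s)^[d * N] p) = τ'' (e p)) ∧
      (∀ c, τ'' (algebraMap κ Ω c) = algebraMap κ Ω ((τκ ^ N) c)) ∧
      (∀ p ∈ firstVars B L, ∀ j, ∃ j', e ((seqShift τB s)^[j] p) = 0 ↔
        specEval hB u ((seqShift τB s)^[j'] p) = 0) ∧
      Algebra.trdeg κ Ω ≤ Cardinal.mk ι := by
  obtain ⟨i, n, hn, hper⟩ := exists_periodic_window τκ (s * d) L u idx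
    (fun a => by have := hidx a; omega)
    (fun j => by simpa only [mul_assoc] using hind (d * j))
    (fun l => (P l).map (MvPolynomial.map hB))
    (fun l hl => by simpa [RingHom.one_def] using hP0 l hl 0)
    (fun l hl j => by
      have h0 : MvPolynomial.map hB ((P l).eval₂
          (MvPolynomial.rename idx : MvPolynomial ι B →ₐ[B] MvPolynomial ℕ B).toRingHom
          (MvPolynomial.X l)) = ((P l).map (MvPolynomial.map hB)).eval₂
          (MvPolynomial.rename idx : MvPolynomial ι κ →ₐ[κ] MvPolynomial ℕ κ).toRingHom
          (MvPolynomial.X l) := by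
        rw [Polynomial.hom_eval₂, Polynomial.eval₂_map, MvPolynomial.map_X]
        congr 1
        apply MvPolynomial.ringHom_ext <;> simp
      rw [← h0, map_seqShift_iterate τB τκ hB s d hcompat]
      exact hP l hl _)
  have hcompat' : ∀ (i : ℕ) c, (τκ ^ i) (hB c) = hB ((τB ^ (d * i)) c) := by
    intro i c
    induction i with
    | zero => rfl
    | succ i ih =>
      rw [pow_succ', RingHom.mul_def, RingHom.comp_apply, ih, ← hcompat, Nat.mul_succ, add_comm,
        pow_add]
      rfl
  let v : ℕ → Λ := fun l => u (l + s * (d * i))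
  let f : κ →+* Λ := (algebraMap κ Λ).comp (τκ ^ i)
  have hv : ∀ p : MvPolynomial ℕ κ, MvPolynomial.eval₂Hom f v p =
      MvPolynomial.aeval u ((seqShift τκ (s * d))^[i] p) := by
    intro p
    rw [seqShift_iterate]
    have : MvPolynomial.eval₂Hom f v =
        (MvPolynomial.aeval u : MvPolynomial ℕ κ →ₐ[κ] Λ).toRingHom.comp
          (seqShift (τκ ^ i) (s * d * i)) := by
      apply MvPolynomial.ringHom_ext
      · intro c; simp [f]
      · intro c; simp [v, mul_assoc]
    exact RingHom.congr_fun this p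
  have hS : 1 ≤ s * (d * n) := Nat.one_le_iff_ne_zero.mpr (by positivity)
  obtain ⟨Ω, _, _, τ'', x, hτ'', hx, hwin, htr⟩ := exists_prolongation_twist (τκ ^ n) f hs hsL
    hS v (fun p hp => by
      rw [hv, hv, ← mul_assoc, ← seqShift_iterate, ← Function.iterate_add_apply]
      exact hper p hp) idx hidx
    (fun j => by
      have : MvPolynomial.eval₂Hom f (fun a => v (idx a + s * j)) =
          (MvPolynomial.aeval (fun a => u (idx a + s * (j + d * i))) :
            MvPolynomial ι κ →ₐ[κ] Λ).toRingHom.comp (MvPolynomial.map (τκ ^ i)) := by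
        apply MvPolynomial.ringHom_ext
        · intro c; simp [f]
        · intro c; simp [v, mul_add, add_assoc]
      rw [this]
      have h1 : Function.Injective (MvPolynomial.aeval (fun a => u (idx a + s * (j + d * i))) :
            MvPolynomial ι κ →ₐ[κ] Λ) := hind _
      exact h1.comp (MvPolynomial.map_injective _ (τκ ^ i).injective))
    (fun j l => (P l).map (MvPolynomial.map (hB.comp (τB ^ j))))
    (fun j l hl => hP0 l hl j)
    (fun j l hl => by
      have := hP l hl (j + d * i)
      rw [seqShift_iterate, Polynomial.hom_eval₂, Polynomial.hom_eval₂] at this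
      rw [Polynomial.eval₂_map, ← this]
      congr 1
      · apply MvPolynomial.ringHom_ext
        · intro c
          simp [f, specEval, -RingHom.coe_pow, hcompat', add_comm j, pow_add]
        · intro c; simp [v, mul_add, add_assoc, specEval]
      · simp [v, mul_add, add_assoc, specEval])
  have hshift : ∀ p, specEval hB x ((seqShift τB s)^[d * n] p) = τ'' (specEval hB x p) := by
    intro p
    have h1 := aeval_seqShift (τκ ^ n) τ'' hτ'' x (s * (d * n)) hx (MvPolynomial.map hB p)
    rw [← mul_assoc, ← seqShift_iterate, map_seqShift_iterate τB τκ hB s d hcompat] at h1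
    exact h1
  refine ⟨Ω, inferInstance, inferInstance, τ'', n, specEval hB x, hn, ?_, hshift, hτ'', ?_, htr⟩
  · intro c; simp [specEval]
  · intro p hp j
    refine ⟨d * i + j % (d * n), ?_⟩
    have hdn : 0 < d * n := by positivity
    have h1 : ∀ m p, specEval hB x ((seqShift τB s)^[d * n * m] p) = 0 ↔ specEval hB x p = 0 := by
      intro m p
      induction m with
      | zero => simp
      | succ m ih =>
        rw [Nat.mul_succ, add_comm, Function.iterate_add_apply, hshift, map_eq_zero, ih]
    conv_lhs => rw [← Nat.div_add_mod j (d * n), Function.iterate_add_apply, h1]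
    have h2 : MvPolynomial.map hB ((seqShift τB s)^[j % (d * n)] p) ∈
        firstVars κ (L + s * (d * n)) := by
      have h3 : (seqShift τB s)^[j % (d * n)] p ∈ firstVars B (L + s * (d * n)) :=
        firstVars_mono (by
          have := (Nat.mod_lt j hdn).le
          gcongr) (seqShift_iterate_mem_firstVars τB s _ hp)
      rw [firstVars, MvPolynomial.mem_supported] at h3 ⊢
      exact (Finset.coe_subset.mpr (MvPolynomial.vars_map _ hB)).trans h3
    refine (hwin _ h2).trans ?_
    rw [hv, map_seqShift_iterate τB τκ hB s d hcompat, Function.iterate_add_apply]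
    rfl

/-- Specialization of a recurrent sequence along any equivariant map to a field that does not
vanish on the orbit of `g`. -/
theorem exists_specialization {B T : Type u} [CommRing B] [IsDomain B]
    [Field T] [Algebra B T] [FaithfulSMul B T] (hfin : Algebra.trdeg B T < Cardinal.aleph0)
    (τB : B →+* B) (τ : T →+* T) (hτ : ∀ x, τ (algebraMap B T x) = algebraMap B T (τB x))
    {x : ℕ → T} {s : ℕ} (hs : 1 ≤ s) (hx : ∀ i, x (i + s) = τ (x i)) :
    ∃ (q : ℕ) (g : B), g ≠ 0 ∧ ∀ (d : ℕ), 1 ≤ d → ∀ (κ : Type u) [Field κ] (τκ : κ →+* κ)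
      (hB : B →+* κ), (∀ c, hB ((τB ^ d) c) = τκ (hB c)) → (∀ j, hB (τB^[j] g) ≠ 0) →
      ∃ (Ω : Type u) (_ : Field Ω) (_ : Algebra κ Ω) (τ'' : Ω →+* Ω) (N : ℕ)
        (e : MvPolynomial ℕ B →+* Ω), 1 ≤ N ∧
        (∀ p, MvPolynomial.aeval x p = 0 → e p = 0) ∧
        (∀ c, e (MvPolynomial.C c) = algebraMap κ Ω (hB ((τB ^ q) c))) ∧
        (∀ p, e ((seqShift τB s)^[d * N] p) = τ'' (e p)) ∧
        (∀ c, τ'' (algebraMap κ Ω c) = algebraMap κ Ω ((τκ ^ N) c)) ∧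
        Algebra.trdeg κ Ω ≤ Algebra.trdeg B T := by
  classical
  obtain ⟨q, ι, hι, idx, hind, hz2, hall⟩ := exists_stable_basis hfin τB τ hτ hx
  let y : ℕ → T := fun i => x (i + s * q)
  have hy : ∀ i, y (i + s) = τ (y i) := fun i => by
    simp only [y]; rw [← hx]; congr 1; ring
  have hyj : ∀ j i, y (i + s * j) = τ^[j] (y i) := fun j i => by
    rw [iterate_shift_seq τ hy, RingHom.coe_pow]
  let z : ι → T := fun a => y (idx a)
  obtain ⟨r, f, hf, hf0, hw⟩ := exists_window.{u} τB τ hτ hs hy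
  have := Fintype.ofFinite ι
  let L := r + s + s + (Finset.univ.sup idx + 1)
  have hidx : ∀ a, idx a + s < L := fun a => by
    have := Finset.le_sup (f := idx) (Finset.mem_univ a)
    omega
  let X : Finset T := (Finset.range L).image y ∪ {(MvPolynomial.aeval y f)⁻¹}
  have hX : ∀ t ∈ X, IsAlgebraic (Algebra.adjoin B (Set.range z)) t := by
    intro t ht
    simp only [X, Finset.mem_union, Finset.mem_image, Finset.mem_singleton] at ht
    obtain ⟨l, -, rfl⟩ | rfl := ht
    · exact hall l
    · apply IsAlgebraic.inv
      have h1 : MvPolynomial.aeval y f ∈ Algebra.adjoin B (Set.range y) := by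
        rw [Algebra.adjoin_range_eq_range_aeval]; exact ⟨f, rfl⟩
      refine IsAlgebraic.adjoin_of_forall_isAlgebraic (s := Set.range y) ?_
        (isAlgebraic_algebraMap (⟨_, h1⟩ : Algebra.adjoin B (Set.range y)))
      rintro _ ⟨⟨l, rfl⟩, -⟩
      exact hall l
  obtain ⟨g₀, hg₀, hplace⟩ := exists_place_orbit τB τ hτ z hind
    (fun a => by
      have := hall (idx a + s)
      change IsAlgebraic _ (y (idx a + s)) at this
      rwa [hy] at this) hz2 X hX
  choose P hP hPlc using fun l => exists_eval₂_eq_zero_of_isAlgebraic_adjoin (hall l)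
  have hPm : ∀ l, ∃ m, (P l).leadingCoeff.coeff m ≠ 0 := fun l => by
    by_contra! h
    refine hPlc l ?_
    rw [show (P l).leadingCoeff = 0 from MvPolynomial.ext _ _ (by simpa using h), map_zero]
  choose m hm using hPm
  let g := g₀ * ∏ l ∈ Finset.range L, (P l).leadingCoeff.coeff (m l)
  refine ⟨q, g, mul_ne_zero hg₀ (Finset.prod_ne_zero_iff.mpr fun l _ => hm l), ?_⟩
  intro d hd κ _ τκ hB hcompat hg
  have hg' : ∀ j, hB (τB^[j] g₀) ≠ 0 ∧ ∀ l < L, hB ((τB ^ j) ((P l).leadingCoeff.coeff (m l))) ≠ 0 := by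
    intro j
    have h1 := hg j
    rw [← RingHom.coe_pow] at h1 ⊢
    simp only [g, map_mul, map_prod] at h1
    refine ⟨left_ne_zero_of_mul h1, fun l hl => ?_⟩
    exact Finset.prod_ne_zero_iff.mp (right_ne_zero_of_mul h1) l (Finset.mem_range.mpr hl)
  obtain ⟨Λ, _, _, O, H, hOB, -, hOX, zO, hzO, hzind⟩ := hplace κ hB (fun j => (hg' j).1)
  have hyO : ∀ l, y l ∈ O := by
    intro l
    rw [← Nat.mod_add_div l s, hyj]
    refine hOX _ _ ?_
    have : l % s < L := (Nat.mod_lt _ hs).trans_le (by omega)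
    exact Finset.mem_union_left _ (Finset.mem_image_of_mem _ (Finset.mem_range.mpr this))
  let yO : ℕ → O := fun l => ⟨y l, hyO l⟩
  let bO : B →+* O := (algebraMap B T).codRestrict O fun b => (hOB b).1
  let GO : MvPolynomial ℕ B →+* O := MvPolynomial.eval₂Hom bO yO
  have hGO : ∀ p, (GO p : T) = MvPolynomial.aeval y p := by
    intro p
    have : O.subtype.comp GO = (MvPolynomial.aeval y : MvPolynomial ℕ B →ₐ[B] T).toRingHom := by
      apply MvPolynomial.ringHom_ext
      · intro c; simp [GO, bO]
      · intro c; simp [GO, yO]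
    exact RingHom.congr_fun this p
  have hHG : ∀ p, specEval hB (fun l => H (yO l)) p = H (GO p) := by
    intro p
    have : specEval hB (fun l => H (yO l)) = H.comp GO := by
      apply MvPolynomial.ringHom_ext
      · intro c; simp only [specEval, GO, RingHom.comp_apply, MvPolynomial.map_C, MvPolynomial.coe_eval₂Hom, MvPolynomial.eval₂_C]
        refine (MvPolynomial.aeval_C _ _).trans (hOB c).2.symm
      · intro c; simp [GO, yO, specEval]
    exact RingHom.congr_fun this p
  have hHG0 : ∀ p, MvPolynomial.aeval y p = 0 → ∀ j,
      specEval hB (fun l => H (yO l)) ((seqShift τB s)^[j] p) = 0 := by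
    intro p hp j
    rw [hHG, show GO ((seqShift τB s)^[j] p) = 0 from Subtype.ext (by
      rw [hGO, aeval_seqShift_iterate τB τ hτ y s hy, hp, ← RingHom.coe_pow, map_zero]; rfl),
      map_zero]
  have hHGf : ∀ j, specEval hB (fun l => H (yO l)) ((seqShift τB s)^[j] f) ≠ 0 := by
    intro j h
    rw [hHG] at h
    have h1 : (MvPolynomial.aeval y f)⁻¹ ∈ X := Finset.mem_union_right _ (by simp)
    have h2 : GO ((seqShift τB s)^[j] f) * ⟨_, hOX j _ h1⟩ = 1 := by
      apply Subtype.ext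
      change (GO ((seqShift τB s)^[j] f) : T) * τ^[j] _ = 1
      rw [hGO, aeval_seqShift_iterate τB τ hτ y s hy, ← RingHom.coe_pow, ← map_mul,
        mul_inv_cancel₀ hf0, map_one]
    have h3 := congrArg H h2
    rw [map_mul, h, zero_mul, map_one] at h3
    exact zero_ne_one h3
  obtain ⟨Ω, _, _, τ'', N, e, hN, heC, heS, hτ'', hewin, htr⟩ := exists_periodic_specialization
    τB τκ hB hd hcompat hs (L := L) (by omega) (fun l => H (yO l)) idx hidx
    (fun j => by
      convert hzind j using 3 with a
      apply Subtype.ext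
      rw [hzO]
      exact hyj j (idx a))
    P
    (fun l hl j h => (hg' j).2 l hl (by
      have h1 := congrArg (fun p => (p.coeff (P l).natDegree).coeff (m l)) h
      simpa [MvPolynomial.coeff_map] using h1))
    (fun l hl j => by
      apply hHG0
      rw [← AlgHom.coe_toRingHom, Polynomial.hom_eval₂]
      rw [← hP l]
      congr 1
      · apply MvPolynomial.ringHom_ext
        · intro c; simp
        · intro c; simp [y]
      · simp [y])
  have hmain := hw Ω e
    (fun j p hp h => by
      obtain ⟨j', hj'⟩ := hewin p (firstVars_mono (by omega) hp) j
      exact hj'.mpr (hHG0 p h j'))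
    (fun j h => by
      obtain ⟨j', hj'⟩ := hewin f (firstVars_mono (by omega) hf) j
      exact hHGf j' (hj'.mp h))
  refine ⟨Ω, inferInstance, inferInstance, τ'', N, e.comp (MvPolynomial.map (τB ^ q)), hN, ?_, ?_,
    ?_, hτ'', htr.trans hind.cardinalMk_le_trdeg⟩
  · intro p hp
    apply hmain
    have : (MvPolynomial.aeval y : MvPolynomial ℕ B →ₐ[B] T).toRingHom.comp
        (MvPolynomial.map (τB ^ q)) = (τ ^ q).comp
          (MvPolynomial.aeval x : MvPolynomial ℕ B →ₐ[B] T).toRingHom := by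
      apply MvPolynomial.ringHom_ext
      · intro c
        have := iterate_comm_algebraMap τB τ hτ q c
        simpa using this.symm
      · intro c; simp [y, iterate_shift_seq τ hx]
    refine (RingHom.congr_fun this p).trans ?_
    simp [hp]
  · intro c; simp [heC]
  · intro p
    rw [RingHom.comp_apply, RingHom.comp_apply, ← heS]
    congr 1
    rw [seqShift_iterate, seqShift_iterate]
    have : (MvPolynomial.map (τB ^ q)).comp (seqShift (τB ^ (d * N)) (s * (d * N))) =
        (seqShift (τB ^ (d * N)) (s * (d * N))).comp (MvPolynomial.map (τB ^ q)) := by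
      apply MvPolynomial.ringHom_ext
      · intro c
        simp [← Function.iterate_add_apply, add_comm]
      · intro c; simp
    exact RingHom.congr_fun this p

/-- A recurrent sequence specializes to one generating an extension of finite transcendence
degree, without specializing the base. -/
theorem exists_finite_trdeg_specialization {B T : Type u} [CommRing B] [IsDomain B]
    [Field T] [Algebra B T] [FaithfulSMul B T]
    (τB : B →+* B) (τ : T →+* T) (hτ : ∀ x, τ (algebraMap B T x) = algebraMap B T (τB x))
    {b : ℕ → T} {s : ℕ} (hs : 1 ≤ s) (hb : ∀ i, b (i + s) = τ (b i)) :
    ∃ (Ω : Type u) (_ : Field Ω) (_ : Algebra B Ω) (_ : FaithfulSMul B Ω) (τ' : Ω →+* Ω)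
      (x : ℕ → Ω), (∀ c, τ' (algebraMap B Ω c) = algebraMap B Ω (τB c)) ∧
      (∀ i, x (i + s) = τ' (x i)) ∧
      (∀ p : MvPolynomial ℕ B, MvPolynomial.aeval b p = 0 → MvPolynomial.aeval x p = 0) ∧
      Algebra.trdeg B Ω < Cardinal.aleph0 ∧ Algebra.trdeg B Ω ≤ Algebra.trdeg B T := by
  have hinj : Function.Injective (algebraMap B T) := FaithfulSMul.algebraMap_injective B T
  have hτB : Function.Injective τB := fun x y h => hinj (τ.injective (by rw [hτ, hτ, h]))
  let κ := FractionRing B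
  let : Algebra κ T := FractionRing.liftAlgebra B T
  have : IsScalarTower B κ T := FractionRing.isScalarTower_liftAlgebra B T
  let τκ : κ →+* κ := IsFractionRing.map hτB
  have hτκB : ∀ c, τκ (algebraMap B κ c) = algebraMap B κ (τB c) := fun c =>
    IsLocalization.map_eq _ _
  have hτκ : ∀ c, τ (algebraMap κ T c) = algebraMap κ T (τκ c) := by
    have : τ.comp (algebraMap κ T) = (algebraMap κ T).comp τκ := by
      apply IsLocalization.ringHom_ext (nonZeroDivisors B)
      ext c
      simp only [RingHom.comp_apply, hτκB]
      rw [← IsScalarTower.algebraMap_apply, ← IsScalarTower.algebraMap_apply, hτ]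
    exact RingHom.congr_fun this
  obtain ⟨r, f, hf, hf0, hw⟩ := exists_window.{u} τκ τ hτκ hs hb
  obtain ⟨Ω, _, _, τ', x, h1, h2, h3, h4, h5⟩ := exists_prolongation τκ hs r b
    (fun p _ => by rw [aeval_seqShift τκ τ hτκ b s hb, map_eq_zero_iff τ τ.injective])
  let : Algebra B Ω := ((algebraMap κ Ω).comp (algebraMap B κ)).toAlgebra
  have : IsScalarTower B κ Ω := IsScalarTower.of_algebraMap_eq fun _ => rfl
  have hfaith : FaithfulSMul B Ω := (faithfulSMul_iff_algebraMap_injective B Ω).mpr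
    ((algebraMap κ Ω).injective.comp (IsFractionRing.injective B κ))
  have halg : Algebra.trdeg B κ = 0 := by
    have : Algebra.IsAlgebraic B κ := IsLocalization.isAlgebraic _ (nonZeroDivisors B)
    exact trdeg_eq_zero
  have hΩ : Algebra.trdeg B Ω = Algebra.trdeg κ Ω := by
    rw [← trdeg_add_eq (R := B) (S := κ) (A := Ω), halg, zero_add]
  have hT : Algebra.trdeg B T = Algebra.trdeg κ T := by
    rw [← trdeg_add_eq (R := B) (S := κ) (A := T), halg, zero_add]
  have hshift : ∀ j p, MvPolynomial.aeval x ((seqShift τκ s)^[j] p) = 0 ↔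
      MvPolynomial.aeval x p = 0 := by
    intro j p
    rw [aeval_seqShift_iterate τκ τ' h1 x s h2, ← RingHom.coe_pow, map_eq_zero]
  have hmain := hw Ω (MvPolynomial.aeval x : MvPolynomial ℕ κ →ₐ[κ] Ω).toRingHom
    (fun j p hp h => (hshift j p).mpr ((h3 p (firstVars_mono (by omega) hp)).mpr h))
    (fun j h => hf0 ((h3 f (firstVars_mono (by omega) hf)).mp ((hshift j f).mp h)))
  refine ⟨Ω, inferInstance, inferInstance, hfaith, τ', x, ?_, h2, ?_, hΩ ▸ h4, ?_⟩
  · intro c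
    exact (h1 _).trans (congrArg _ (hτκB c))
  · intro p hp
    have := hmain (MvPolynomial.map (algebraMap B κ) p)
      (by rwa [MvPolynomial.aeval_map_algebraMap])
    rw [← MvPolynomial.aeval_map_algebraMap κ]
    exact this
  · rw [hΩ, hT]
    exact h5.trans (trdeg_le_of_injective (IntermediateField.val _) Subtype.val_injective)

theorem exists_lift_of_ker_le {A D Ω : Type*} [CommRing A] [CommRing D] [CommRing Ω]
    (f : A →+* D) (hf : Function.Surjective f) (e : A →+* Ω) (h : ∀ p, f p = 0 → e p = 0) :
    ∃ a : D →+* Ω, ∀ p, a (f p) = e p :=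
  ⟨f.liftOfSurjective hf ⟨e, fun p hp => h p hp⟩, fun p =>
    f.liftOfRightInverse_comp_apply _ _ ⟨e, fun p hp => h p hp⟩ p⟩

/-- The specialization theorem for a domain finitely generated over `B` as a ring with
endomorphism. -/
theorem exists_universal_specialization {B D : Type u} [CommRing B] [IsDomain B] [CommRing D]
    [IsDomain D] [Algebra B D] [FaithfulSMul B D] (τB : B →+* B) (τ : D →+* D)
    (hτinj : Function.Injective τ)
    (hτ : ∀ x, τ (algebraMap B D x) = algebraMap B D (τB x))
    {b : ℕ → D} {s : ℕ} (hs : 1 ≤ s) (hb : ∀ i, b (i + s) = τ (b i))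
    (htop : Algebra.adjoin B (Set.range b) = ⊤) :
    ∃ (q : ℕ) (g : B), g ≠ 0 ∧ ∀ (d : ℕ), 1 ≤ d → ∀ (κ : Type u) [Field κ] (τκ : κ →+* κ)
      (hB : B →+* κ), (∀ c, hB ((τB ^ d) c) = τκ (hB c)) → (∀ j, hB (τB^[j] g) ≠ 0) →
      ∃ (Ω : Type u) (_ : Field Ω) (_ : Algebra κ Ω) (τ'' : Ω →+* Ω) (N : ℕ)
        (a : D →+* Ω), 1 ≤ N ∧
        (∀ c, a (algebraMap B D c) = algebraMap κ Ω (hB ((τB ^ q) c))) ∧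
        (∀ x, a ((τ ^ (d * N)) x) = τ'' (a x)) ∧
        (∀ c, τ'' (algebraMap κ Ω c) = algebraMap κ Ω ((τκ ^ N) c)) ∧
        Algebra.trdeg κ Ω < Cardinal.aleph0 ∧ Algebra.trdeg κ Ω ≤ Algebra.trdeg B D := by
  let T := FractionRing D
  have hDT := IsFractionRing.injective D T
  let τT : T →+* T := IsFractionRing.map hτinj
  have hτT : ∀ x, τT (algebraMap D T x) = algebraMap D T (τ x) := fun x =>
    IsLocalization.map_eq _ _
  have : FaithfulSMul B T := (faithfulSMul_iff_algebraMap_injective B T).mpr (by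
    rw [IsScalarTower.algebraMap_eq B D T]
    exact hDT.comp (FaithfulSMul.algebraMap_injective B D))
  have htrT : Algebra.trdeg B T = Algebra.trdeg B D := by
    have : Algebra.IsAlgebraic D T := IsLocalization.isAlgebraic _ (nonZeroDivisors D)
    rw [← trdeg_add_eq (R := B) (S := D) (A := T), trdeg_eq_zero (R := D), add_zero]
  obtain ⟨Ω₁, _, _, _, τ₁, x, h1, h2, h3, h4, h5⟩ := exists_finite_trdeg_specialization
    (b := fun i => algebraMap D T (b i)) τB τT
    (fun c => by
      rw [IsScalarTower.algebraMap_apply B D T, hτT, hτ, ← IsScalarTower.algebraMap_apply])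
    hs (fun i => by rw [hb, hτT])
  obtain ⟨q, g, hg, hU⟩ := exists_specialization h4 τB τ₁ h1 hs h2
  refine ⟨q, g, hg, fun d hd κ _ τκ hB hcompat hgj => ?_⟩
  obtain ⟨Ω, _, _, τ'', N, e, hN, he0, heC, heS, hτ'', htr⟩ := hU d hd κ τκ hB hcompat hgj
  let F := (MvPolynomial.aeval b : MvPolynomial ℕ B →ₐ[B] D)
  have hF : Function.Surjective F := by
    intro y
    have : y ∈ Algebra.adjoin B (Set.range b) := htop ▸ Algebra.mem_top
    rw [Algebra.adjoin_range_eq_range_aeval] at this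
    exact this
  obtain ⟨a, ha⟩ := exists_lift_of_ker_le F.toRingHom hF e (fun p hp => he0 p (h3 p (by
    have h6 : algebraMap D T (MvPolynomial.aeval b p) = 0 := by
      rw [show MvPolynomial.aeval b p = 0 from hp, map_zero]
    rw [← h6, ← MvPolynomial.aeval_algebraMap_apply]
    rfl)))
  refine ⟨Ω, inferInstance, inferInstance, τ'', N, a, hN, ?_, ?_, hτ'', htr.trans_lt h4,
    htr.trans (h5.trans htrT.le)⟩
  · intro c
    rw [← heC, ← ha]
    simp [F]
  · intro y
    obtain ⟨p, rfl⟩ := hF y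
    refine Eq.trans ?_ ((heS p).trans (congrArg τ'' (ha p).symm))
    rw [← ha]
    congr 1
    have := aeval_seqShift_iterate τB τ hτ b s hb (d * N) p
    rw [← RingHom.coe_pow] at this
    exact this.symm

/-- Contraction along an injective endomorphism permutes finitely many minimal primes. -/
theorem exists_pow_comap_minimalPrimes_eq {R : Type*} [CommRing R]
    (hfin : (minimalPrimes R).Finite) (σ : R →+* R) (hσ : Function.Injective σ) :
    ∃ m, 1 ≤ m ∧ ∀ p ∈ minimalPrimes R, Ideal.comap (σ ^ m) p = p := by
  have hex : ∀ p : minimalPrimes R, ∃ p' : minimalPrimes R, Ideal.comap σ p'.1 = p.1 := by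
    rintro ⟨p, hp⟩
    obtain ⟨p', hp', hpp'⟩ := Ideal.exists_comap_eq_of_mem_minimalPrimes_of_injective hσ p hp
    obtain ⟨p'', hp'', hle⟩ := Ideal.exists_minimalPrimes_le (I := ⊥) (J := p') bot_le
    have : p''.IsPrime := hp''.1.1
    refine ⟨⟨p'', hp''⟩, le_antisymm ?_ ?_⟩
    · exact hpp' ▸ Ideal.comap_mono hle
    · exact hp.2 ⟨Ideal.IsPrime.comap σ, bot_le⟩ (hpp' ▸ Ideal.comap_mono hle)
  choose s hs using hex
  have : Finite (minimalPrimes R) := hfin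
  have hsinj : Function.Injective s := fun p p' h => Subtype.ext (by rw [← hs p, ← hs p', h])
  let e := Equiv.ofBijective s (Finite.injective_iff_bijective.mp hsinj)
  obtain ⟨m, hm, hem⟩ := isOfFinOrder_iff_pow_eq_one.mp (isOfFinOrder_of_finite e)
  have hpow : ∀ n p, Ideal.comap (σ ^ n) ((e ^ n) p).1 = p.1 := by
    intro n
    induction n with
    | zero => intro p; exact Ideal.comap_id _
    | succ n ih =>
      intro p
      rw [pow_succ σ, pow_succ e]
      refine Eq.trans ?_ (hs p)
      rw [← ih (s p)]
      exact (Ideal.comap_comap σ (σ ^ n)).symm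
  exact ⟨m, hm, fun p hp => by simpa [hem] using hpow m ⟨p, hp⟩⟩

theorem finite_minimalPrimes_of_pseudoDomain {R : Type*} [CommRing R] {Φ : R →+* R}
    (h : PseudoDomain Φ) : (minimalPrimes R).Finite := by
  obtain ⟨d, hd, q, hq, hdq, hbot⟩ := h
  refine ((Finset.range d).finite_toSet.image fun i => Ideal.comap (Φ ^ i) q).subset ?_
  intro p hp
  have : p.IsPrime := hp.1.1
  have h1 : (Finset.range d).inf (fun i => Ideal.comap (Φ ^ i) q) ≤ p := by
    rw [Finset.inf_eq_iInf, ← hbot]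
    exact bot_le
  obtain ⟨i, hi, hle⟩ := (Ideal.IsPrime.inf_le' ‹_›).mp h1
  exact ⟨i, hi, le_antisymm hle (hp.2 ⟨Ideal.IsPrime.comap _, bot_le⟩ hle)⟩

theorem DiffSimple.injective_of_comm {R : Type*} [CommRing R] {Φ σ : R →+* R} (h : DiffSimple Φ)
    (hc : ∀ x, Φ (σ x) = σ (Φ x)) : Function.Injective σ := by
  rw [RingHom.injective_iff_ker_eq_bot]
  refine (h.2 (RingHom.ker σ) fun x hx => ?_).resolve_right fun ht => ?_
  · rw [RingHom.mem_ker] at hx ⊢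
    rw [← hc, hx, map_zero]
  · have : Nontrivial R := ⟨0, 1, fun h01 => h.1 (by
      rw [Ideal.eq_top_iff_one, Ideal.mem_bot, h01])⟩
    exact RingHom.ker_ne_top σ ht

theorem DiffSimple.nontrivial {R : Type*} [CommRing R] {Φ : R →+* R} (h : DiffSimple Φ) :
    Nontrivial R :=
  ⟨0, 1, fun h01 => h.1 (by rw [Ideal.eq_top_iff_one, Ideal.mem_bot, h01])⟩

theorem DiffSimple.isField_constSubring {R : Type*} [CommRing R] {Φ : R →+* R}
    (h : DiffSimple Φ) : IsField (constSubring Φ) := by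
  have := h.nontrivial
  refine ⟨⟨0, 1, zero_ne_one⟩, mul_comm, fun {c} hc => ?_⟩
  have hcΦ : Φ (c : R) = c := c.2
  have h1 : Ideal.span {(c : R)} = ⊤ := by
    refine (h.2 _ fun x hx => ?_).resolve_left fun h0 => ?_
    · rw [Ideal.mem_span_singleton] at hx ⊢
      obtain ⟨y, rfl⟩ := hx
      exact ⟨Φ y, by rw [map_mul, hcΦ]⟩
    · rw [Ideal.span_singleton_eq_bot] at h0
      exact hc (Subtype.ext h0)
  rw [Ideal.span_singleton_eq_top] at h1
  obtain ⟨y, hy⟩ := h1.exists_right_inv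
  refine ⟨⟨y, ?_⟩, Subtype.ext hy⟩
  change Φ y = y
  have h2 : (c : R) * Φ y = 1 := by
    have := congrArg Φ hy
    rwa [map_mul, hcΦ, map_one] at this
  calc Φ y = (c * y) * Φ y := by rw [hy, one_mul]
    _ = (c * Φ y) * y := by ring
    _ = y := by rw [h2, one_mul]

/-- Constants that are linearly independent over the constants of a simple ring are linearly
independent over the ring. -/
theorem eq_zero_of_sum_mul_constants {R S : Type*} [CommRing R] [CommRing S] {Φ : R →+* R}
    (h : DiffSimple Φ) (ΦS : S →+* S) (j : R →+* S) (hj : ∀ x, ΦS (j x) = j (Φ x))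
    {ι : Type*} (c : ι → S) (hc : ∀ i, ΦS (c i) = c i)
    (hind : ∀ (s : Finset ι) (a : ι → R), (∀ i ∈ s, Φ (a i) = a i) →
      ∑ i ∈ s, j (a i) * c i = 0 → ∀ i ∈ s, a i = 0)
    (s : Finset ι) (a : ι → R) (hsum : ∑ i ∈ s, j (a i) * c i = 0) : ∀ i ∈ s, a i = 0 := by
  classical
  have := h.nontrivial
  induction s using Finset.induction_on generalizing a with
  | empty => simp
  | insert i₀ s hi₀ ih =>
    let I : Ideal R :=
      { carrier := {r | ∃ a : ι → R, j r * c i₀ + ∑ i ∈ s, j (a i) * c i = 0}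
        zero_mem' := ⟨0, by simp⟩
        add_mem' := by
          rintro x y ⟨a, ha⟩ ⟨b, hb⟩
          refine ⟨a + b, ?_⟩
          simp only [Pi.add_apply, map_add, add_mul, Finset.sum_add_distrib]
          linear_combination ha + hb
        smul_mem' := by
          rintro r x ⟨a, ha⟩
          refine ⟨r • a, ?_⟩
          have : ∑ i ∈ s, j ((r • a) i) * c i = j r * ∑ i ∈ s, j (a i) * c i := by
            rw [Finset.mul_sum]
            exact Finset.sum_congr rfl fun i _ => by simp [mul_assoc]
          rw [this, smul_eq_mul, map_mul]
          linear_combination j r * ha }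
    have hΦ : ∀ (r : R) (a : ι → R), j r * c i₀ + ∑ i ∈ s, j (a i) * c i = 0 →
        j (Φ r) * c i₀ + ∑ i ∈ s, j (Φ (a i)) * c i = 0 := by
      intro r a ha
      have := congrArg ΦS ha
      simpa [hj, hc] using this
    rcases h.2 I (by rintro x ⟨a, ha⟩; exact ⟨_, hΦ x a ha⟩) with hI | hI
    · rw [Finset.sum_insert hi₀] at hsum
      have h0 : a i₀ = 0 := by
        have : a i₀ ∈ I := ⟨a, hsum⟩
        rwa [hI] at this
      rw [h0, map_zero, zero_mul, zero_add] at hsum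
      intro i hi
      rcases Finset.mem_insert.mp hi with rfl | hi
      · exact h0
      · exact ih a hsum i hi
    · obtain ⟨b, hb⟩ : (1 : R) ∈ I := hI ▸ Submodule.mem_top
      have h1 := hΦ 1 b hb
      rw [map_one] at h1
      have h2 : ∑ i ∈ s, j (Φ (b i) - b i) * c i = 0 := by
        simp only [map_sub, sub_mul, Finset.sum_sub_distrib]
        linear_combination h1 - hb
      have h3 := ih _ h2
      have h4 := hind (insert i₀ s) (fun i => if i = i₀ then 1 else b i) (by
        intro i hi
        by_cases hii : i = i₀
        · simp [hii]
        · simp only [hii, if_false]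
          exact sub_eq_zero.mp (h3 i ((Finset.mem_insert.mp hi).resolve_left hii))) (by
        rw [Finset.sum_insert hi₀, ← hb]
        simp only [if_true]
        congr 1
        refine Finset.sum_congr rfl fun i hi => ?_
        have hii : i ≠ i₀ := by
          rintro rfl
          exact hi₀ hi
        simp only [hii, if_false]) i₀ (Finset.mem_insert_self _ _)
      simp at h4

section FieldDescent

variable {T : Type*} [Field T]

/-- The least degree of a nonzero polynomial over the subfield `F` that vanishes at `β`. -/
noncomputable def degreeOver (F : Subfield T) (β : T) : ℕ∞ :=
  sInf {n | ∃ p : Polynomial T, p ≠ 0 ∧ (∀ j, p.coeff j ∈ F) ∧ p.eval β = 0 ∧ n = p.natDegree}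

theorem degreeOver_le {F : Subfield T} {β : T} {p : Polynomial T} (hp : p ≠ 0)
    (hF : ∀ j, p.coeff j ∈ F) (h0 : p.eval β = 0) : degreeOver F β ≤ p.natDegree :=
  sInf_le ⟨p, hp, hF, h0, rfl⟩

theorem exists_of_degreeOver_ne_top {F : Subfield T} {β : T} (h : degreeOver F β ≠ ⊤) :
    ∃ p : Polynomial T, p ≠ 0 ∧ (∀ j, p.coeff j ∈ F) ∧ p.eval β = 0 ∧
      degreeOver F β = p.natDegree := by
  refine csInf_mem (s := {n : ℕ∞ | ∃ p : Polynomial T, p ≠ 0 ∧ (∀ j, p.coeff j ∈ F) ∧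
    p.eval β = 0 ∧ n = p.natDegree}) ?_
  by_contra hemp
  rw [Set.not_nonempty_iff_eq_empty] at hemp
  exact h (by rw [degreeOver, hemp, sInf_empty])

theorem degreeOver_mono {F F' : Subfield T} (h : F ≤ F') (β : T) :
    degreeOver F' β ≤ degreeOver F β := by
  by_cases ht : degreeOver F β = ⊤
  · rw [ht]; exact le_top
  · obtain ⟨p, hp, hF, h0, hd⟩ := exists_of_degreeOver_ne_top ht
    rw [hd]
    exact degreeOver_le hp (fun j => h (hF j)) h0

theorem degreeOver_map_le {F F' : Subfield T} (τ : T →+* T) (h : ∀ x ∈ F, τ x ∈ F') (β : T) :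
    degreeOver F' (τ β) ≤ degreeOver F β := by
  by_cases ht : degreeOver F β = ⊤
  · rw [ht]; exact le_top
  · obtain ⟨p, hp, hF, h0, hd⟩ := exists_of_degreeOver_ne_top ht
    rw [hd, ← Polynomial.natDegree_map τ]
    refine degreeOver_le ((Polynomial.map_ne_zero_iff τ.injective).mpr hp) (fun j => ?_) ?_
    · rw [Polynomial.coeff_map]; exact h _ (hF j)
    · rw [Polynomial.eval_map, Polynomial.eval₂_hom, h0, map_zero]

theorem exists_quotient_of_mem_closure_insert {F : Subfield T} {β c : T}
    (hc : c ∈ Subfield.closure (insert β (F : Set T))) :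
    ∃ r s : Polynomial T, (∀ j, r.coeff j ∈ F) ∧ (∀ j, s.coeff j ∈ F) ∧
      (s.natDegree : ℕ∞) < degreeOver F β ∧ (r.natDegree : ℕ∞) < degreeOver F β ∧
      s.eval β ≠ 0 ∧ c * s.eval β = r.eval β := by
  have h1 : c ∈ IntermediateField.adjoin F {β} := by
    have : Subfield.closure (insert β (F : Set T)) ≤
        (IntermediateField.adjoin F {β}).toSubfield := by
      rw [Subfield.closure_le]
      rintro x (rfl | hx)
      · exact IntermediateField.mem_adjoin_simple_self F x
      · exact (IntermediateField.adjoin F {β}).algebraMap_mem ⟨x, hx⟩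
    exact this hc
  obtain ⟨r, s, hrs⟩ := (IntermediateField.mem_adjoin_simple_iff F c).mp h1
  have hred : ∀ p : Polynomial F, ∃ p' : Polynomial T, (∀ j, p'.coeff j ∈ F) ∧
      (p'.natDegree : ℕ∞) < degreeOver F β ∧ p'.eval β = Polynomial.aeval β p := by
    intro p
    by_cases ht : degreeOver F β = ⊤
    · refine ⟨p.map (algebraMap F T), fun j => ?_, ?_, ?_⟩
      · rw [Polynomial.coeff_map]; exact (p.coeff j).2
      · rw [ht]; exact WithTop.coe_lt_top _
      · rw [Polynomial.eval_map_algebraMap]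
    · obtain ⟨m, hm, hmF, hm0, hmd⟩ := exists_of_degreeOver_ne_top ht
      have hlift : ∃ m' : Polynomial F, m'.map (algebraMap F T) = m := by
        have : m ∈ Polynomial.lifts (algebraMap F T) := by
          rw [Polynomial.lifts_iff_coeff_lifts]
          intro j
          exact ⟨⟨m.coeff j, hmF j⟩, rfl⟩
        exact (Polynomial.mem_lifts _).mp this
      obtain ⟨m', rfl⟩ := hlift
      have hm' : m' ≠ 0 := by rintro rfl; simp at hm
      have hdeg : m'.natDegree ≠ 0 := by
        intro h0
        rw [Polynomial.eq_C_of_natDegree_eq_zero h0] at hm0 hm'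
        simp at hm0 hm'
        exact hm' hm0
      refine ⟨(p % m').map (algebraMap F T), fun j => ?_, ?_, ?_⟩
      · rw [Polynomial.coeff_map]; exact Subtype.property _
      · rw [hmd, Polynomial.natDegree_map, Polynomial.natDegree_map]
        exact_mod_cast Polynomial.natDegree_mod_lt p hdeg
      · rw [Polynomial.eval_map_algebraMap] at hm0 ⊢
        conv_rhs => rw [← EuclideanDomain.mod_add_div p m']
        simp [hm0]
  by_cases hs0 : Polynomial.aeval β s = 0
  · obtain ⟨p', h1, h2, h3⟩ := hred 1
    refine ⟨0, p', by simp [F.zero_mem], h1, h2, ?_, ?_, ?_⟩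
    · simp only [Polynomial.natDegree_zero]
      exact lt_of_le_of_lt (by exact_mod_cast zero_le) h2
    · simp [h3]
    · rw [hrs, hs0]; simp
  · obtain ⟨r', h1, h2, h3⟩ := hred r
    obtain ⟨s', h4, h5, h6⟩ := hred s
    exact ⟨r', s', h1, h4, h5, h2, by rwa [h6], by rw [h3, h6, hrs, div_mul_cancel₀ _ hs0]⟩

theorem mem_of_mem_closure_insert {F F' : Subfield T} {β c : T}
    (hd : degreeOver F β ≤ degreeOver F' β) (hle : F ≤ F')
    (hc' : c ∈ F') (hc : c ∈ Subfield.closure (insert β (F : Set T))) : c ∈ F := by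
  obtain ⟨r, s, hr, hs, hsd, hrd, hs0, hcs⟩ := exists_quotient_of_mem_closure_insert hc
  have h0 : r - Polynomial.C c * s = 0 := by
    by_contra hne
    have h1 : degreeOver F' β ≤ (r - Polynomial.C c * s).natDegree := by
      refine degreeOver_le hne (fun j => ?_) ?_
      · rw [Polynomial.coeff_sub, Polynomial.coeff_C_mul]
        exact F'.sub_mem (hle (hr j)) (F'.mul_mem hc' (hle (hs j)))
      · simp [hcs]
    have h2 : ((r - Polynomial.C c * s).natDegree : ℕ∞) < degreeOver F β := by
      have : (r - Polynomial.C c * s).natDegree ≤ max r.natDegree s.natDegree :=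
        (Polynomial.natDegree_sub_le _ _).trans
          (max_le_max le_rfl (Polynomial.natDegree_C_mul_le _ _))
      refine lt_of_le_of_lt (Nat.cast_le.mpr this) ?_
      rcases max_choice r.natDegree s.natDegree with h | h <;> rw [h] <;> assumption
    exact absurd (h2.trans_le hd) (not_lt.mpr h1)
  have hsne : s ≠ 0 := by rintro rfl; simp at hs0
  obtain ⟨j, hj⟩ : ∃ j, s.coeff j ≠ 0 := by
    by_contra! h
    exact hsne (Polynomial.ext h)
  have h3 := congrArg (fun p => Polynomial.coeff p j) h0
  simp only [Polynomial.coeff_sub, Polynomial.coeff_C_mul, Polynomial.coeff_zero] at h3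
  have h4 : c = r.coeff j / s.coeff j := by
    rw [eq_div_iff hj]; exact (sub_eq_zero.mp h3).symm
  rw [h4]
  exact F.div_mem (hr j) (hs j)

theorem exists_finite_subset_of_mem_closure {X Y : Set T} {x : T}
    (hx : x ∈ Subfield.closure (X ∪ Y)) :
    ∃ Y₀ : Finset T, (Y₀ : Set T) ⊆ Y ∧ x ∈ Subfield.closure (X ∪ Y₀) := by
  classical
  have hmono : ∀ Y₁ Y₂ : Finset T, ∀ x, x ∈ Subfield.closure (X ∪ (Y₁ : Set T)) →
      x ∈ Subfield.closure (X ∪ ((Y₁ ∪ Y₂ : Finset T) : Set T)) ∧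
      x ∈ Subfield.closure (X ∪ ((Y₂ ∪ Y₁ : Finset T) : Set T)) := fun Y₁ Y₂ x hx =>
    ⟨Subfield.closure_mono (Set.union_subset_union_right _
      (Finset.coe_subset.mpr Finset.subset_union_left)) hx,
    Subfield.closure_mono (Set.union_subset_union_right _
      (Finset.coe_subset.mpr Finset.subset_union_right)) hx⟩
  induction hx using Subfield.closure_induction with
  | mem x hx =>
    rcases hx with hx | hx
    · exact ⟨∅, by simp, Subfield.subset_closure (Or.inl hx)⟩
    · exact ⟨{x}, by simpa using hx, Subfield.subset_closure (Or.inr (by simp))⟩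
  | one => exact ⟨∅, by simp, one_mem _⟩
  | add x y _ _ hx hy =>
    obtain ⟨Y₁, h1, h2⟩ := hx
    obtain ⟨Y₂, h3, h4⟩ := hy
    exact ⟨Y₁ ∪ Y₂, by simp [h1, h3], add_mem (hmono Y₁ Y₂ x h2).1 (hmono Y₂ Y₁ y h4).2⟩
  | mul x y _ _ hx hy =>
    obtain ⟨Y₁, h1, h2⟩ := hx
    obtain ⟨Y₂, h3, h4⟩ := hy
    exact ⟨Y₁ ∪ Y₂, by simp [h1, h3], mul_mem (hmono Y₁ Y₂ x h2).1 (hmono Y₂ Y₁ y h4).2⟩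
  | neg x _ hx =>
    obtain ⟨Y₁, h1, h2⟩ := hx
    exact ⟨Y₁, h1, neg_mem h2⟩
  | inv x _ hx =>
    obtain ⟨Y₁, h1, h2⟩ := hx
    exact ⟨Y₁, h1, inv_mem h2⟩

/-- A field generated by a set `S` over `X` that embeds in an extension generated over `X`
by a recurrent sequence is determined by finitely many elements of `S` and their transforms. -/
theorem exists_finset_descent (τ : T →+* T) {X S : Set T} (hX : ∀ x ∈ X, τ x ∈ X)
    (hS : ∀ x ∈ S, τ x ∈ S) {b : ℕ → T} {s : ℕ} (hs : 1 ≤ s) (hb : ∀ i, b (i + s) = τ (b i)) :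
    ∃ S₀ : Finset T, (S₀ : Set T) ⊆ S ∧ ∀ S₁ ⊆ S, (S₀ : Set T) ⊆ S₁ → (∀ x ∈ S₁, τ x ∈ S₁) →
      ∀ c ∈ Subfield.closure (X ∪ S), c ∈ Subfield.closure (X ∪ S₁ ∪ Set.range b) →
        c ∈ Subfield.closure (X ∪ S₁) := by
  classical
  let F : Set T → ℕ → Subfield T := fun Y i => Subfield.closure (X ∪ Y ∪ b '' Set.Iio i)
  have hFmono : ∀ Y Y' i, Y ⊆ Y' → F Y i ≤ F Y' i := fun Y Y' i h =>
    Subfield.closure_mono (Set.union_subset_union_left _ (Set.union_subset_union_right _ h))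
  have hFτ : ∀ Y, (∀ x ∈ Y, τ x ∈ Y) → ∀ i, ∀ x ∈ F Y i, τ x ∈ F Y (i + s) := by
    intro Y hY i
    have : F Y i ≤ (F Y (i + s)).comap τ := by
      rw [Subfield.closure_le]
      rintro x ((hx | hx) | ⟨j, hj, rfl⟩)
      · exact Subfield.subset_closure (Or.inl (Or.inl (hX x hx)))
      · exact Subfield.subset_closure (Or.inl (Or.inr (hY x hx)))
      · refine Subfield.subset_closure (Or.inr ⟨j + s, ?_, hb j⟩)
        have : j < i := hj
        change j + s < i + s
        omega
    exact fun x hx => this hx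
  have hdle : ∀ Y, (∀ x ∈ Y, τ x ∈ Y) → ∀ i,
      degreeOver (F Y (i + s)) (b (i + s)) ≤ degreeOver (F Y i) (b i) := by
    intro Y hY i
    rw [hb]
    exact degreeOver_map_le τ (hFτ Y hY i) _
  obtain ⟨r, hr⟩ := exists_forall_ge_add_eq (fun i => degreeOver (F S i) (b i)) hs (hdle S hS)
  have hfin : ∀ i, ∃ Y : Finset T, (Y : Set T) ⊆ S ∧
      degreeOver (F Y i) (b i) ≤ degreeOver (F S i) (b i) := by
    intro i
    by_cases ht : degreeOver (F S i) (b i) = ⊤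
    · exact ⟨∅, by simp, by rw [ht]; exact le_top⟩
    · obtain ⟨p, hp, hpF, h0, hd⟩ := exists_of_degreeOver_ne_top ht
      have : ∀ j, ∃ Y : Finset T, (Y : Set T) ⊆ S ∧ p.coeff j ∈ F Y i := by
        intro j
        have h1 := hpF j
        have h2 : X ∪ S ∪ b '' Set.Iio i = X ∪ b '' Set.Iio i ∪ S := Set.union_right_comm _ _ _
        simp only [F] at h1 ⊢
        rw [h2] at h1
        obtain ⟨Y, hY, hY'⟩ := exists_finite_subset_of_mem_closure h1
        exact ⟨Y, hY, by rwa [Set.union_right_comm]⟩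
      choose Y hY hYp using this
      refine ⟨p.support.biUnion Y, ?_, ?_⟩
      · intro x hx
        obtain ⟨j, _, hj⟩ := Finset.mem_biUnion.mp (Finset.mem_coe.mp hx)
        exact hY j hj
      · rw [hd]
        refine degreeOver_le hp (fun j => ?_) h0
        by_cases hj : p.coeff j = 0
        · rw [hj]; exact zero_mem _
        · exact hFmono _ _ i (Finset.coe_subset.mpr
            (Finset.subset_biUnion_of_mem Y (Polynomial.mem_support_iff.mpr hj))) (hYp j)
  choose Y hY hYd using hfin
  refine ⟨(Finset.range (r + s)).biUnion Y, ?_, fun S₁ hS₁ hS₀ hτ₁ => ?_⟩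
  · intro x hx
    obtain ⟨j, _, hj⟩ := Finset.mem_biUnion.mp (Finset.mem_coe.mp hx)
    exact hY j hj
  have hsmall : ∀ i < r + s, degreeOver (F S₁ i) (b i) ≤ degreeOver (F S i) (b i) := by
    intro i hi
    refine le_trans (degreeOver_mono (hFmono _ _ i ?_) _) (hYd i)
    exact (Finset.coe_subset.mpr (Finset.subset_biUnion_of_mem Y (Finset.mem_range.mpr hi))).trans
      hS₀
  have hall : ∀ i, degreeOver (F S₁ i) (b i) ≤ degreeOver (F S i) (b i) := by
    intro i
    induction i using Nat.strong_induction_on with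
    | _ i ih =>
      by_cases hi : i < r + s
      · exact hsmall i hi
      · obtain ⟨i', rfl⟩ : ∃ i', i = i' + s := ⟨i - s, by omega⟩
        have : degreeOver (F S (i' + s)) (b (i' + s)) = degreeOver (F S i') (b i') :=
          hr i' (by omega)
        rw [this]
        exact (hdle S₁ hτ₁ i').trans (ih i' (by omega))
  intro c hc hcb
  have hstep : ∀ i, c ∈ F S₁ i → c ∈ F S₁ 0 := by
    intro i
    induction i with
    | zero => exact id
    | succ i ih =>
      intro h
      refine ih (mem_of_mem_closure_insert (hall i) (hFmono _ _ i hS₁) ?_ (β := b i) ?_)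
      · exact Subfield.closure_mono Set.subset_union_left hc
      · refine Subfield.closure_le.mpr ?_ h
        rintro x (hx | ⟨j, hj, rfl⟩)
        · exact Subfield.subset_closure (Or.inr (Subfield.subset_closure (Or.inl hx)))
        · rcases Nat.lt_succ_iff_lt_or_eq.mp hj with hj | rfl
          · exact Subfield.subset_closure (Or.inr (Subfield.subset_closure (Or.inr ⟨j, hj, rfl⟩)))
          · exact Subfield.subset_closure (Or.inl rfl)
  obtain ⟨Z, hZ, hcZ⟩ := exists_finite_subset_of_mem_closure hcb
  have hn : ∃ i, (Z : Set T) ⊆ b '' Set.Iio i := by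
    choose! g hg using fun z (hz : z ∈ Z) => hZ (Finset.mem_coe.mpr hz)
    refine ⟨Z.sup g + 1, fun z hz => ⟨g z, ?_, hg z hz⟩⟩
    exact Nat.lt_succ_of_le (Finset.le_sup hz)
  obtain ⟨i, hi⟩ := hn
  have := hstep i (Subfield.closure_mono (Set.union_subset_union_right _ hi) hcZ)
  simpa [F] using this

end FieldDescent

/-- A homomorphism from `R ⊗[k] E` that is equivariant for a simple endomorphism on `R` with
constants `k` is injective as soon as it is injective on `E`. -/
theorem injective_of_tensor_constants {k R E S : Type*} [Field k] [CommRing R] [Algebra k R]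
    [CommRing E] [Algebra k E] [CommRing S] {Φ : R →+* R} (h : DiffSimple Φ)
    (hk : ∀ a, Φ a = a → ∃ c : k, algebraMap k R c = a) (ΦS : S →+* S) (m : R ⊗[k] E →+* S)
    (h1 : ∀ r, ΦS (m (r ⊗ₜ 1)) = m (Φ r ⊗ₜ 1)) (h2 : ∀ x, ΦS (m (1 ⊗ₜ x)) = m (1 ⊗ₜ x))
    (h3 : ∀ x, m (1 ⊗ₜ x) = 0 → x = 0) : Function.Injective m := by
  rw [injective_iff_map_eq_zero]
  intro z hz
  let e := Module.Basis.ofVectorSpace k E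
  let e' := Algebra.TensorProduct.basis R e
  have hsum : z = ∑ i ∈ (e'.repr z).support, (e'.repr z i) ⊗ₜ[k] e i := by
    conv_lhs => rw [← e'.linearCombination_repr z]
    rw [Finsupp.linearCombination_apply, Finsupp.sum]
    refine Finset.sum_congr rfl fun i _ => ?_
    simp [e', TensorProduct.smul_tmul']
  let j : R →+* S := m.comp Algebra.TensorProduct.includeLeftRingHom
  have hmul : ∀ r x, m (r ⊗ₜ x) = j r * m (1 ⊗ₜ x) := by
    intro r x
    change _ = m (r ⊗ₜ 1) * _
    rw [← map_mul, Algebra.TensorProduct.tmul_mul_tmul, mul_one, one_mul]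
  have key := eq_zero_of_sum_mul_constants h ΦS j h1 (fun i => m (1 ⊗ₜ e i)) (fun i => h2 _)
    (by
      intro s a ha h0
      choose! c hc using fun i (hi : i ∈ s) => hk (a i) (ha i hi)
      have h4 : ∑ i ∈ s, c i • e i = 0 := by
        apply h3
        rw [TensorProduct.tmul_sum, map_sum, ← h0]
        refine Finset.sum_congr rfl fun i hi => ?_
        rw [← hmul, ← hc i hi, Algebra.algebraMap_eq_smul_one, TensorProduct.smul_tmul]
      intro i hi
      rw [← hc i hi, linearIndependent_iff'.mp e.linearIndependent s c h4 i hi, map_zero])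
    (e'.repr z).support (e'.repr z) (by
      rw [hsum, map_sum] at hz
      rw [← hz]
      exact Finset.sum_congr rfl fun i _ => (hmul _ _).symm)
  rw [hsum]
  exact Finset.sum_eq_zero fun i hi => by rw [key i hi, TensorProduct.zero_tmul]

theorem diffSimple_of_field {K : Type*} [Field K] (φ : K →+* K) : DiffSimple φ :=
  ⟨bot_ne_top, fun I _ => eq_bot_or_eq_top I⟩

theorem Ideal.exists_pow_comap_eq_of_isNoetherian {R : Type*} [CommRing R] [IsNoetherianRing R]
    [Nontrivial R] (σ : R →+* R) (hσ : Function.Injective σ) :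
    ∃ m, 1 ≤ m ∧ ∃ p ∈ minimalPrimes R, Ideal.comap (σ ^ m) p = p := by
  obtain ⟨m, hm, h⟩ := exists_pow_comap_minimalPrimes_eq
    (minimalPrimes.finite_of_isNoetherianRing R) σ hσ
  obtain ⟨p, hp⟩ := (Ideal.nonempty_minimalPrimes (I := (⊥ : Ideal R)) bot_ne_top)
  exact ⟨m, hm, p, hp, h p hp⟩

section Regular

variable {k K : Type*} [Field k] [Field K] [Algebra k K] (φ : K →+* K)
  (hφ : ∀ c : k, φ (algebraMap k K c) = algebraMap k K c)

/-- The extension of an endomorphism of `K` over `k` to `K ⊗[k] E`. -/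
noncomputable def tensorLeftEndo (E : Type*) [CommRing E] [Algebra k E] :
    K ⊗[k] E →+* K ⊗[k] E :=
  (Algebra.TensorProduct.map (⟨φ, hφ⟩ : K →ₐ[k] K) (AlgHom.id k E)).toRingHom

theorem tensorLeftEndo_tmul {E : Type*} [CommRing E] [Algebra k E] (a : K) (x : E) :
    tensorLeftEndo φ hφ E (a ⊗ₜ x) = φ a ⊗ₜ x := rfl

theorem tensorLeftEndo_injective (E : Type*) [CommRing E] [Algebra k E] :
    Function.Injective (tensorLeftEndo φ hφ E) :=
  Module.Flat.rTensor_preserves_injective_linearMap (M := E)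
    (⟨φ, hφ⟩ : K →ₐ[k] K).toLinearMap φ.injective

theorem tensorLeftEndo_pow_tmul {E : Type*} [CommRing E] [Algebra k E] (m : ℕ) (a : K) (x : E) :
    (tensorLeftEndo φ hφ E ^ m) (a ⊗ₜ x) = (φ ^ m) a ⊗ₜ x := by
  induction m with
  | zero => rfl
  | succ m ih =>
    rw [pow_succ', pow_succ']
    exact (congrArg (tensorLeftEndo φ hφ E) ih).trans (tensorLeftEndo_tmul φ hφ _ _)

end Regular

theorem isDomain_tensor_of_finiteType {k K : Type*} [Field k] [Field K] [Algebra k K] (φ : K →+* K)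
    (hφ : ∀ c : k, φ (algebraMap k K c) = algebraMap k K c)
    (hper : ∀ (m : ℕ), 1 ≤ m → ∀ a : K, (φ ^ m) a = a → ∃ c, algebraMap k K c = a)
    (E : Type*) [CommRing E] [IsDomain E] [Algebra k E] [Algebra.FiniteType k E] :
    IsDomain (K ⊗[k] E) := by
  have : IsNoetherianRing (K ⊗[k] E) := Algebra.FiniteType.isNoetherianRing K _
  have : Nontrivial (K ⊗[k] E) :=
    (Algebra.TensorProduct.includeRight_injective (R := k) (A := K) (B := E)
      (algebraMap k K).injective).nontrivial
  obtain ⟨m, hm, p, hp, hpm⟩ := Ideal.exists_pow_comap_eq_of_isNoetherian _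
    (tensorLeftEndo_injective φ hφ E)
  have hpp : p.IsPrime := hp.1.1
  have hle : p ≤ Ideal.comap (tensorLeftEndo φ hφ E ^ m) p := hpm.ge
  let Φ : (K ⊗[k] E) ⧸ p →+* (K ⊗[k] E) ⧸ p := Ideal.quotientMap p _ hle
  have hinj : Function.Injective (Ideal.Quotient.mk p) := by
    refine injective_of_tensor_constants (Φ := φ ^ m) (diffSimple_of_field _) (hper m hm) Φ
      (Ideal.Quotient.mk p) (fun r => ?_) (fun x => ?_) (fun x hx => ?_)
    · change Ideal.Quotient.mk p ((tensorLeftEndo φ hφ E ^ m) _) = _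
      rw [tensorLeftEndo_pow_tmul]
    · change Ideal.Quotient.mk p ((tensorLeftEndo φ hφ E ^ m) _) = _
      rw [tensorLeftEndo_pow_tmul, map_one]
    · by_contra hx0
      rw [Ideal.Quotient.eq_zero_iff_mem] at hx
      have h1 : (1 ⊗ₜ x : K ⊗[k] E) ∈ nonZeroDivisors (K ⊗[k] E) := by
        have h2 : Function.Injective (LinearMap.lTensor K (LinearMap.mulLeft k x)) :=
          Module.Flat.lTensor_preserves_injective_linearMap _
            (fun a b hab => mul_left_cancel₀ hx0 hab)
        have h3 : ∀ z, LinearMap.lTensor K (LinearMap.mulLeft k x) z = (1 ⊗ₜ x) * z := by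
          intro z
          induction z with
          | zero => simp
          | add a b ha hb => rw [map_add, ha, hb, mul_add]
          | tmul a b => simp
        rw [mem_nonZeroDivisors_iff_right]
        intro z hz
        apply h2
        rw [h3, mul_comm, hz, map_zero]
      exact Set.disjoint_left.mp (Ideal.disjoint_nonZeroDivisors_of_mem_minimalPrimes hp) hx h1
  exact hinj.isDomain _

/-- `K` is a regular extension of the constants of an endomorphism without nontrivial
periodic points. -/
theorem isDomain_tensor {k K : Type*} [Field k] [Field K] [Algebra k K] (φ : K →+* K)
    (hφ : ∀ c : k, φ (algebraMap k K c) = algebraMap k K c)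
    (hper : ∀ (m : ℕ), 1 ≤ m → ∀ a : K, (φ ^ m) a = a → ∃ c, algebraMap k K c = a)
    (E : Type*) [CommRing E] [IsDomain E] [Algebra k E] : IsDomain (K ⊗[k] E) := by
  classical
  have : Nontrivial (K ⊗[k] E) :=
    (Algebra.TensorProduct.includeRight_injective (R := k) (A := K) (B := E)
      (algebraMap k K).injective).nontrivial
  have : NoZeroDivisors (K ⊗[k] E) := by
    refine ⟨fun {x y} hxy => ?_⟩
    obtain ⟨N, hN, hxyN⟩ := TensorProduct.exists_finite_submodule_right_of_setFinite
      (R := k) (M := K) (N := E) {x, y} (Set.toFinite _)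
    obtain ⟨s, hs⟩ := (Module.Finite.iff_fg.mp hN)
    let E' := Algebra.adjoin k (s : Set E)
    have hE' : Algebra.FiniteType k E' := by
      rw [← Subalgebra.fg_iff_finiteType]
      exact ⟨s, rfl⟩
    have := isDomain_tensor_of_finiteType φ hφ hper E'
    let g : K ⊗[k] E' →ₐ[k] K ⊗[k] E := Algebra.TensorProduct.map (AlgHom.id k K) E'.val
    have hg : Function.Injective g :=
      Module.Flat.lTensor_preserves_injective_linearMap (M := K) E'.val.toLinearMap
        Subtype.val_injective
    have hNE : N ≤ Subalgebra.toSubmodule E' := by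
      rw [← hs]
      exact Algebra.span_le_adjoin k _
    have hrange : ∀ z ∈ ({x, y} : Set (K ⊗[k] E)), ∃ z', g z' = z := by
      intro z hz
      obtain ⟨z', hz'⟩ := hxyN hz
      refine ⟨LinearMap.lTensor K (Submodule.inclusion hNE) z', ?_⟩
      rw [← hz']
      change LinearMap.lTensor K E'.val.toLinearMap _ = _
      rw [← LinearMap.comp_apply, ← LinearMap.lTensor_comp]
      rfl
    obtain ⟨x', hx'⟩ := hrange x (Or.inl rfl)
    obtain ⟨y', hy'⟩ := hrange y (Or.inr rfl)
    have h0 : x' * y' = 0 := hg (by rw [map_mul, hx', hy', hxy, map_zero])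
    rcases mul_eq_zero.mp h0 with h | h
    · left; rw [← hx', h, map_zero]
    · right; rw [← hy', h, map_zero]
  exact NoZeroDivisors.to_isDomain _

section TensorLift

variable {k K A S : Type*} [CommRing k] [CommRing K] [CommRing A] [CommRing S] [Algebra k K]
  [Algebra k A]

/-- The homomorphism from a tensor product to a ring determined by two homomorphisms that agree
on the base. -/
noncomputable def tensorLift (f : K →+* S) (g : A →+* S)
    (h : ∀ c : k, f (algebraMap k K c) = g (algebraMap k A c)) : K ⊗[k] A →+* S :=
  letI : Algebra k S := (f.comp (algebraMap k K)).toAlgebra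
  (Algebra.TensorProduct.productMap (R := k) (⟨f, fun _ => rfl⟩ : K →ₐ[k] S)
    (⟨g, fun c => (h c).symm⟩ : A →ₐ[k] S)).toRingHom

theorem tensorLift_tmul (f : K →+* S) (g : A →+* S)
    (h : ∀ c : k, f (algebraMap k K c) = g (algebraMap k A c)) (a : K) (x : A) :
    tensorLift f g h (a ⊗ₜ x) = f a * g x := rfl

theorem tensor_ringHom_ext {f g : K ⊗[k] A →+* S} (h1 : ∀ a, f (a ⊗ₜ 1) = g (a ⊗ₜ 1))
    (h2 : ∀ x, f (1 ⊗ₜ x) = g (1 ⊗ₜ x)) : f = g := by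
  refine RingHom.ext fun z => ?_
  induction z with
  | zero => simp
  | add a b ha hb => rw [map_add, map_add, ha, hb]
  | tmul a x =>
    have : a ⊗ₜ[k] x = (a ⊗ₜ 1) * (1 ⊗ₜ x) := by simp
    rw [this, map_mul, map_mul, h1, h2]

end TensorLift

theorem exists_functional_ne_zero {k K A : Type*} [Field k] [AddCommGroup K] [Module k K]
    [AddCommGroup A] [Module k A] {g : K ⊗[k] A} (hg : g ≠ 0) :
    ∃ l : K →ₗ[k] k, TensorProduct.lid k A (LinearMap.rTensor A l g) ≠ 0 := by
  classical
  by_contra! h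
  apply hg
  let e := Module.Basis.ofVectorSpace k K
  have h1 : ∀ i, TensorProduct.lid k A (LinearMap.rTensor A (e.coord i) g) = 0 := fun i => h _
  have h2 : ∀ i, (TensorProduct.equivFinsuppOfBasisLeft e g) i = 0 := by
    intro i
    rw [← h1 i]
    clear h h1 hg
    induction g with
    | zero => simp
    | add a b ha hb => simp only [map_add, Finsupp.add_apply, ha, hb]
    | tmul a x => simp
  exact (TensorProduct.equivFinsuppOfBasisLeft e).injective (by ext i; simp [h2 i])

theorem pow_apply_comm {R : Type*} [Semiring R] {f g : R →+* R} (h : ∀ x, f (g x) = g (f x))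
    (m n : ℕ) (x : R) : (f ^ m) ((g ^ n) x) = (g ^ n) ((f ^ m) x) := by
  have h1 : Commute f g := RingHom.ext h
  exact RingHom.congr_fun (h1.pow_pow m n) x

theorem pow_apply_algebraMap {B T : Type*} [CommSemiring B] [Semiring T]
    {τB : B →+* B} {τ : T →+* T} {f : B →+* T} (hτ : ∀ x, τ (f x) = f (τB x))
    (n : ℕ) (x : B) : (τ ^ n) (f x) = f ((τB ^ n) x) := by
  induction n with
  | zero => simp
  | succ n ih =>
    rw [pow_succ', pow_succ']
    exact (congrArg τ ih).trans (hτ _)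

theorem injective_pow {R : Type*} [Semiring R] {f : R →+* R} (h : Function.Injective f) (n : ℕ) :
    Function.Injective (f ^ n) := by
  rw [RingHom.coe_pow]
  exact h.iterate n

/-- Let `D` be finitely generated over `K` as a ring with endomorphism. A domain `A` of constants
of `D` has a nonzero element that meets the orbit of every nonzero periodic prime of `A`. -/
theorem exists_avoiding_element {k K A D : Type u} [Field k] [Field K] [Algebra k K]
    [CommRing A] [IsDomain A] [Algebra k A] [CommRing D] [IsDomain D] [Algebra K D]
    {φ σ : K →+* K} (hcomm : ∀ a, φ (σ a) = σ (φ a))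
    (hφ : ∀ c : k, φ (algebraMap k K c) = algebraMap k K c)
    (hper : ∀ (m : ℕ), 1 ≤ m → ∀ a : K, (φ ^ m) a = a → ∃ c, algebraMap k K c = a)
    {σk : k →+* k} (hσk : ∀ c, σ (algebraMap k K c) = algebraMap k K (σk c))
    {σA : A →+* A} (hσAinj : Function.Injective σA)
    (hσA : ∀ c, σA (algebraMap k A c) = algebraMap k A (σk c))
    {ι : A →+* D} (hι : ∀ c : k, algebraMap K D (algebraMap k K c) = ι (algebraMap k A c))
    (hιu : ∀ x, x ≠ 0 → IsUnit (ι x))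
    {Φ : D →+* D} {m : ℕ} (hm : 1 ≤ m)
    (hΦK : ∀ a, Φ (algebraMap K D a) = algebraMap K D ((φ ^ m) a)) (hΦι : ∀ x, Φ (ι x) = ι x)
    {τ : D →+* D} (hτinj : Function.Injective τ)
    (hτK : ∀ a, τ (algebraMap K D a) = algebraMap K D (σ a)) (hτι : ∀ x, τ (ι x) = ι (σA x))
    {b : ℕ → D} {s : ℕ} (hs : 1 ≤ s) (hb : ∀ i, b (i + s) = τ (b i))
    (htop : Algebra.adjoin K (Set.range b) = ⊤) :
    ∃ x : A, x ≠ 0 ∧ ∀ q : Ideal A, q.IsPrime → ∀ d, 1 ≤ d → Ideal.comap (σA ^ d) q = q →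
      (∀ j, (σA ^ j) x ∉ q) → q = ⊥ := by
  have := isDomain_tensor φ hφ hper A
  let μ : K ⊗[k] A →+* D := tensorLift (algebraMap K D) ι hι
  have hμ : ∀ a x, μ (a ⊗ₜ x) = algebraMap K D a * ι x := tensorLift_tmul _ _ _
  let : Algebra (K ⊗[k] A) D := μ.toAlgebra
  have hμ' : ∀ z, algebraMap (K ⊗[k] A) D z = μ z := fun _ => rfl
  have hμinj : Function.Injective μ := by
    refine injective_of_tensor_constants (Φ := φ ^ m) (diffSimple_of_field _) (hper m hm) Φ μ
      (fun r => ?_) (fun x => ?_) (fun x hx => ?_)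
    · rw [hμ, hμ, map_one, mul_one, mul_one, hΦK]
    · rw [hμ, map_one, one_mul, hΦι]
    · rw [hμ, map_one, one_mul] at hx
      by_contra h0
      exact (hιu x h0).ne_zero hx
  have : FaithfulSMul (K ⊗[k] A) D := (faithfulSMul_iff_algebraMap_injective _ _).mpr hμinj
  let KA : K →+* K ⊗[k] A := Algebra.TensorProduct.includeLeftRingHom
  let AA : A →+* K ⊗[k] A := (Algebra.TensorProduct.includeRight (R := k) (A := K)).toRingHom
  have hKA : ∀ c : k, KA (algebraMap k K c) = AA (algebraMap k A c) := fun c =>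
    Algebra.TensorProduct.tmul_one_eq_one_tmul c
  let τB : K ⊗[k] A →+* K ⊗[k] A := tensorLift (KA.comp σ) (AA.comp σA) (fun c => by
    simp only [RingHom.comp_apply, hσk, hσA, hKA])
  have hτB : ∀ a x, τB (a ⊗ₜ x) = σ a ⊗ₜ σA x := by
    intro a x
    change (σ a ⊗ₜ[k] (1 : A)) * ((1 : K) ⊗ₜ[k] σA x) = _
    simp
  have hτBn : ∀ n a x, (τB ^ n) (a ⊗ₜ x) = (σ ^ n) a ⊗ₜ (σA ^ n) x := by
    intro n a x
    induction n with
    | zero => rfl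
    | succ n ih =>
      rw [pow_succ', pow_succ', pow_succ']
      exact (congrArg τB ih).trans (hτB _ _)
  have hτμ : ∀ z, τ (algebraMap (K ⊗[k] A) D z) = algebraMap (K ⊗[k] A) D (τB z) := by
    intro z
    refine RingHom.congr_fun (f := τ.comp μ) (g := μ.comp τB) (tensor_ringHom_ext ?_ ?_) z
    · intro a
      simp only [RingHom.comp_apply, hτB, hμ, map_one, mul_one, hτK]
    · intro x
      simp only [RingHom.comp_apply, hτB, hμ, map_one, one_mul, hτι]
  have htop' : Algebra.adjoin (K ⊗[k] A) (Set.range b) = ⊤ := by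
    rw [eq_top_iff]
    intro y _
    have hy : y ∈ Algebra.adjoin K (Set.range b) := htop ▸ Algebra.mem_top
    induction hy using Algebra.adjoin_induction with
    | mem x hx => exact Algebra.subset_adjoin hx
    | algebraMap r =>
      have : algebraMap K D r = algebraMap (K ⊗[k] A) D (r ⊗ₜ 1) := by
        rw [hμ', hμ, map_one, mul_one]
      rw [this]
      exact Subalgebra.algebraMap_mem _ _
    | add x y _ _ hx hy => exact add_mem (hx trivial) (hy trivial)
    | mul x y _ _ hx hy => exact mul_mem (hx trivial) (hy trivial)
  obtain ⟨q₀, g, hg, hU⟩ := exists_universal_specialization τB τ hτinj hτμ hs hb htop'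
  obtain ⟨l, hl⟩ := exists_functional_ne_zero hg
  refine ⟨_, hl, fun q hq d hd hqd hav => ?_⟩
  have hdom : ∀ q : Ideal A, q.IsPrime → IsDomain (K ⊗[k] (A ⧸ q)) := fun q hq =>
    isDomain_tensor φ hφ hper (A ⧸ q)
  have := hdom q hq
  let pr : ∀ q : Ideal A, K ⊗[k] A →+* K ⊗[k] (A ⧸ q) := fun q =>
    (Algebra.TensorProduct.map (AlgHom.id k K) (Ideal.Quotient.mkₐ k q)).toRingHom
  have hpr : ∀ (q : Ideal A) (a : K) (x : A), pr q (a ⊗ₜ x) = a ⊗ₜ Ideal.Quotient.mk q x :=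
    fun q a x => rfl
  let KE : K →+* K ⊗[k] (A ⧸ q) := Algebra.TensorProduct.includeLeftRingHom
  let EE : (A ⧸ q) →+* K ⊗[k] (A ⧸ q) :=
    (Algebra.TensorProduct.includeRight (R := k) (A := K)).toRingHom
  have hEE : Function.Injective EE := Algebra.TensorProduct.includeRight_injective
    (R := k) (A := K) (B := A ⧸ q) (algebraMap k K).injective
  have hKE : ∀ c : k, KE (algebraMap k K c) = EE (algebraMap k (A ⧸ q) c) := fun c =>
    Algebra.TensorProduct.tmul_one_eq_one_tmul c
  have hσkn : ∀ n c, (σ ^ n) (algebraMap k K c) = algebraMap k K ((σk ^ n) c) := fun n c =>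
    pow_apply_algebraMap hσk n c
  have hσAn : ∀ n c, (σA ^ n) (algebraMap k A c) = algebraMap k A ((σk ^ n) c) := fun n c =>
    pow_apply_algebraMap hσA n c
  -- the maps `K ⊗ A / (σ^n)⁻¹ q → K ⊗ A / q` induced by `σ^n`
  have hlift : ∀ n (q' : Ideal A), Ideal.comap (σA ^ n) q = q' →
      ∃ θ : K ⊗[k] (A ⧸ q') →+* K ⊗[k] (A ⧸ q), Function.Injective θ ∧
        (∀ z, θ (pr q' z) = pr q ((τB ^ n) z)) ∧
        ∀ a x, θ (a ⊗ₜ Ideal.Quotient.mk q' x) = (σ ^ n) a ⊗ₜ Ideal.Quotient.mk q ((σA ^ n) x) := by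
    intro n q' hq'
    let σE : A ⧸ q' →+* A ⧸ q := Ideal.quotientMap q (σA ^ n) hq'.ge
    have hσE : ∀ x, σE (Ideal.Quotient.mk q' x) = Ideal.Quotient.mk q ((σA ^ n) x) := fun x =>
      Ideal.quotientMap_mk
    have hσEinj : Function.Injective σE := Ideal.quotientMap_injective' hq'.le
    let θ : K ⊗[k] (A ⧸ q') →+* K ⊗[k] (A ⧸ q) :=
      tensorLift (KE.comp (σ ^ n)) (EE.comp σE) (fun c => by
        rw [RingHom.comp_apply, RingHom.comp_apply, hσkn, hKE]
        congr 1
        change _ = σE (Ideal.Quotient.mk q' _)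
        rw [hσE, hσAn]
        rfl)
    have hθ : ∀ a x, θ (a ⊗ₜ x) = (σ ^ n) a ⊗ₜ σE x := by
      intro a x
      change ((σ ^ n) a ⊗ₜ[k] (1 : A ⧸ q)) * ((1 : K) ⊗ₜ[k] σE x) = _
      simp
    refine ⟨θ, ?_, ?_, ?_⟩
    · refine injective_of_tensor_constants (Φ := φ ^ 1) (diffSimple_of_field _) (hper 1 le_rfl)
        (tensorLeftEndo φ hφ (A ⧸ q)) θ (fun r => ?_) (fun x => ?_) (fun x hx => ?_)
      · rw [hθ, hθ, tensorLeftEndo_tmul, pow_apply_comm (fun x => (hcomm x).symm), pow_one]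
      · rw [hθ, tensorLeftEndo_tmul, map_one, map_one]
      · rw [hθ, map_one] at hx
        exact hσEinj ((hEE (hx.trans (map_zero EE).symm)).trans (map_zero σE).symm)
    · intro z
      refine RingHom.congr_fun (f := θ.comp (pr q')) (g := (pr q).comp (τB ^ n))
        (tensor_ringHom_ext ?_ ?_) z
      · intro a
        simp only [RingHom.comp_apply, hpr, hτBn, hθ, hσE]
      · intro a
        simp only [RingHom.comp_apply, hpr, hτBn, hθ, hσE]
    · intro a x
      rw [hθ, hσE]
  obtain ⟨θ, hθinj, hθ, -⟩ := hlift d q hqd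
  let κ := FractionRing (K ⊗[k] (A ⧸ q))
  have hκ : Function.Injective (algebraMap (K ⊗[k] (A ⧸ q)) κ) := IsFractionRing.injective _ _
  let τκ : κ →+* κ := IsFractionRing.map hθinj
  have hτκ : ∀ z, τκ (algebraMap (K ⊗[k] (A ⧸ q)) κ z) = algebraMap _ κ (θ z) := fun z =>
    IsLocalization.map_eq _ _
  let hB : K ⊗[k] A →+* κ := (algebraMap (K ⊗[k] (A ⧸ q)) κ).comp (pr q)
  obtain ⟨Ω, _, _, τ'', N, a, -, ha, -⟩ := hU d hd κ τκ hB (fun c => by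
      change algebraMap _ κ (pr q _) = τκ (algebraMap _ κ (pr q c))
      rw [hτκ, hθ])
    (fun j h0 => by
      change algebraMap _ κ (pr q _) = 0 at h0
      rw [← RingHom.coe_pow] at h0
      obtain ⟨θ', hθ'inj, hθ', -⟩ := hlift j _ rfl
      rw [map_eq_zero_iff _ hκ, ← hθ', map_eq_zero_iff _ hθ'inj] at h0
      apply hav j
      have h1 : ∀ z, TensorProduct.lid k _ (LinearMap.rTensor _ l
          (pr (Ideal.comap (σA ^ j) q) z)) = Ideal.Quotient.mk (Ideal.comap (σA ^ j) q)
          (TensorProduct.lid k A (LinearMap.rTensor A l z)) := by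
        intro z
        induction z with
        | zero => simp
        | add x y hx hy => simp only [map_add, hx, hy]
        | tmul a x =>
          rw [hpr]
          simp only [LinearMap.rTensor_tmul, TensorProduct.lid_tmul]
          rfl
      have h2 := h1 g
      rw [h0, map_zero, map_zero] at h2
      exact Ideal.mem_comap.mp (Ideal.Quotient.eq_zero_iff_mem.mp h2.symm))
  have hbot : ∀ x, (σA ^ q₀) x ∈ q → x = 0 := by
    intro x hx
    by_contra h0
    have h1 := ha (1 ⊗ₜ x)
    rw [hμ', hμ, map_one, one_mul, hτBn, map_one] at h1
    have h2 : hB (1 ⊗ₜ (σA ^ q₀) x) = 0 := by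
      change algebraMap _ κ (pr q _) = 0
      rw [hpr, Ideal.Quotient.eq_zero_iff_mem.mpr hx, TensorProduct.tmul_zero, map_zero]
    rw [h2, map_zero] at h1
    exact ((hιu x h0).map a).ne_zero h1
  rw [eq_bot_iff]
  intro x hx
  have hq : ∀ n, ∀ x ∈ q, (σA ^ (d * n)) x ∈ q := by
    intro n
    induction n with
    | zero => intro x hx; simpa using hx
    | succ n ih =>
      intro x hx
      rw [Nat.mul_succ, pow_add]
      refine ih ((σA ^ d) x) ?_
      rw [← Ideal.mem_comap, hqd]
      exact hx
  have h1 := hq q₀ x hx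
  have h2 : d * q₀ = q₀ + (d - 1) * q₀ := by
    obtain ⟨d', rfl⟩ : ∃ d', d = d' + 1 := ⟨d - 1, by omega⟩
    simp
    ring
  rw [h2, pow_add] at h1
  exact (map_eq_zero_iff _ (injective_pow hσAinj _)).mp (hbot _ h1)

/-- A field of constants of a domain `D` that is finitely generated over `K` as a ring with
endomorphism is the fraction field of each large enough stable subalgebra. -/
theorem exists_finset_denominators {k K k₁ D : Type*} [Field k] [Field K] [Algebra k K]
    [Field k₁] [Algebra k k₁] [CommRing D] [IsDomain D] [Algebra K D]
    {φ σ : K →+* K}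
    (hper : ∀ (m : ℕ), 1 ≤ m → ∀ a : K, (φ ^ m) a = a → ∃ c, algebraMap k K c = a)
    {σ₁ : k₁ →+* k₁}
    {ι : k₁ →+* D} (hι : ∀ c : k, algebraMap K D (algebraMap k K c) = ι (algebraMap k k₁ c))
    {Φ : D →+* D} {m : ℕ} (hm : 1 ≤ m)
    (hΦK : ∀ a, Φ (algebraMap K D a) = algebraMap K D ((φ ^ m) a)) (hΦι : ∀ x, Φ (ι x) = ι x)
    {τ : D →+* D} (hτinj : Function.Injective τ)
    (hτK : ∀ a, τ (algebraMap K D a) = algebraMap K D (σ a)) (hτι : ∀ x, τ (ι x) = ι (σ₁ x))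
    {b : ℕ → D} {s : ℕ} (hs : 1 ≤ s) (hb : ∀ i, b (i + s) = τ (b i))
    (htop : Algebra.adjoin K (Set.range b) = ⊤) :
    ∃ S₀ : Finset k₁, ∀ A : Subalgebra k k₁, (S₀ : Set k₁) ⊆ A → (∀ x ∈ A, σ₁ x ∈ A) →
      ∀ c, ∃ u ∈ A, u ≠ 0 ∧ c * u ∈ A := by
  classical
  let T := FractionRing D
  have hDT := IsFractionRing.injective D T
  let τT : T →+* T := IsFractionRing.map hτinj
  have hτT : ∀ x, τT (algebraMap D T x) = algebraMap D T (τ x) := fun x =>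
    IsLocalization.map_eq _ _
  let ι' : k₁ →+* T := (algebraMap D T).comp ι
  let j : K →+* T := (algebraMap D T).comp (algebraMap K D)
  obtain ⟨S₀, hS₀, hS⟩ := exists_finset_descent τT (X := Set.range j) (S := Set.range ι')
    (b := fun i => algebraMap D T (b i))
    (by rintro _ ⟨a, rfl⟩; exact ⟨σ a, by simp only [j, RingHom.comp_apply, hτT, hτK]⟩)
    (by rintro _ ⟨a, rfl⟩; exact ⟨σ₁ a, by simp only [ι', RingHom.comp_apply, hτT, hτι]⟩)
    hs (fun i => by rw [hb, hτT])
  have hS₀' : ∀ x ∈ S₀, ∃ y, ι' y = x := fun x hx => hS₀ (Finset.mem_coe.mpr hx)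
  choose! f hf using hS₀'
  refine ⟨S₀.image f, fun A hA hAσ c => ?_⟩
  have hc := hS (ι' '' A) (Set.image_subset_range _ _)
    (fun x hx => ⟨f x, hA (Finset.mem_coe.mpr (Finset.mem_image_of_mem f hx)), hf x hx⟩)
    (by
      rintro _ ⟨a, ha, rfl⟩
      exact ⟨σ₁ a, hAσ a ha, by simp only [ι', RingHom.comp_apply, hτT, hτι]⟩)
    (ι' c) (Subfield.subset_closure (Or.inr ⟨c, rfl⟩)) (by
      have h1 : ι c ∈ Algebra.adjoin K (Set.range b) := htop ▸ Algebra.mem_top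
      change algebraMap D T (ι c) ∈ _
      generalize ι c = y at h1
      induction h1 using Algebra.adjoin_induction with
      | mem x hx =>
        obtain ⟨i, rfl⟩ := hx
        exact Subfield.subset_closure (Or.inr ⟨i, rfl⟩)
      | algebraMap r => exact Subfield.subset_closure (Or.inl (Or.inl ⟨r, rfl⟩))
      | add x y _ _ hx hy => rw [map_add]; exact add_mem hx hy
      | mul x y _ _ hx hy => rw [map_mul]; exact mul_mem hx hy)
  let μ : K ⊗[k] k₁ →+* T := tensorLift j ι' (fun c => congrArg (algebraMap D T) (hι c))
  have hμ : ∀ a x, μ (a ⊗ₜ x) = j a * ι' x := tensorLift_tmul _ _ _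
  have hμinj : Function.Injective μ := by
    let μ' : K ⊗[k] k₁ →+* D := tensorLift (algebraMap K D) ι hι
    have hμ' : ∀ a x, μ' (a ⊗ₜ x) = algebraMap K D a * ι x := tensorLift_tmul _ _ _
    have h1 : Function.Injective μ' := by
      refine injective_of_tensor_constants (Φ := φ ^ m) (diffSimple_of_field _) (hper m hm) Φ μ'
        (fun r => ?_) (fun x => ?_) (fun x hx => ?_)
      · rw [hμ', hμ', map_one, mul_one, mul_one, hΦK]
      · rw [hμ', map_one, one_mul, hΦι]
      · rw [hμ', map_one, one_mul] at hx
        exact (map_eq_zero_iff ι ι.injective).mp hx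
    have h2 : μ = (algebraMap D T).comp μ' := tensor_ringHom_ext
      (fun a => by simp only [RingHom.comp_apply, hμ, hμ', map_one, mul_one, j])
      (fun a => by simp only [RingHom.comp_apply, hμ, hμ', map_one, one_mul, ι'])
    rw [h2, RingHom.coe_comp]
    exact hDT.comp h1
  let incl : K ⊗[k] A →+* K ⊗[k] k₁ :=
    (Algebra.TensorProduct.map (AlgHom.id k K) A.val).toRingHom
  have hincl : ∀ (a : K) (x : A), incl (a ⊗ₜ x) = a ⊗ₜ (x : k₁) := fun _ _ => rfl
  have hle : Subring.closure (Set.range j ∪ ι' '' A) ≤ (μ.comp incl).range := by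
    rw [Subring.closure_le]
    rintro _ (⟨a, rfl⟩ | ⟨a, ha, rfl⟩)
    · exact ⟨a ⊗ₜ 1, by
        rw [RingHom.comp_apply, hincl, hμ, OneMemClass.coe_one, map_one, mul_one]⟩
    · exact ⟨1 ⊗ₜ ⟨a, ha⟩, by rw [RingHom.comp_apply, hincl, hμ, map_one, one_mul]⟩
  obtain ⟨y, hy, z, hz, hyz⟩ := Subfield.mem_closure_iff.mp hc
  obtain ⟨u, rfl⟩ := hle hy
  obtain ⟨v, rfl⟩ := hle hz
  by_cases hv : v = 0
  · rw [hv, map_zero, div_zero, eq_comm, map_eq_zero_iff ι' ι'.injective] at hyz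
    exact ⟨1, A.one_mem, one_ne_zero, by rw [hyz, zero_mul]; exact A.zero_mem⟩
  obtain ⟨l, hl⟩ := exists_functional_ne_zero hv
  have hv' : μ (incl v) ≠ 0 := by
    rw [map_ne_zero_iff μ hμinj]
    refine fun h0 => hv (Module.Flat.lTensor_preserves_injective_linearMap (M := K)
      A.val.toLinearMap Subtype.val_injective (h0.trans (map_zero _).symm))
  have h1 : incl u = (1 ⊗ₜ c) * incl v := by
    apply hμinj
    rw [map_mul, hμ, map_one, one_mul]
    exact (div_eq_iff hv').mp hyz
  have hnat : ∀ z, TensorProduct.lid k k₁ (LinearMap.rTensor k₁ l (incl z)) =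
      (TensorProduct.lid k A (LinearMap.rTensor A l z) : A) := by
    intro z
    induction z with
    | zero => simp
    | add x y hx hy => simp only [map_add, hx, hy, AddMemClass.coe_add]
    | tmul a x =>
      rw [hincl]
      simp
  have hmul : ∀ z : K ⊗[k] k₁, TensorProduct.lid k k₁ (LinearMap.rTensor k₁ l ((1 ⊗ₜ c) * z)) =
      c * TensorProduct.lid k k₁ (LinearMap.rTensor k₁ l z) := by
    intro z
    induction z with
    | zero => simp
    | add x y hx hy => simp only [mul_add, map_add, hx, hy]
    | tmul a x => simp
  have h2 := congrArg (fun z => TensorProduct.lid k k₁ (LinearMap.rTensor k₁ l z)) h1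
  simp only [hmul, hnat] at h2
  refine ⟨_, (TensorProduct.lid k A (LinearMap.rTensor A l v)).2, ?_, ?_⟩
  · exact fun h0 => hl (Subtype.ext h0)
  · rw [← h2]
    exact Subtype.property _

section Coinduced

variable {L : Type*} [Field L] {N : ℕ} [NeZero N] (τ : L →+* L)

/-- The value of `x : Fin N → L` at an arbitrary position, continued by `x (i + N) = τ (x i)`. -/
def coindVal (x : Fin N → L) (i : ℕ) : L := (τ ^ (i / N)) (x (Fin.ofNat N i))

theorem coindVal_add (x : Fin N → L) (i : ℕ) : coindVal τ x (i + N) = τ (coindVal τ x i) := by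
  have hN : 0 < N := Nat.pos_of_ne_zero (NeZero.ne N)
  have h1 : Fin.ofNat N (i + N) = Fin.ofNat N i := by
    apply Fin.ext
    simp [Fin.ofNat]
  rw [coindVal, coindVal, h1, Nat.add_div_right _ hN, pow_succ']
  rfl

theorem coindVal_of_fin (x : Fin N → L) (j : Fin N) : coindVal τ x j = x j := by
  rw [coindVal, Nat.div_eq_of_lt j.2, pow_zero]
  simp

/-- The endomorphism of `Fin N → L` coinduced from the endomorphism `τ` of `L`. -/
def coindEndo : (Fin N → L) →+* (Fin N → L) where
  toFun x j := coindVal τ x (j + 1)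
  map_one' := by ext; simp [coindVal]
  map_mul' x y := by ext; simp [coindVal]
  map_zero' := by ext; simp [coindVal]
  map_add' x y := by ext; simp [coindVal]

theorem coindVal_ext_of_period {f g : ℕ → L} (hf : ∀ i, f (i + N) = τ (f i))
    (hg : ∀ i, g (i + N) = τ (g i)) (h : ∀ i < N, f i = g i) (i : ℕ) : f i = g i := by
  induction i using Nat.strong_induction_on with
  | _ i ih =>
    by_cases hi : i < N
    · exact h i hi
    · obtain ⟨i', rfl⟩ : ∃ i', i = i' + N := ⟨i - N, by omega⟩
      rw [hf, hg, ih i' (by have := Nat.pos_of_ne_zero (NeZero.ne N); omega)]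

theorem coindVal_coindEndo (x : Fin N → L) (i : ℕ) :
    coindVal τ (coindEndo τ x) i = coindVal τ x (i + 1) := by
  refine coindVal_ext_of_period τ (N := N) (f := coindVal τ (coindEndo τ x))
    (g := fun i => coindVal τ x (i + 1)) (coindVal_add τ _) (fun i => ?_) (fun i hi => ?_) i
  · rw [add_right_comm, coindVal_add]
  · exact coindVal_of_fin τ (coindEndo τ x) ⟨i, hi⟩

theorem coindVal_coindEndo_pow (m : ℕ) (x : Fin N → L) (i : ℕ) :
    coindVal τ ((coindEndo τ ^ m) x) i = coindVal τ x (i + m) := by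
  induction m generalizing x with
  | zero => rfl
  | succ m ih =>
    rw [pow_succ]
    refine (ih (coindEndo τ x)).trans ?_
    rw [coindVal_coindEndo, add_assoc]

theorem coindEndo_pow_apply (m : ℕ) (x : Fin N → L) (j : Fin N) :
    (coindEndo τ ^ m) x j = coindVal τ x (j + m) := by
  rw [← coindVal_coindEndo_pow, coindVal_of_fin]

theorem coindEndo_pow_period (x : Fin N → L) (j : Fin N) :
    (coindEndo τ ^ N) x j = τ (x j) := by
  rw [coindEndo_pow_apply, coindVal_add, coindVal_of_fin]

theorem coindVal_eq_zero_iff (x : Fin N → L) (i : ℕ) :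
    coindVal τ x i = 0 ↔ x (Fin.ofNat N i) = 0 := by
  rw [coindVal, map_eq_zero_iff _ (τ ^ (i / N)).injective]

theorem coindEndo_pow_single (l : L) (j : Fin N) :
    (coindEndo τ ^ N) (Pi.single j l) = Pi.single j (τ l) := by
  ext i
  rw [coindEndo_pow_period]
  by_cases h : i = j
  · subst h; simp
  · simp [h]

/-- All idempotents are shifts of a single one. -/
theorem exists_coindEndo_pow_single_one (i j : Fin N) :
    ∃ m, (coindEndo τ ^ m) (Pi.single i 1) = Pi.single j (1 : L) := by
  refine ⟨i + N - j, ?_⟩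
  ext l
  rw [coindEndo_pow_apply]
  have hi := i.2
  have hj := j.2
  have hl := l.2
  by_cases h : l = j
  · subst h
    have h1 : (l : ℕ) + (i + N - l) = i + N := by omega
    rw [h1, coindVal_add, coindVal_of_fin]
    simp
  · rw [Pi.single_eq_of_ne h, coindVal_eq_zero_iff, Pi.single_eq_of_ne]
    intro hc
    have h1 := congrArg Fin.val hc
    simp only [Fin.ofNat] at h1
    have h2 : (l : ℕ) ≠ j := fun h' => h (Fin.ext h')
    have h3 : ((l : ℕ) + (i + N - j)) % N = (i : ℕ) % N := by
      rw [h1, Nat.mod_eq_of_lt hi]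
    have h4 : ((l : ℕ) + (i + N - j)) ≡ j + (i + N - j) [MOD N] := by
      have h5 : (j : ℕ) + (i + N - j) = i + N := by omega
      rw [h5, Nat.ModEq, h3, Nat.add_mod_right]
    have h6 := Nat.ModEq.add_right_cancel' _ h4
    rw [Nat.ModEq, Nat.mod_eq_of_lt hl, Nat.mod_eq_of_lt hj] at h6
    exact h2 h6

theorem pseudoField_coind : PseudoField (Fin N → L) (coindEndo τ) := by
  refine ⟨⟨bot_ne_top, fun I hI => ?_⟩, inferInstance, fun x hx => ?_⟩
  · by_cases h : I = ⊥
    · exact Or.inl h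
    right
    obtain ⟨x, hx, hx0⟩ := Submodule.exists_mem_ne_zero_of_ne_bot h
    obtain ⟨i, hi⟩ : ∃ i, x i ≠ 0 := by
      by_contra! h'
      exact hx0 (funext h')
    have hpow : ∀ m, ∀ y ∈ I, (coindEndo τ ^ m) y ∈ I := by
      intro m
      induction m with
      | zero => exact fun y hy => hy
      | succ m ih => exact fun y hy => by rw [pow_succ]; exact ih _ (hI y hy)
    have h1 : Pi.single i (1 : L) ∈ I := by
      have : Pi.single i (1 : L) = Pi.single i (x i)⁻¹ * x := by
        rw [← Pi.single_mul_left, inv_mul_cancel₀ hi]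
      rw [this]
      exact I.mul_mem_left _ hx
    rw [Ideal.eq_top_iff_one, ← Finset.univ_sum_single (1 : Fin N → L)]
    refine Submodule.sum_mem _ fun j _ => ?_
    obtain ⟨m, hm⟩ := exists_coindEndo_pow_single_one τ i j
    rw [Pi.one_apply, ← hm]
    exact hpow m _ h1
  · rw [Pi.isUnit_iff]
    intro i
    rw [isUnit_iff_ne_zero]
    intro h0
    have h1 : Pi.single i (1 : L) * x = 0 := by
      rw [← Pi.single_mul_left, h0, mul_zero, Pi.single_zero]
    have h2 := (mem_nonZeroDivisors_iff_right.mp hx) _ h1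
    exact one_ne_zero ((Pi.single_eq_zero_iff).mp h2)

/-- The equivariant homomorphism into the coinduced ring attached to a homomorphism that is
equivariant for the `N`-th powers. -/
def coindHom {C : Type*} [CommRing C] (N : ℕ) (σ : C →+* C) (h : C →+* L) :
    C →+* (Fin N → L) :=
  RingHom.pi fun j => h.comp (σ ^ (j : ℕ))

theorem coindHom_apply {C : Type*} [CommRing C] (σ : C →+* C) (h : C →+* L) (x : C) (j : Fin N) :
    coindHom N σ h x j = h ((σ ^ (j : ℕ)) x) := rfl

variable {τ}

theorem coindVal_coindHom {C : Type*} [CommRing C] {σ : C →+* C} {h : C →+* L}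
    (hh : ∀ x, h ((σ ^ N) x) = τ (h x)) (x : C) (i : ℕ) :
    coindVal τ (coindHom N σ h x) i = h ((σ ^ i) x) := by
  refine coindVal_ext_of_period τ (N := N) (f := coindVal τ (coindHom N σ h x))
    (g := fun i => h ((σ ^ i) x)) (coindVal_add τ _) (fun i => ?_) (fun i hi => ?_) i
  · rw [add_comm i N, pow_add, ← hh]; rfl
  · exact coindVal_of_fin τ (coindHom N σ h x) ⟨i, hi⟩

theorem coindEndo_coindHom {C : Type*} [CommRing C] {σ : C →+* C} {h : C →+* L}
    (hh : ∀ x, h ((σ ^ N) x) = τ (h x)) (x : C) :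
    coindEndo τ (coindHom N σ h x) = coindHom N σ h (σ x) := by
  ext j
  change coindVal τ _ _ = _
  rw [coindVal_coindHom hh, pow_succ]
  rfl

end Coinduced

section RingHomTrdeg

/-- The transcendence degree of a ring homomorphism. -/
noncomputable def ringHomTrdeg {k : Type*} {Ω : Type*} [CommRing k] [CommRing Ω] (f : k →+* Ω) :
    Cardinal :=
  @Algebra.trdeg k Ω _ _ f.toAlgebra

theorem ringHomTrdeg_algebraMap (k Ω : Type*) [CommRing k] [CommRing Ω] [h : Algebra k Ω] :
    ringHomTrdeg (algebraMap k Ω) = Algebra.trdeg k Ω := by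
  rw [ringHomTrdeg]
  congr 1

theorem ringHomTrdeg_comp {k F Ω : Type u} [Field k] [Field F] [Field Ω]
    (f : F →+* Ω) (g : k →+* F) :
    ringHomTrdeg (f.comp g) = ringHomTrdeg g + ringHomTrdeg f := by
  let := f.toAlgebra
  let := g.toAlgebra
  let := (f.comp g).toAlgebra
  have : IsScalarTower k F Ω := IsScalarTower.of_algebraMap_eq fun _ => rfl
  exact (trdeg_add_eq (R := k) (S := F) (A := Ω)).symm

theorem ringHomTrdeg_of_surjective {k F : Type u} [Field k] [Field F] {g : k →+* F}
    (hg : Function.Surjective g) : ringHomTrdeg g = 0 := by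
  let := g.toAlgebra
  have : Algebra.IsAlgebraic k F := ⟨fun x => by
    obtain ⟨y, rfl⟩ := hg x
    exact isAlgebraic_algebraMap y⟩
  exact trdeg_eq_zero (R := k) (A := F)

theorem surjective_pow {R : Type*} [CommRing R] {σ : R →+* R} (h : Function.Surjective σ) (m : ℕ) :
    Function.Surjective (σ ^ m : R →+* R) := by
  rw [RingHom.coe_pow]
  exact h.iterate m

theorem trdeg_quotient_lt {k B : Type u} [Field k] [CommRing B] [IsDomain B] [Algebra k B]
    (hfin : Algebra.trdeg k B < Cardinal.aleph0) (p : Ideal B) [p.IsPrime] (hp : p ≠ ⊥) :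
    Algebra.trdeg k (B ⧸ p) < Algebra.trdeg k B := by
  by_contra! hle
  have : FaithfulSMul k (B ⧸ p) := (faithfulSMul_iff_algebraMap_injective k (B ⧸ p)).mpr
    (algebraMap k (B ⧸ p)).injective
  have : FaithfulSMul k B := (faithfulSMul_iff_algebraMap_injective k B).mpr
    (algebraMap k B).injective
  obtain ⟨ι, y, hy⟩ := exists_isTranscendenceBasis' k (B ⧸ p)
  choose x hx using fun i => Ideal.Quotient.mk_surjective (y i)
  have hxy : (Ideal.Quotient.mkₐ k p) ∘ x = y := funext hx
  have hxi : AlgebraicIndependent k x :=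
    AlgebraicIndependent.of_comp (Ideal.Quotient.mkₐ k p) (hxy ▸ hy.1)
  have hb := hxi.isTranscendenceBasis_of_trdeg_le hfin (hle.trans hy.cardinalMk_eq_trdeg.ge)
  obtain ⟨b, hbp, hb0⟩ := Submodule.exists_mem_ne_zero_of_ne_bot hp
  have := hb.isAlgebraic
  obtain ⟨r, hr, hdvd⟩ := (Algebra.IsAlgebraic.isAlgebraic
    (R := Algebra.adjoin k (Set.range x)) b).exists_nonzero_dvd (mem_nonZeroDivisors_of_ne_zero hb0)
  have hrp : (r : B) ∈ p := Ideal.mem_of_dvd p hdvd hbp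
  have hr2 : (r : B) ∈ (MvPolynomial.aeval (R := k) x).range :=
    Algebra.adjoin_range_eq_range_aeval k x ▸ r.2
  obtain ⟨P, hP : MvPolynomial.aeval x P = r⟩ := hr2
  have h0 : MvPolynomial.aeval y P = 0 := by
    rw [← Ideal.Quotient.eq_zero_iff_mem.mpr hrp, ← hP, ← hxy]
    exact (MvPolynomial.comp_aeval_apply x (Ideal.Quotient.mkₐ k p) P).symm
  apply hr
  apply Subtype.ext
  rw [← hP, (algebraicIndependent_iff.mp hy.1) P h0]
  simp

end RingHomTrdeg

section Localizer

theorem trdeg_fractionRing (k B : Type u) [Field k] [CommRing B] [IsDomain B] [Algebra k B] :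
    Algebra.trdeg k (FractionRing B) = Algebra.trdeg k B := by
  have : FaithfulSMul k B := (faithfulSMul_iff_algebraMap_injective k B).mpr
    (algebraMap k B).injective
  have : Algebra.IsAlgebraic B (FractionRing B) := IsLocalization.isAlgebraic _ (nonZeroDivisors B)
  rw [← trdeg_add_eq (R := k) (S := B) (A := FractionRing B), trdeg_eq_zero (R := B), add_zero]

theorem isAlgebraic_of_subalgebra_le {k D : Type*} [CommRing k] [CommRing D] [Algebra k D]
    {A B : Subalgebra k D} (h : A ≤ B) [Algebra.IsAlgebraic A D] : Algebra.IsAlgebraic B D := by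
  refine ⟨fun x => ?_⟩
  obtain ⟨p, hp0, hp⟩ := Algebra.IsAlgebraic.isAlgebraic (R := A) x
  refine ⟨p.map (Subalgebra.inclusion h).toRingHom, ?_, ?_⟩
  · rwa [Ne, Polynomial.map_eq_zero_iff]
    exact Subalgebra.inclusion_injective h
  · rw [← hp, Polynomial.aeval_def, Polynomial.aeval_def, Polynomial.eval₂_map]
    rfl

/-- The subalgebra generated by the orbits of a finite family. -/
def orbitAdjoin (k : Type*) {D ι : Type*} [CommRing k] [CommRing D] [Algebra k D] (τ : D →+* D)
    (v : ι → D) : Subalgebra k D :=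
  Algebra.adjoin k {x | ∃ i m, (τ ^ m) (v i) = x}

theorem orbitAdjoin_stable {k D ι : Type*} [CommRing k] [CommRing D] [Algebra k D] {τ : D →+* D}
    {σk : k →+* k} (hτ : ∀ c, τ (algebraMap k D c) = algebraMap k D (σk c)) (v : ι → D) :
    ∀ x ∈ orbitAdjoin k τ v, τ x ∈ orbitAdjoin k τ v := by
  intro x hx
  induction hx using Algebra.adjoin_induction with
  | mem x hx =>
    obtain ⟨i, m, rfl⟩ := hx
    exact Algebra.subset_adjoin ⟨i, m + 1, by rw [pow_succ']; rfl⟩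
  | algebraMap r => rw [hτ]; exact Subalgebra.algebraMap_mem _ _
  | add x y _ _ hx hy => rw [map_add]; exact add_mem hx hy
  | mul x y _ _ hx hy => rw [map_mul]; exact mul_mem hx hy

theorem adjoin_subalgebra_eq_top {k D : Type*} [CommRing k] [CommRing D] [Algebra k D]
    (B : Subalgebra k D) {s : Set D} (h : Algebra.adjoin k s = ⊤) : Algebra.adjoin B s = ⊤ := by
  rw [eq_top_iff]
  intro x _
  have hx : x ∈ Algebra.adjoin k s := h ▸ Algebra.mem_top
  induction hx using Algebra.adjoin_induction with
  | mem x hx => exact Algebra.subset_adjoin hx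
  | algebraMap r => exact (Algebra.adjoin B s).algebraMap_mem (algebraMap k B r)
  | add x y _ _ hx hy => exact add_mem (hx trivial) (hy trivial)
  | mul x y _ _ hx hy => exact mul_mem (hx trivial) (hy trivial)

theorem exists_periodic_prime_avoidance_of_subalgebra {k D : Type u} [Field k] [CommRing D]
    [IsDomain D] [Algebra k D] {σk : k →+* k} (hσk : Function.Surjective σk) (τ : D →+* D)
    (hτinj : Function.Injective τ) (hτ : ∀ c, τ (algebraMap k D c) = algebraMap k D (σk c))
    {c : ℕ → D} {s : ℕ} (hs : 1 ≤ s) (hc : ∀ i, c (i + s) = τ (c i))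
    (htop : Algebra.adjoin k (Set.range c) = ⊤) {t : ℕ} (ht : Algebra.trdeg k D = t)
    (hmin : ∀ (Ω : Type u) [Field Ω] (a : D →+* Ω) (N : ℕ) (τ' : Ω →+* Ω), 1 ≤ N →
      (∀ x, a ((τ ^ N) x) = τ' (a x)) → (t : Cardinal) ≤ ringHomTrdeg (a.comp (algebraMap k D)))
    (B : Subalgebra k D) (τB : B →+* B) (hτB : ∀ b, (τB b : D) = τ b)
    [Algebra.IsAlgebraic B D] :
    ∃ g : B, g ≠ 0 ∧ ∀ q : Ideal B, q.IsPrime → ∀ d, 1 ≤ d → Ideal.comap (τB ^ d) q = q →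
        (∀ j, (τB ^ j) g ∉ q) → q = ⊥ := by
  have htop' : Algebra.adjoin B (Set.range c) = ⊤ := adjoin_subalgebra_eq_top B htop
  obtain ⟨q₀, g, hg, hU⟩ := exists_universal_specialization (B := B) τB τ hτinj
    (fun b => (hτB b).symm) hs hc htop'
  refine ⟨g, hg, fun q hq d hd hqd hgj => ?_⟩
  by_contra hq0
  let κ := FractionRing (B ⧸ q)
  have hqd' : q ≤ Ideal.comap (τB ^ d) q := hqd.ge
  let τq : B ⧸ q →+* B ⧸ q := Ideal.quotientMap q (τB ^ d) hqd'
  have hτq : Function.Injective τq := Ideal.quotientMap_injective' hqd.le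
  let τκ : κ →+* κ := IsFractionRing.map hτq
  let hB : B →+* κ := (algebraMap (B ⧸ q) κ).comp (Ideal.Quotient.mk q)
  obtain ⟨Ω, _, _, τ'', N, a, hN, ha, haτ, -, -, htr⟩ := hU d hd κ τκ hB (fun c => by
      change algebraMap (B ⧸ q) κ (τq (Ideal.Quotient.mk q c)) = _
      exact (IsLocalization.map_eq _ _).symm) (fun j h0 => by
      rw [← RingHom.coe_pow] at h0
      exact hgj j (Ideal.Quotient.eq_zero_iff_mem.mp
        ((map_eq_zero_iff _ (IsFractionRing.injective (B ⧸ q) κ)).mp h0)))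
  have h1 := hmin Ω a (d * N) τ'' (Nat.mul_pos hd hN) haτ
  have hτB' : ∀ c, τB (algebraMap k B c) = algebraMap k B (σk c) := fun c =>
    Subtype.ext ((hτB _).trans (hτ c))
  have h2 : a.comp (algebraMap k D) =
      ((algebraMap κ Ω).comp (algebraMap k κ)).comp (σk ^ q₀) := by
    ext x
    have h3 := ha (algebraMap k B x)
    rw [pow_apply_algebraMap hτB'] at h3
    exact h3
  rw [trdeg_eq_zero (R := B) (A := D)] at htr
  have htr0 : Algebra.trdeg κ Ω = 0 := le_antisymm htr bot_le
  rw [h2, ringHomTrdeg_comp, ringHomTrdeg_of_surjective (surjective_pow hσk q₀), zero_add,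
    ringHomTrdeg_comp, ringHomTrdeg_algebraMap, ringHomTrdeg_algebraMap, htr0, add_zero,
    trdeg_fractionRing, ← ht] at h1
  have h4 : Algebra.trdeg k B ≤ Algebra.trdeg k D :=
    trdeg_le_of_injective B.val Subtype.val_injective
  have h5 := trdeg_quotient_lt (k := k) (B := B)
    (h4.trans_lt (by rw [ht]; exact Cardinal.natCast_lt_aleph0)) q hq0
  exact absurd (h1.trans_lt h5) (not_lt.mpr h4)

/-- For a `τ`-generated domain `D` of minimal transcendence degree `t` among its specializations,
there is a transcendence basis whose orbits generate a ring `B` in which only the zero ideal is a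
periodic prime avoiding the orbit of a suitable element. -/
theorem exists_periodic_prime_avoidance {k D : Type u} [Field k] [CommRing D] [IsDomain D]
    [Algebra k D] {σk : k →+* k} (hσk : Function.Surjective σk) (τ : D →+* D)
    (hτinj : Function.Injective τ) (hτ : ∀ c, τ (algebraMap k D c) = algebraMap k D (σk c))
    {c : ℕ → D} {s : ℕ} (hs : 1 ≤ s) (hc : ∀ i, c (i + s) = τ (c i))
    (htop : Algebra.adjoin k (Set.range c) = ⊤) {t : ℕ} (ht : Algebra.trdeg k D = t)
    (hmin : ∀ (Ω : Type u) [Field Ω] (a : D →+* Ω) (N : ℕ) (τ' : Ω →+* Ω), 1 ≤ N →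
      (∀ x, a ((τ ^ N) x) = τ' (a x)) → (t : Cardinal) ≤ ringHomTrdeg (a.comp (algebraMap k D))) :
    ∃ (v : Fin t → D) (τB : orbitAdjoin k τ v →+* orbitAdjoin k τ v) (g : orbitAdjoin k τ v),
      (∀ b, (τB b : D) = τ b) ∧ g ≠ 0 ∧ Algebra.IsAlgebraic (orbitAdjoin k τ v) D ∧
      ∀ q : Ideal (orbitAdjoin k τ v), q.IsPrime → ∀ d, 1 ≤ d → Ideal.comap (τB ^ d) q = q →
        (∀ j, (τB ^ j) g ∉ q) → q = ⊥ := by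
  have : FaithfulSMul k D := (faithfulSMul_iff_algebraMap_injective k D).mpr
    (algebraMap k D).injective
  obtain ⟨ι, v', hv'⟩ := exists_isTranscendenceBasis' k D
  obtain ⟨ef⟩ : Nonempty (Fin t ≃ ι) := by
    rw [← Cardinal.lift_mk_eq', hv'.cardinalMk_eq_trdeg, ht]
    simp
  let v := v' ∘ ef
  let B := orbitAdjoin k τ v
  let τB : B →+* B := (τ.comp B.val.toRingHom).codRestrict B
    fun b => orbitAdjoin_stable hτ v b b.2
  have hτB : ∀ b, (τB b : D) = τ b := fun _ => rfl
  have hle : Algebra.adjoin k (Set.range v') ≤ B := by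
    refine Algebra.adjoin_le ?_
    rintro _ ⟨i, rfl⟩
    exact Algebra.subset_adjoin ⟨ef.symm i, 0, by simp [v]⟩
  have halg : Algebra.IsAlgebraic B D := by
    have := hv'.isAlgebraic
    exact isAlgebraic_of_subalgebra_le hle
  obtain ⟨g, hg, hU⟩ := exists_periodic_prime_avoidance_of_subalgebra hσk τ hτinj hτ hs hc htop ht
    hmin B τB hτB
  exact ⟨v, τB, g, hτB, hg, halg, hU⟩

end Localizer

section Encoding

/-- Finitely many field elements can be encoded in a single element of the coinduced ring. -/
theorem exists_encoding {L : Type*} [Field L] [Infinite L] {N : ℕ} [NeZero N] (τ : L →+* L)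
    (ℓ : ℕ → L) {r : ℕ} (hN : 2 ^ (r + 1) ≤ N) (e₀ : Fin N) (he₀ : (e₀ : ℕ) = 1) :
    ∃ x : Fin N → L, IsUnit (1 + x) ∧ ∀ i, 1 ≤ i → i ≤ r →
      x * (coindEndo τ ^ (2 ^ i - 1)) x = Pi.single e₀ (ℓ i) := by
  classical
  obtain ⟨T, hT⟩ := Infinite.exists_notMem_finset
    (insert 0 (insert (-1) ((Finset.range (r + 1)).image fun i => - ℓ i)) : Finset L)
  simp only [Finset.mem_insert, Finset.mem_image, Finset.mem_range, not_or, not_exists,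
    not_and] at hT
  obtain ⟨hT0, hT1, hTℓ⟩ := hT
  let X : ℕ → L := fun j => if j = 1 then T else
    if 2 ^ (Nat.log 2 j) = j ∧ Nat.log 2 j ≤ r then ℓ (Nat.log 2 j) / T else 0
  have hX1 : X 1 = T := if_pos rfl
  have hXpow : ∀ i, 1 ≤ i → i ≤ r → X (2 ^ i) = ℓ i / T := by
    intro i hi hir
    have h1 : 2 ^ i ≠ 1 := (Nat.one_lt_two_pow (by omega)).ne'
    simp only [X, if_neg h1, Nat.log_pow (le_refl 2), true_and, if_pos hir]
  have hXne : ∀ j, X j ≠ 0 → ∃ a ≤ r, j = 2 ^ a := by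
    intro j hj
    by_cases h1 : j = 1
    · exact ⟨0, Nat.zero_le _, h1⟩
    · simp only [X, if_neg h1] at hj
      split_ifs at hj with h2
      · exact ⟨_, h2.2, h2.1.symm⟩
      · exact absurd rfl hj
  refine ⟨fun j => X j, ?_, fun i hi hir => ?_⟩
  · rw [Pi.isUnit_iff]
    intro j
    rw [isUnit_iff_ne_zero]
    change 1 + X j ≠ 0
    by_cases h1 : (j : ℕ) = 1
    · rw [h1, hX1]
      exact fun h => hT1 (eq_neg_of_add_eq_zero_right h)
    · by_cases h2 : X j = 0
      · rw [h2]; simp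
      · obtain ⟨a, har, ha⟩ := hXne _ h2
        have ha1 : 1 ≤ a := by
          by_contra h
          exact h1 (by rw [ha, show a = 0 by omega, pow_zero])
        rw [ha, hXpow a ha1 har]
        intro h
        refine hTℓ a (by omega) ?_
        field_simp at h
        linear_combination -h
  · ext j
    rw [Pi.mul_apply, coindEndo_pow_apply]
    have h2i : 2 ≤ 2 ^ i := by
      calc 2 = 2 ^ 1 := rfl
        _ ≤ 2 ^ i := Nat.pow_le_pow_right two_pos hi
    have h2ir : 2 ^ i ≤ 2 ^ r := Nat.pow_le_pow_right two_pos hir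
    rw [pow_succ] at hN
    have key : ∀ m, m < N → coindVal τ (fun j : Fin N => X j) m = X m := fun m hm =>
      coindVal_of_fin τ (fun j : Fin N => X j) ⟨m, hm⟩
    by_cases h1 : j = e₀
    · subst h1
      rw [Pi.single_eq_same, he₀, key _ (by omega), show 1 + (2 ^ i - 1) = 2 ^ i by omega, hX1,
        hXpow i hi hir]
      field_simp
    · rw [Pi.single_eq_of_ne h1]
      by_contra h0
      obtain ⟨h3, h4⟩ := mul_ne_zero_iff.mp h0
      obtain ⟨a, har, ha⟩ := hXne _ h3
      have ha1 : 1 ≤ a := by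
        by_contra h
        exact h1 (Fin.ext (by rw [ha, he₀, show a = 0 by omega, pow_zero]))
      have h2ar : 2 ^ a ≤ 2 ^ r := Nat.pow_le_pow_right two_pos har
      rw [ha, key _ (by omega)] at h4
      obtain ⟨b, hbr, hb⟩ := hXne _ h4
      have e1 : Even (2 ^ a) := (Nat.even_pow.mpr ⟨even_two, by omega⟩)
      have e2 : Even (2 ^ i) := (Nat.even_pow.mpr ⟨even_two, by omega⟩)
      have hb0 : b ≠ 0 := by
        rintro rfl
        have : 0 < 2 ^ a := by positivity
        omega
      have e3 : Even (2 ^ b) := (Nat.even_pow.mpr ⟨even_two, hb0⟩)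
      obtain ⟨u1, hu1⟩ := e1
      obtain ⟨u2, hu2⟩ := e2
      obtain ⟨u3, hu3⟩ := e3
      omega

/-- To show that only the zero ideal of an equivariant subring of the coinduced ring is pseudo
prime, it suffices to look at the primes containing the kernel of a fixed coordinate. -/
theorem pseudoPrime_eq_bot_of_coord {L : Type*} [Field L] {N : ℕ} [NeZero N] {τ : L →+* L}
    {V : Subring (Fin N → L)} {σV : V →+* V} (hσV : ∀ v, (σV v : Fin N → L) = coindEndo τ v)
    (e₀ : Fin N)
    (h : ∀ q : Ideal V, q.IsPrime → ∀ d, 1 ≤ d → Ideal.comap (σV ^ d) q = q →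
      (∀ z : V, (z : Fin N → L) e₀ = 0 → z ∈ q) → ∀ z ∈ q, (z : Fin N → L) e₀ = 0)
    (p : Ideal V) (hp : PseudoPrime σV p) : p = ⊥ := by
  have hpow : ∀ m (v : V), ((σV ^ m) v : Fin N → L) = (coindEndo τ ^ m) v := by
    intro m
    induction m with
    | zero => exact fun _ => rfl
    | succ m ih => intro v; rw [pow_succ, pow_succ]; exact (ih _).trans (by rw [hσV]; rfl)
  obtain ⟨d, hd, q, hq, hqd, rfl⟩ := hp
  let P : Fin N → Ideal V := fun j =>
    RingHom.ker ((Pi.evalRingHom (fun _ => L) j).comp V.subtype)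
  have hP : ∀ j (z : V), z ∈ P j ↔ (z : Fin N → L) j = 0 := fun j z => Iff.rfl
  obtain ⟨j, -, hj⟩ : ∃ j ∈ Finset.univ, P j ≤ q := by
    refine (Ideal.IsPrime.inf_le' hq).mp ?_
    intro z hz
    rw [Submodule.mem_finsetInf] at hz
    have : z = 0 := Subtype.ext (funext fun j => hz j (Finset.mem_univ _))
    rw [this]; exact q.zero_mem
  obtain ⟨i, hi⟩ : ∃ i : ℕ, Fin.ofNat N (j + i) = e₀ := by
    refine ⟨e₀ + N - j, Fin.ext ?_⟩
    have h1 : (j : ℕ) + (e₀ + N - j) = e₀ + N := by omega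
    simp only [Fin.ofNat, h1, Nat.add_mod_right, Nat.mod_eq_of_lt e₀.2]
  let q' := Ideal.comap (σV ^ i) q
  have h1 := h q' (hq.comap _) d hd (by
    rw [Ideal.comap_comap, ← RingHom.mul_def, ← pow_add, add_comm, pow_add, RingHom.mul_def,
      ← Ideal.comap_comap, hqd]) (fun z hz => by
    apply hj
    rw [hP, hpow, coindEndo_pow_apply, coindVal_eq_zero_iff, hi]
    exact hz)
  rw [eq_bot_iff]
  intro x hx
  have hx' : ∀ m < d, (σV ^ m) x ∈ q := fun m hm => by
    simp only [Submodule.mem_iInf, Finset.mem_range, Ideal.mem_comap] at hx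
    exact hx m hm
  have hxall : ∀ m, (σV ^ m) x ∈ q := by
    intro m
    induction m using Nat.strong_induction_on with
    | _ m ih =>
      by_cases hm : m < d
      · exact hx' m hm
      · have h2 := ih (m - d) (by omega)
        rw [← hqd, Ideal.mem_comap] at h2
        have h3 : σV ^ m = σV ^ d * σV ^ (m - d) := by
          rw [← pow_add, Nat.add_sub_of_le (not_lt.mp hm)]
        rw [h3]
        exact h2
  have h4 : ∀ m, coindVal τ (x : Fin N → L) (e₀ + m) = 0 := by
    intro m
    rw [← coindEndo_pow_apply, ← hpow]
    refine h1 _ ?_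
    rw [Ideal.mem_comap]
    have h3 : σV ^ (i + m) = σV ^ i * σV ^ m := pow_add _ _ _
    have h5 := hxall (i + m)
    rw [h3] at h5
    exact h5
  refine Subtype.ext (funext fun j' => ?_)
  have h5 := h4 (j' + N - e₀)
  have h6 : (e₀ : ℕ) + (j' + N - e₀) = j' + N := by omega
  rw [h6, coindVal_add, coindVal_of_fin, map_eq_zero_iff τ τ.injective] at h5
  exact h5

end Encoding

section Coordinate

variable {L : Type*} [Field L] {N : ℕ} {V : Subring (Fin N → L)} {e₀ : Fin N}

theorem coeff_zero_mem_of_coord {B : Type*} [CommRing B] {q : Ideal V}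
    (hq : ∀ z : V, (z : Fin N → L) e₀ = 0 → z ∈ q) (j : B →+* L) (w : B → V)
    (hw : ∀ b, (w b : Fin N → L) e₀ = j b) {z : V} (hz : z ∈ q) (p : Polynomial B)
    (hp : p.eval₂ j ((z : Fin N → L) e₀) = 0) : w (p.coeff 0) ∈ q := by
  let ev : V →+* L := (Pi.evalRingHom (fun _ => L) e₀).comp V.subtype
  have h1 : p.divX.eval₂ j (ev z) ∈ ev.range := by
    rw [Polynomial.eval₂_eq_sum]
    exact Subring.sum_mem _ fun i _ =>
      mul_mem (RingHom.mem_range.mpr ⟨w _, hw _⟩) (pow_mem (RingHom.mem_range_self ev z) _)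
  obtain ⟨s, hs⟩ := h1
  have h2 : w (p.coeff 0) + z * s ∈ q := by
    refine hq _ ?_
    change ev (w (p.coeff 0) + z * s) = 0
    rw [map_add, map_mul, hs, show ev (w (p.coeff 0)) = j (p.coeff 0) from hw _, ← hp]
    have h3 := congrArg (Polynomial.eval₂ j (ev z)) (Polynomial.divX_mul_X_add p)
    rw [Polynomial.eval₂_add, Polynomial.eval₂_mul, Polynomial.eval₂_X, Polynomial.eval₂_C] at h3
    rw [add_comm, mul_comm]
    exact h3
  exact (Ideal.add_mem_iff_left q (q.mul_mem_right _ hz)).mp h2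

theorem coord_eq_zero_of_isUnit {k : Type*} [Field k] {q : Ideal V} [q.IsPrime]
    (hq : ∀ z : V, (z : Fin N → L) e₀ = 0 → z ∈ q) (j : k →+* L) (w : k →+* V)
    (hw : ∀ b, (w b : Fin N → L) e₀ = j b)
    (halg : ∀ l : L, l ≠ 0 → ∃ p : Polynomial k, p.coeff 0 ≠ 0 ∧ p.eval₂ j l = 0)
    {z : V} (hz : z ∈ q) : (z : Fin N → L) e₀ = 0 := by
  by_contra h0
  obtain ⟨p, hp0, hp⟩ := halg _ h0
  have h1 := coeff_zero_mem_of_coord hq j w hw hz p hp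
  exact ‹q.IsPrime›.ne_top (Ideal.eq_top_of_isUnit_mem _ h1 ((isUnit_iff_ne_zero.mpr hp0).map w))

theorem coord_eq_zero_of_avoidance [NeZero N] {τ : L →+* L} {σV : V →+* V}
    (hσV : ∀ v, (σV v : Fin N → L) = coindEndo τ v) {B : Type*} [CommRing B] {τB : B →+* B}
    {g : B}
    (hav : ∀ q : Ideal B, q.IsPrime → ∀ d, 1 ≤ d → Ideal.comap (τB ^ d) q = q →
        (∀ j, (τB ^ j) g ∉ q) → q = ⊥)
    (j : B →+* L) (hjτ : ∀ b, τ (j b) = j (τB b)) (hg : j g ≠ 0)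
    (hVB : ∀ b, Pi.single e₀ (j b) ∈ V) (hVg : Pi.single e₀ (j g)⁻¹ ∈ V)
    (halg : ∀ l : L, l ≠ 0 → ∃ p : Polynomial B, p.coeff 0 ≠ 0 ∧ p.eval₂ j l = 0)
    (q : Ideal V) (hqp : q.IsPrime) (d : ℕ) (hd : 1 ≤ d) (hqd : Ideal.comap (σV ^ d) q = q)
    (hq : ∀ z : V, (z : Fin N → L) e₀ = 0 → z ∈ q) (z : V) (hz : z ∈ q) :
    (z : Fin N → L) e₀ = 0 := by
  by_contra h0
  have hpow : ∀ m (v : V), ((σV ^ m) v : Fin N → L) = (coindEndo τ ^ m) v := by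
    intro m
    induction m with
    | zero => exact fun _ => rfl
    | succ m ih => intro v; rw [pow_succ, pow_succ]; exact (ih _).trans (by rw [hσV]; rfl)
  let w : B → V := fun b => ⟨Pi.single e₀ (j b), hVB b⟩
  have hw : ∀ b, (w b : Fin N → L) e₀ = j b := fun b => Pi.single_eq_same _ _
  have hw1 : 1 - w 1 ∈ q := hq _ (by
    change (1 : Fin N → L) e₀ - (w 1 : Fin N → L) e₀ = 0
    rw [hw, map_one, Pi.one_apply, sub_self])
  let χ : B →+* V ⧸ q :=
    { toFun := fun b => Ideal.Quotient.mk q (w b)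
      map_one' := by
        rw [← map_one (Ideal.Quotient.mk q), eq_comm]
        exact Ideal.Quotient.eq.mpr hw1
      map_mul' := fun a b => by
        rw [← map_mul]
        congr 1
        exact Subtype.ext (by simp [w, Pi.single_mul])
      map_zero' := by
        rw [← map_zero (Ideal.Quotient.mk q)]
        congr 1
        exact Subtype.ext (by simp [w])
      map_add' := fun a b => by
        rw [← map_add]
        congr 1
        exact Subtype.ext (by simp [w, Pi.single_add]) }
  have hχ : ∀ b, b ∈ RingHom.ker χ ↔ w b ∈ q := fun b => Ideal.Quotient.eq_zero_iff_mem
  have hσw : ∀ b, (σV ^ N) (w b) = w (τB b) := fun b => Subtype.ext (by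
    rw [hpow]
    change (coindEndo τ ^ N) (Pi.single e₀ (j b)) = Pi.single e₀ (j (τB b))
    rw [coindEndo_pow_single, hjτ])
  have hσw' : ∀ m b, ((σV ^ N) ^ m) (w b) = w ((τB ^ m) b) := fun m b => by
    induction m generalizing b with
    | zero => rfl
    | succ m ih =>
      rw [pow_succ, pow_succ]
      exact (congrArg _ (hσw b)).trans (ih _)
  have hqd' : ∀ m (v : V), ((σV ^ d) ^ m) v ∈ q ↔ v ∈ q := fun m => by
    induction m with
    | zero => exact fun _ => Iff.rfl
    | succ m ih =>
      intro v
      rw [pow_succ]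
      exact (ih _).trans (by rw [← Ideal.mem_comap, hqd])
  have hbot : RingHom.ker χ = ⊥ := by
    refine hav _ (RingHom.ker_isPrime χ) d hd ?_ (fun m hm => ?_)
    · ext b
      rw [Ideal.mem_comap, hχ, hχ, ← hσw', ← pow_mul, mul_comm, pow_mul, hqd']
    · rw [hχ, ← hσw'] at hm
      have h1 : ((σV ^ N) ^ m) (w g * ⟨_, hVg⟩) ∈ q := by
        rw [map_mul]; exact q.mul_mem_right _ hm
      have h2 : w g * ⟨_, hVg⟩ = w 1 := Subtype.ext (by
        simp [w, ← Pi.single_mul, mul_inv_cancel₀ hg])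
      rw [h2, hσw', map_one] at h1
      refine hqp.ne_top ((Ideal.eq_top_iff_one _).mpr ?_)
      have h3 := q.add_mem hw1 h1
      rwa [sub_add_cancel] at h3
  obtain ⟨p, hp0, hp⟩ := halg _ h0
  have h1 := coeff_zero_mem_of_coord hq j w hw hz p hp
  rw [← hχ, hbot] at h1
  exact hp0 h1

end Coordinate

section Constrained

theorem exists_endo_closure {R : Type*} [CommRing R] (σ : R →+* R) {G : Set R}
    (hG : ∀ x ∈ G, σ x ∈ G) :
    ∃ σV : Subring.closure G →+* Subring.closure G, ∀ v, (σV v : R) = σ v := by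
  have h : ∀ x ∈ Subring.closure G, σ x ∈ Subring.closure G := by
    intro x hx
    have : Subring.closure G ≤ (Subring.closure G).comap σ :=
      Subring.closure_le.mpr fun y hy => Subring.subset_closure (hG y hy)
    exact this hx
  exact ⟨σ.restrict _ _ h, fun _ => rfl⟩

theorem exists_polynomial_of_fraction {B D L : Type*} [CommRing B] [IsDomain B] [CommRing D]
    [Algebra B D] [Algebra.IsAlgebraic B D] [Field L] (ι : D →+* L)
    (hfrac : ∀ l, ∃ u v, ι v ≠ 0 ∧ l * ι v = ι u) (l : L) (hl : l ≠ 0) :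
    ∃ p : Polynomial B, p.coeff 0 ≠ 0 ∧ p.eval₂ (ι.comp (algebraMap B D)) l = 0 := by
  let : Algebra B L := (ι.comp (algebraMap B D)).toAlgebra
  let ιB : D →ₐ[B] L := { ι with commutes' := fun _ => rfl }
  obtain ⟨u, v, hv, huv⟩ := hfrac l
  have h1 : ∀ x : D, IsAlgebraic B (ι x) := fun x =>
    (Algebra.IsAlgebraic.isAlgebraic (R := B) x).algHom ιB
  have h2 : IsAlgebraic B l := by
    rw [eq_div_of_mul_eq hv huv, div_eq_mul_inv]
    exact (h1 u).mul (h1 v).inv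
  exact h2.exists_nonzero_coeff_and_aeval_eq_zero (mem_nonZeroDivisors_of_ne_zero hl)

theorem single_orbitAdjoin_mem {k D L ι : Type*} [Field k] [CommRing D] [Algebra k D] [Field L]
    {N : ℕ} [NeZero N] {τ : L →+* L} {τD : D →+* D} {j : D →+* L}
    (hj : ∀ x, τ (j x) = j (τD x)) {v : ι → D} {e₀ : Fin N} (V : Subring (Fin N → L))
    (hV : ∀ x ∈ V, coindEndo τ x ∈ V) (hk : ∀ c, Pi.single e₀ (j (algebraMap k D c)) ∈ V)
    (hv : ∀ i, Pi.single e₀ (j (v i)) ∈ V) (b : D) (hb : b ∈ orbitAdjoin k τD v) :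
    Pi.single e₀ (j b) ∈ V := by
  have hVpow : ∀ m, ∀ x ∈ V, (coindEndo τ ^ m) x ∈ V := by
    intro m
    induction m with
    | zero => exact fun x hx => hx
    | succ m ih => exact fun x hx => by rw [pow_succ]; exact ih _ (hV x hx)
  induction hb using Algebra.adjoin_induction with
  | mem x hx =>
    obtain ⟨i, m, rfl⟩ := hx
    induction m with
    | zero => exact hv i
    | succ m ih =>
      have h1 := hVpow N _ ih
      rw [coindEndo_pow_single, hj] at h1
      rw [pow_succ']
      exact h1
  | algebraMap r => exact hk r
  | add x y _ _ hx hy => rw [map_add, Pi.single_add]; exact add_mem hx hy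
  | mul x y _ _ hx hy => rw [map_mul, Pi.single_mul]; exact mul_mem hx hy

theorem constrained_of_minimal {k D L : Type u} [Field k] [CommRing D] [IsDomain D] [Algebra k D]
    [Field L] {σk : k →+* k} (hσk : Function.Surjective σk) {N : ℕ} [NeZero N] (τ : L →+* L)
    (ι : D →+* L) (hι : Function.Injective ι) (hfrac : ∀ l, ∃ u v, ι v ≠ 0 ∧ l * ι v = ι u)
    (τD : D →+* D) (hτD : ∀ x, τ (ι x) = ι (τD x))
    (hτk : ∀ c, τD (algebraMap k D c) = algebraMap k D ((σk ^ N) c))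
    {c : ℕ → D} {s : ℕ} (hs : 1 ≤ s) (hc : ∀ i, c (i + s) = τD (c i))
    (htop : Algebra.adjoin k (Set.range c) = ⊤) {t : ℕ} (ht : Algebra.trdeg k D = t)
    (hN : 2 ^ (t + 3) ≤ N)
    (hmin : ∀ (Ω : Type u) [Field Ω] (a : D →+* Ω) (N' : ℕ) (τ' : Ω →+* Ω), 1 ≤ N' →
      (∀ x, a ((τD ^ N') x) = τ' (a x)) → (t : Cardinal) ≤ ringHomTrdeg (a.comp (algebraMap k D)))
    (e : k →+* (Fin N → L)) (he : ∀ c j, e c j = ι (algebraMap k D ((σk ^ (j : ℕ)) c)))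
    (heσ : ∀ c, coindEndo τ (e c) = e (σk c))
    (m : ℕ) (a : Fin m → (Fin N → L)) :
    ∃ b binv : Fin N → L, b * binv = 1 ∧
          ∃ σV : ↥(Subring.closure (Set.range e ∪
                    {z | ∃ (j : Fin m) (m' : ℕ), (⇑(coindEndo τ))^[m'] (a j) = z} ∪
                    {z | ∃ m' : ℕ, (⇑(coindEndo τ))^[m'] binv = z})) →+*
                 ↥(Subring.closure (Set.range e ∪
                    {z | ∃ (j : Fin m) (m' : ℕ), (⇑(coindEndo τ))^[m'] (a j) = z} ∪
                    {z | ∃ m' : ℕ, (⇑(coindEndo τ))^[m'] binv = z})),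
            (∀ v, ((σV v : Fin N → L)) = coindEndo τ ↑v) ∧
            ∀ p : Ideal ↥(Subring.closure (Set.range e ∪
                    {z | ∃ (j : Fin m) (m' : ℕ), (⇑(coindEndo τ))^[m'] (a j) = z} ∪
                    {z | ∃ m' : ℕ, (⇑(coindEndo τ))^[m'] binv = z})),
              PseudoPrime σV p → p = ⊥ := by
  have hstab : ∀ binv : Fin N → L, ∀ x ∈ Set.range e ∪
        {z | ∃ (j : Fin m) (m' : ℕ), (⇑(coindEndo τ))^[m'] (a j) = z} ∪
        {z | ∃ m' : ℕ, (⇑(coindEndo τ))^[m'] binv = z}, coindEndo τ x ∈ Set.range e ∪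
        {z | ∃ (j : Fin m) (m' : ℕ), (⇑(coindEndo τ))^[m'] (a j) = z} ∪
        {z | ∃ m' : ℕ, (⇑(coindEndo τ))^[m'] binv = z} := by
    rintro binv x ((⟨c, rfl⟩ | ⟨j, m', rfl⟩) | ⟨m', rfl⟩)
    · exact Or.inl (Or.inl ⟨σk c, (heσ c).symm⟩)
    · exact Or.inl (Or.inr ⟨j, m' + 1, Function.iterate_succ_apply' _ _ _⟩)
    · exact Or.inr ⟨m' + 1, Function.iterate_succ_apply' _ _ _⟩
  have hτDinj : Function.Injective τD := fun x y h => hι (τ.injective (by rw [hτD, hτD, h]))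
  have h2N : 1 < N := lt_of_lt_of_le (Nat.one_lt_two_pow (by omega)) hN
  have : FaithfulSMul k D := (faithfulSMul_iff_algebraMap_injective k D).mpr
    (algebraMap k D).injective
  rcases Nat.eq_zero_or_pos t with rfl | htpos
  · have halg : Algebra.IsAlgebraic k D := trdeg_eq_zero_iff.mp (by rw [ht, Nat.cast_zero])
    refine ⟨1, 1, mul_one 1, ?_⟩
    obtain ⟨σV, hσV⟩ := exists_endo_closure (coindEndo τ) (hstab 1)
    refine ⟨σV, hσV, pseudoPrime_eq_bot_of_coord hσV (0 : Fin N) fun q hq d hd hqd hqP z hz => ?_⟩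
    let w := e.codRestrict (Subring.closure (Set.range e ∪
                    {z | ∃ (j : Fin m) (m' : ℕ), (⇑(coindEndo τ))^[m'] (a j) = z} ∪
                    {z | ∃ m' : ℕ, (⇑(coindEndo τ))^[m'] 1 = z}))
                    fun c => Subring.subset_closure (Or.inl (Or.inl ⟨c, rfl⟩))
    refine coord_eq_zero_of_isUnit hqP (ι.comp (algebraMap k D)) w (fun b => ?_)
      (exists_polynomial_of_fraction ι hfrac) hz
    exact he b 0
  · obtain ⟨v, τB, g, hτB, hg, halg, hav⟩ :=
      exists_periodic_prime_avoidance (surjective_pow hσk N) τD hτDinj hτk hs hc htop ht hmin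
    have htr : Algebra.Transcendental k D := by
      rw [← trdeg_ne_zero_iff, ht]
      exact_mod_cast htpos.ne'
    have : Infinite D := Algebra.Transcendental.infinite k D
    have : Infinite L := Infinite.of_injective ι hι
    let e₀ : Fin N := ⟨1, h2N⟩
    let ℓ : ℕ → L := fun i => if h : i - 3 < t then (if i = 1 then 1 else if i = 2 then (ι g)⁻¹
      else ι (v ⟨i - 3, h⟩)) else 0
    have hℓ1 : ℓ 1 = 1 := by simp [ℓ, htpos]
    have hℓ2 : ℓ 2 = (ι g)⁻¹ := by simp [ℓ, htpos]
    have hℓ3 : ∀ i : Fin t, ℓ (i + 3) = ι (v i) := fun i => by simp [ℓ]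
    obtain ⟨x, hx, hxℓ⟩ := exists_encoding τ ℓ (r := t + 2) hN e₀ rfl
    obtain ⟨b, hb⟩ := hx.exists_left_inv
    refine ⟨b, 1 + x, hb, ?_⟩
    obtain ⟨σV, hσV⟩ := exists_endo_closure (coindEndo τ) (hstab (1 + x))
    refine ⟨σV, hσV, pseudoPrime_eq_bot_of_coord hσV e₀ ?_⟩
    generalize hVdef : Subring.closure (Set.range e ∪
                    {z | ∃ (j : Fin m) (m' : ℕ), (⇑(coindEndo τ))^[m'] (a j) = z} ∪
                    {z | ∃ m' : ℕ, (⇑(coindEndo τ))^[m'] (1 + x) = z}) = V at σV hσV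
    have hVe : ∀ c, e c ∈ V := fun c => hVdef ▸ Subring.subset_closure (Or.inl (Or.inl ⟨c, rfl⟩))
    have hVσ : ∀ x ∈ V, coindEndo τ x ∈ V := fun x hx => by
      rw [← hσV ⟨x, hx⟩]; exact Subtype.property _
    have hVx : ∀ m, (coindEndo τ ^ m) x ∈ V := fun m => by
      have h1 : (coindEndo τ ^ m) (1 + x) ∈ V := hVdef ▸ Subring.subset_closure
        (Or.inr ⟨m, by rw [RingHom.coe_pow]⟩)
      rw [map_add, map_one] at h1
      simpa using sub_mem h1 V.one_mem
    have hVℓ : ∀ i, 1 ≤ i → i ≤ t + 2 → Pi.single e₀ (ℓ i) ∈ V := fun i h1 h2 => by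
      rw [← hxℓ i h1 h2]
      exact mul_mem (by simpa using hVx 0) (hVx _)
    have hV1 := hVℓ 1 le_rfl (by omega)
    rw [hℓ1] at hV1
    have hVk : ∀ c, Pi.single e₀ (ι (algebraMap k D c)) ∈ V := fun c => by
      obtain ⟨c', hc'⟩ := surjective_pow hσk e₀ c
      have h1 := mul_mem hV1 (hVe c')
      rwa [← Pi.single_mul_left, he, hc', one_mul] at h1
    have hVB := single_orbitAdjoin_mem hτD V hVσ hVk
      (fun i : Fin t => hℓ3 i ▸ hVℓ (i + 3) (by omega) (by omega))
    exact coord_eq_zero_of_avoidance hσV hav (ι.comp (orbitAdjoin k τD v).val.toRingHom)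
      (fun b => (hτD b).trans (congrArg ι (hτB b).symm))
      (fun h0 => hg (Subtype.ext (hι (h0.trans (map_zero ι).symm))))
      (fun b => hVB b b.2) (by
        have := hVℓ 2 (by omega) (by omega)
        rwa [hℓ2] at this)
      (exists_polynomial_of_fraction ι hfrac)

end Constrained

section OrbitGenerators

theorem exists_finset_orbit_generators {k C L : Type*} [Field k] [CommRing C] [Algebra k C]
    [Field L] {σk : k →+* k} (hσk : Function.Surjective σk) {σ : C →+* C} {c : ℕ → C} {s : ℕ}
    (hs : 1 ≤ s) (hc : ∀ i, c (i + s) = σ (c i)) (htop : Algebra.adjoin k (Set.range c) = ⊤)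
    (hσ : ∀ a, σ (algebraMap k C a) = algebraMap k C (σk a))
    {N : ℕ} [NeZero N] {τ : L →+* L} {h : C →+* L} (hh : ∀ x, h ((σ ^ N) x) = τ (h x))
    (hfrac : ∀ l, ∃ u v, h v ≠ 0 ∧ l * h v = h u) (e : k →+* (Fin N → L))
    (he : ∀ a, e a = coindHom N σ h (algebraMap k C a)) :
    ∃ S : Finset (Fin N → L), ∀ x : Fin N → L, ∃ a b : Fin N → L,
      a ∈ Subring.closure (Set.range e ∪ {z | ∃ s ∈ S, ∃ m : ℕ, (⇑(coindEndo τ))^[m] s = z}) ∧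
      b ∈ Subring.closure (Set.range e ∪ {z | ∃ s ∈ S, ∃ m : ℕ, (⇑(coindEndo τ))^[m] s = z}) ∧
      IsUnit b ∧ x * b = a := by
  classical
  have hN : 0 < N := Nat.pos_of_ne_zero (NeZero.ne N)
  let S : Finset (Fin N → L) := Finset.univ.image (fun j => Pi.single j 1) ∪
    (Finset.univ ×ˢ Finset.range (s * N)).image (fun p => Pi.single p.1 (h (c p.2)))
  refine ⟨S, ?_⟩
  generalize hV : Subring.closure
    (Set.range e ∪ {z | ∃ s ∈ S, ∃ m : ℕ, (⇑(coindEndo τ))^[m] s = z}) = V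
  have hVe : ∀ a, e a ∈ V := fun a => hV ▸ Subring.subset_closure (Or.inl ⟨a, rfl⟩)
  have hVS : ∀ x ∈ S, ∀ m, (coindEndo τ ^ m) x ∈ V := fun x hx m =>
    hV ▸ Subring.subset_closure (Or.inr ⟨x, hx, m, by rw [RingHom.coe_pow]⟩)
  have hV1 : ∀ j, Pi.single j 1 ∈ V := fun j => hVS _ (Finset.mem_union_left _
    (Finset.mem_image_of_mem _ (Finset.mem_univ j))) 0
  have hVτ : ∀ j i m, i < s * N → Pi.single j ((τ ^ m) (h (c i))) ∈ V := fun j i m hi => by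
    have h1 := hVS (Pi.single j (h (c i))) (Finset.mem_union_right _
      (Finset.mem_image.mpr ⟨(j, i), by simp [hi], rfl⟩)) (N * m)
    rw [pow_mul] at h1
    convert h1 using 1
    clear h1
    induction m with
    | zero => rfl
    | succ m ih =>
      rw [pow_succ', pow_succ']
      exact (coindEndo_pow_single τ _ j).symm.trans (congrArg _ ih)
  have hVc : ∀ j i, Pi.single j (h (c i)) ∈ V := fun j i => by
    have h1 : c i = (σ ^ (N * (i / (s * N)))) (c (i % (s * N))) := by
      rw [← iterate_shift_seq σ hc, ← mul_assoc, Nat.mod_add_div]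
    have h2 := hVτ j (i % (s * N)) (i / (s * N)) (Nat.mod_lt _ (Nat.mul_pos hs hN))
    rw [h1, pow_mul]
    convert h2 using 2
    exact (pow_apply_algebraMap (f := h) (τB := σ ^ N) (τ := τ) (fun x => (hh x).symm) _ _).symm
  have hVk : ∀ j a, Pi.single j (h (algebraMap k C a)) ∈ V := fun j a => by
    obtain ⟨a', ha'⟩ := surjective_pow hσk j a
    have h1 := mul_mem (hV1 j) (hVe a')
    rwa [← Pi.single_mul_left, he, coindHom_apply, pow_apply_algebraMap hσ, ha', one_mul] at h1
  have hVh : ∀ j x, Pi.single j (h x) ∈ V := fun j x => by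
    have hx : x ∈ Algebra.adjoin k (Set.range c) := htop ▸ Algebra.mem_top
    induction hx using Algebra.adjoin_induction with
    | mem x hx => obtain ⟨i, rfl⟩ := hx; exact hVc j i
    | algebraMap r => exact hVk j r
    | add x y _ _ hx hy => rw [map_add, Pi.single_add]; exact add_mem hx hy
    | mul x y _ _ hx hy => rw [map_mul, Pi.single_mul]; exact mul_mem hx hy
  intro x
  choose u v hv huv using fun j => hfrac (x j)
  refine ⟨∑ j, Pi.single j (h (u j)), ∑ j, Pi.single j (h (v j)),
    sum_mem fun j _ => hVh j _, sum_mem fun j _ => hVh j _, ?_, ?_⟩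
  · rw [Finset.univ_sum_single, Pi.isUnit_iff]
    exact fun j => isUnit_iff_ne_zero.mpr (hv j)
  · rw [Finset.univ_sum_single, Finset.univ_sum_single]
    exact funext huv

/-- A homomorphism to a field, equivariant for a power of `σ`, may be replaced by one for which
the field is the fraction field of the image. -/
theorem exists_fraction_specialization {k C Ω : Type u} [Field k] [CommRing C] [Algebra k C]
    [Field Ω] {σ : C →+* C} {N : ℕ} {τ : Ω →+* Ω} {h : C →+* Ω}
    (hh : ∀ x, h ((σ ^ N) x) = τ (h x)) :
    ∃ (L : Type u) (_ : Field L) (τ' : L →+* L) (h' : C →+* L),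
      (∀ x, h' ((σ ^ N) x) = τ' (h' x)) ∧ (∀ l, ∃ u v, h' v ≠ 0 ∧ l * h' v = h' u) ∧
      ringHomTrdeg (h'.comp (algebraMap k C)) ≤ ringHomTrdeg (h.comp (algebraMap k C)) := by
  let L := Subfield.closure (Set.range h)
  have hL : ∀ x, h x ∈ L := fun x => Subfield.subset_closure ⟨x, rfl⟩
  have hLτ : L ≤ L.comap τ := Subfield.closure_le.mpr (by
    rintro _ ⟨x, rfl⟩
    change τ (h x) ∈ L
    rw [← hh]; exact hL _)
  let h' : C →+* L := h.codRestrict L hL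
  refine ⟨L, inferInstance, τ.restrict L L hLτ, h', fun x => Subtype.ext (hh x), fun l => ?_, ?_⟩
  · obtain ⟨y, hy, z, hz, hyz⟩ := Subfield.mem_closure_iff.mp l.2
    rw [← RingHom.coe_range, Subring.closure_eq] at hy hz
    obtain ⟨u, rfl⟩ := hy
    obtain ⟨v, rfl⟩ := hz
    by_cases hv : h v = 0
    · refine ⟨0, 1, by simp, ?_⟩
      rw [hv, div_zero] at hyz
      rw [map_zero, show l = 0 from Subtype.ext hyz.symm, zero_mul]
    · refine ⟨u, v, fun h0 => hv (congrArg Subtype.val h0), Subtype.ext ?_⟩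
      exact (div_eq_iff hv).mp hyz |>.symm
  · let : Algebra k L := (h'.comp (algebraMap k C)).toAlgebra
    let : Algebra k Ω := (h.comp (algebraMap k C)).toAlgebra
    exact trdeg_le_of_injective (R := k) { L.subtype with commutes' := fun _ => rfl }
      Subtype.val_injective

theorem exists_finite_trdeg_datum {k C Ω : Type u} [Field k] [CommRing C] [Algebra k C]
    [Field Ω] {σk : k →+* k} {σ : C →+* C} {c : ℕ → C} {s : ℕ}
    (hs : 1 ≤ s) (hc : ∀ i, c (i + s) = σ (c i)) (htop : Algebra.adjoin k (Set.range c) = ⊤)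
    (hσ : ∀ a, σ (algebraMap k C a) = algebraMap k C (σk a)) {N : ℕ} (hN : 1 ≤ N)
    {τ : Ω →+* Ω} {h : C →+* Ω} (hh : ∀ x, h ((σ ^ N) x) = τ (h x)) :
    ∃ (L : Type u) (_ : Field L) (τ' : L →+* L) (h' : C →+* L),
      (∀ x, h' ((σ ^ N) x) = τ' (h' x)) ∧
      ringHomTrdeg (h'.comp (algebraMap k C)) < Cardinal.aleph0 := by
  let : Algebra k Ω := (h.comp (algebraMap k C)).toAlgebra
  have : FaithfulSMul k Ω := (faithfulSMul_iff_algebraMap_injective k Ω).mpr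
    (algebraMap k Ω).injective
  have hcN : ∀ i, c (i + s * N) = (σ ^ N) (c i) := fun i => iterate_shift_seq σ hc N i
  obtain ⟨L, _, _, _, τ', x, h1, h2, h3, h4, -⟩ := exists_finite_trdeg_specialization
    (b := fun i => h (c i)) (σk ^ N) τ (fun a => by
      change τ (h _) = h _
      rw [← hh, pow_apply_algebraMap hσ]) (Nat.mul_pos hs hN) (fun i => by rw [hcN, hh])
  let F := (MvPolynomial.aeval c : MvPolynomial ℕ k →ₐ[k] C)
  have hF : Function.Surjective F := by
    intro y
    have : y ∈ Algebra.adjoin k (Set.range c) := htop ▸ Algebra.mem_top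
    rw [Algebra.adjoin_range_eq_range_aeval] at this
    exact this
  let hk : C →ₐ[k] Ω := { h with commutes' := fun _ => rfl }
  obtain ⟨h', hh'⟩ := exists_lift_of_ker_le F.toRingHom hF (MvPolynomial.aeval x).toRingHom
    (fun p hp => h3 p (by
      have h6 := MvPolynomial.comp_aeval_apply c hk p
      rw [show MvPolynomial.aeval c p = 0 from hp, map_zero] at h6
      exact h6.symm))
  have hk' : ∀ a, h' (algebraMap k C a) = algebraMap k L a := fun a => by
    have := hh' (MvPolynomial.C a)
    simpa [F] using this
  have hc' : ∀ i, h' (c i) = x i := fun i => by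
    have := hh' (MvPolynomial.X i)
    simpa [F] using this
  refine ⟨L, inferInstance, τ', h', fun y => ?_, ?_⟩
  · have hy : y ∈ Algebra.adjoin k (Set.range c) := htop ▸ Algebra.mem_top
    induction hy using Algebra.adjoin_induction with
    | mem y hy => obtain ⟨i, rfl⟩ := hy; rw [← hcN, hc', hc', h2]
    | algebraMap r => rw [pow_apply_algebraMap hσ, hk', hk', h1]
    | add y z _ _ hy hz => simp only [map_add, hy, hz]
    | mul y z _ _ hy hz => simp only [map_mul, hy, hz]
  · rw [show h'.comp (algebraMap k C) = algebraMap k L from RingHom.ext hk', ringHomTrdeg_algebraMap]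
    exact h4

end OrbitGenerators

section Constrained

theorem constrained_of_minimal_datum {k C L : Type u} [Field k] [CommRing C] [Algebra k C]
    [Field L] {σk : k →+* k} (hσk : Function.Surjective σk) {σ : C →+* C} {c : ℕ → C} {s : ℕ}
    (hs : 1 ≤ s) (hc : ∀ i, c (i + s) = σ (c i)) (htop : Algebra.adjoin k (Set.range c) = ⊤)
    (hσ : ∀ a, σ (algebraMap k C a) = algebraMap k C (σk a))
    {N : ℕ} [NeZero N] {τ : L →+* L} {h : C →+* L} (hh : ∀ x, h ((σ ^ N) x) = τ (h x))
    (hfrac : ∀ l, ∃ u v, h v ≠ 0 ∧ l * h v = h u) {t : ℕ}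
    (ht : ringHomTrdeg (h.comp (algebraMap k C)) = t) (hN : 2 ^ (t + 3) ≤ N)
    (hmin : ∀ (Ω : Type u) [Field Ω] (a : C →+* Ω) (N' : ℕ) (τ' : Ω →+* Ω), 1 ≤ N' →
      (∀ x, a ((σ ^ N') x) = τ' (a x)) → (t : Cardinal) ≤ ringHomTrdeg (a.comp (algebraMap k C)))
    (e : k →+* (Fin N → L)) (he : ∀ a, e a = coindHom N σ h (algebraMap k C a))
    (m : ℕ) (a : Fin m → (Fin N → L)) :
    ∃ b binv : Fin N → L, b * binv = 1 ∧
          ∃ σV : ↥(Subring.closure (Set.range e ∪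
                    {z | ∃ (j : Fin m) (m' : ℕ), (⇑(coindEndo τ))^[m'] (a j) = z} ∪
                    {z | ∃ m' : ℕ, (⇑(coindEndo τ))^[m'] binv = z})) →+*
                 ↥(Subring.closure (Set.range e ∪
                    {z | ∃ (j : Fin m) (m' : ℕ), (⇑(coindEndo τ))^[m'] (a j) = z} ∪
                    {z | ∃ m' : ℕ, (⇑(coindEndo τ))^[m'] binv = z})),
            (∀ v, ((σV v : Fin N → L)) = coindEndo τ ↑v) ∧
            ∀ p : Ideal ↥(Subring.closure (Set.range e ∪
                    {z | ∃ (j : Fin m) (m' : ℕ), (⇑(coindEndo τ))^[m'] (a j) = z} ∪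
                    {z | ∃ m' : ℕ, (⇑(coindEndo τ))^[m'] binv = z})),
              PseudoPrime σV p → p = ⊥ := by
  have hNpos : 0 < N := Nat.pos_of_ne_zero (NeZero.ne N)
  let g : C →+* h.range := h.rangeRestrict
  have hg : Function.Surjective g := h.rangeRestrict_surjective
  let := (g.comp (algebraMap k C)).toAlgebra
  let gA : C →ₐ[k] h.range := { g with commutes' := fun _ => rfl }
  have hτr : ∀ x : h.range, τ x ∈ h.range := by
    rintro ⟨_, x, rfl⟩
    exact ⟨(σ ^ N) x, hh x⟩
  let τD : h.range →+* h.range := (τ.comp h.range.subtype).codRestrict h.range hτr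
  have hgτ : ∀ x, g ((σ ^ N) x) = τD (g x) := fun x => Subtype.ext (hh x)
  have hfrac' : ∀ l, ∃ u v, h.range.subtype v ≠ 0 ∧ l * h.range.subtype v = h.range.subtype u :=
    fun l => by
      obtain ⟨u, v, hv, huv⟩ := hfrac l
      exact ⟨g u, g v, hv, huv⟩
  refine constrained_of_minimal hσk τ h.range.subtype Subtype.val_injective hfrac' τD
    (fun _ => rfl) (fun a => ?_) (c := fun i => g (c i)) (s := s * N) (Nat.mul_pos hs hNpos)
    (fun i => ?_) ?_ (t := t) ?_ hN (fun Ω _ a N' τ' hN' ha => ?_) e (fun a j => ?_)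
    (fun a => ?_) m a
  · change τD (g (algebraMap k C a)) = g (algebraMap k C ((σk ^ N) a))
    rw [← hgτ, pow_apply_algebraMap hσ]
  · rw [iterate_shift_seq σ hc, hgτ]
  · rw [← AlgHom.range_eq_top gA |>.mpr hg, ← Algebra.map_top, ← htop, AlgHom.map_adjoin,
      ← Set.range_comp]
    rfl
  · let := (h.comp (algebraMap k C)).toAlgebra
    have : IsScalarTower k h.range L := IsScalarTower.of_algebraMap_eq fun _ => rfl
    have : IsFractionRing h.range L := IsFractionRing.of_field _ _ fun z => by
      obtain ⟨u, v, hv, huv⟩ := hfrac' z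
      exact ⟨u, v, eq_div_of_mul_eq hv huv⟩
    have : FaithfulSMul k h.range := (faithfulSMul_iff_algebraMap_injective k _).mpr
      (algebraMap k h.range).injective
    have : Algebra.IsAlgebraic h.range L :=
      IsLocalization.isAlgebraic _ (nonZeroDivisors h.range)
    have h1 := trdeg_add_eq (R := k) (S := h.range) (A := L)
    rw [trdeg_eq_zero (R := h.range), add_zero] at h1
    exact h1.trans ht
  · have h1 := hmin Ω (a.comp g) (N * N') τ' (Nat.mul_pos hNpos hN') fun x => by
      rw [pow_mul]
      change a (g (((σ ^ N) ^ N') x)) = τ' (a (g x))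
      rw [← ha]
      exact congrArg a (pow_apply_algebraMap (f := g) (τB := σ ^ N) (τ := τD)
        (fun x => (hgτ x).symm) _ _).symm
    exact h1
  · rw [he, coindHom_apply, pow_apply_algebraMap hσ]
    rfl
  · rw [he, he, coindEndo_coindHom hh, hσ]

/-- A ring with endomorphism that is finitely generated over a field with surjective endomorphism
and has a periodic specialization to a field, has a specialization to a finitely generated
constrained pseudo field. -/
theorem exists_constrained {k C Ω : Type u} [Field k] [CommRing C] [Algebra k C]
    [Field Ω] {σk : k →+* k} (hσk : Function.Surjective σk) {σ : C →+* C} {c : ℕ → C} {s : ℕ}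
    (hs : 1 ≤ s) (hc : ∀ i, c (i + s) = σ (c i)) (htop : Algebra.adjoin k (Set.range c) = ⊤)
    (hσ : ∀ a, σ (algebraMap k C a) = algebraMap k C (σk a)) {N₀ : ℕ} (hN₀ : 1 ≤ N₀)
    {τ₀ : Ω →+* Ω} {h₀ : C →+* Ω} (hh₀ : ∀ x, h₀ ((σ ^ N₀) x) = τ₀ (h₀ x)) :
    ∃ (N : ℕ) (_ : NeZero N) (L : Type u) (_ : Field L) (τ : L →+* L) (h : C →+* L),
      (∀ x, h ((σ ^ N) x) = τ (h x)) ∧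
      ∀ e : k →+* (Fin N → L), (∀ a, e a = coindHom N σ h (algebraMap k C a)) →
      (∃ S : Finset (Fin N → L), ∀ x : Fin N → L, ∃ a b : Fin N → L,
        a ∈ Subring.closure (Set.range e ∪ {z | ∃ s ∈ S, ∃ m : ℕ, (⇑(coindEndo τ))^[m] s = z}) ∧
        b ∈ Subring.closure (Set.range e ∪ {z | ∃ s ∈ S, ∃ m : ℕ, (⇑(coindEndo τ))^[m] s = z}) ∧
        IsUnit b ∧ x * b = a) ∧
      ∀ (m : ℕ) (a : Fin m → (Fin N → L)),
    ∃ b binv : Fin N → L, b * binv = 1 ∧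
          ∃ σV : ↥(Subring.closure (Set.range e ∪
                    {z | ∃ (j : Fin m) (m' : ℕ), (⇑(coindEndo τ))^[m'] (a j) = z} ∪
                    {z | ∃ m' : ℕ, (⇑(coindEndo τ))^[m'] binv = z})) →+*
                 ↥(Subring.closure (Set.range e ∪
                    {z | ∃ (j : Fin m) (m' : ℕ), (⇑(coindEndo τ))^[m'] (a j) = z} ∪
                    {z | ∃ m' : ℕ, (⇑(coindEndo τ))^[m'] binv = z})),
            (∀ v, ((σV v : Fin N → L)) = coindEndo τ ↑v) ∧
            ∀ p : Ideal ↥(Subring.closure (Set.range e ∪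
                    {z | ∃ (j : Fin m) (m' : ℕ), (⇑(coindEndo τ))^[m'] (a j) = z} ∪
                    {z | ∃ m' : ℕ, (⇑(coindEndo τ))^[m'] binv = z})),
              PseudoPrime σV p → p = ⊥ := by
  let P : ℕ → Prop := fun t => ∃ (N : ℕ) (L : Type u) (_ : Field L) (τ : L →+* L) (h : C →+* L),
    1 ≤ N ∧ (∀ x, h ((σ ^ N) x) = τ (h x)) ∧ ringHomTrdeg (h.comp (algebraMap k C)) = t
  have hP : ∃ t, P t := by
    obtain ⟨L, _, τ, h, hh, ht⟩ := exists_finite_trdeg_datum hs hc htop hσ hN₀ hh₀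
    obtain ⟨t, ht⟩ := Cardinal.lt_aleph0.mp ht
    exact ⟨t, N₀, L, _, τ, h, hN₀, hh, ht⟩
  classical
  obtain ⟨N₁, L₁, _, τ₁, h₁, hN₁, hh₁, ht₁⟩ := Nat.find_spec hP
  have hmin : ∀ (Ω : Type u) [Field Ω] (a : C →+* Ω) (N' : ℕ) (τ' : Ω →+* Ω), 1 ≤ N' →
      (∀ x, a ((σ ^ N') x) = τ' (a x)) →
      (Nat.find hP : Cardinal) ≤ ringHomTrdeg (a.comp (algebraMap k C)) := by
    intro Ω _ a N' τ' hN' ha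
    by_contra! hlt
    obtain ⟨t, ht⟩ := Cardinal.lt_aleph0.mp (hlt.trans Cardinal.natCast_lt_aleph0)
    refine Nat.find_min hP (m := t) ?_ ⟨N', Ω, _, τ', a, hN', ha, ht⟩
    rw [ht] at hlt
    exact_mod_cast hlt
  obtain ⟨L, _, τ, h, hh, hfrac, hle⟩ := exists_fraction_specialization (k := k) hh₁
  have ht : ringHomTrdeg (h.comp (algebraMap k C)) = (Nat.find hP : ℕ) :=
    le_antisymm (hle.trans_eq ht₁) (hmin L h N₁ τ hN₁ hh)
  have hN : 2 ^ (Nat.find hP + 3) ≤ N₁ * 2 ^ (Nat.find hP + 3) := Nat.le_mul_of_pos_left _ hN₁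
  have hne : NeZero (N₁ * 2 ^ (Nat.find hP + 3)) :=
    ⟨(lt_of_lt_of_le (Nat.two_pow_pos _) hN).ne'⟩
  have hh' : ∀ x, h ((σ ^ (N₁ * 2 ^ (Nat.find hP + 3))) x)
      = (τ ^ (2 ^ (Nat.find hP + 3))) (h x) := fun x => by
    rw [pow_mul]
    exact (pow_apply_algebraMap (f := h) (τB := σ ^ N₁) (τ := τ) (fun x => (hh x).symm) _ _).symm
  exact ⟨_, hne, L, _, _, h, hh', fun e he =>
    ⟨exists_finset_orbit_generators hσk hs hc htop hσ hh' hfrac e he,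
      constrained_of_minimal_datum hσk hs hc htop hσ hh' hfrac ht hN hmin e he⟩⟩

end Constrained

section Components

/-- The orbits of a finite nonempty family under an endomorphism can be enumerated by a sequence
that is recurrent for the endomorphism. -/
theorem exists_recurrent_sequence {R ι : Type*} [CommRing R] [Finite ι] [Nonempty ι] (σ : R →+* R)
    (g : ι → R) :
    ∃ (s : ℕ) (b : ℕ → R), 1 ≤ s ∧ (∀ i, b (i + s) = σ (b i)) ∧
      Set.range b = {z | ∃ a m, (σ ^ m) (g a) = z} := by
  obtain ⟨s, ⟨f⟩⟩ := Finite.exists_equiv_fin ι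
  have hs : 0 < s := Nat.pos_of_ne_zero fun h => by
    subst h
    exact (f (Classical.arbitrary ι)).elim0
  have : NeZero s := ⟨hs.ne'⟩
  refine ⟨s, fun i => (σ ^ (i / s)) (g (f.symm (Fin.ofNat s i))), hs, fun i => ?_, ?_⟩
  · have h1 : Fin.ofNat s (i + s) = Fin.ofNat s i := Fin.ext (Nat.add_mod_right i s)
    simp only [h1, Nat.add_div_right i hs, pow_succ']
    rfl
  · ext z
    constructor
    · rintro ⟨i, rfl⟩
      exact ⟨_, _, rfl⟩
    · rintro ⟨a, m, rfl⟩
      refine ⟨f a + s * m, ?_⟩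
      have h1 : Fin.ofNat s (f a + s * m) = f a :=
        Fin.ext (by simp [Fin.ofNat, Nat.mod_eq_of_lt (f a).2])
      have h2 : (f a + s * m) / s = m := by
        rw [Nat.add_mul_div_left _ _ hs, Nat.div_eq_of_lt (f a).2, zero_add]
      simp only [h1, h2, Equiv.symm_apply_apply]

/-- A simple pseudo domain with a commuting endomorphism has a quotient domain to which powers of
both endomorphisms descend. -/
theorem exists_domain_quotient {R : Type u} [CommRing R] {Φ σ : R →+* R} (hs : DiffSimple Φ)
    (hd : PseudoDomain Φ) (hc : ∀ x, Φ (σ x) = σ (Φ x)) :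
    ∃ (D : Type u) (_ : CommRing D) (_ : IsDomain D) (π : R →+* D) (Φ' τ : D →+* D) (d m : ℕ),
      Function.Surjective π ∧ Function.Injective τ ∧ 1 ≤ d ∧ 1 ≤ m ∧
      (∀ x, Φ' (π x) = π ((Φ ^ d) x)) ∧ ∀ x, τ (π x) = π ((σ ^ m) x) := by
  have := hs.nontrivial
  have hfin := finite_minimalPrimes_of_pseudoDomain hd
  obtain ⟨d, hd1, hd⟩ := exists_pow_comap_minimalPrimes_eq hfin Φ
    (hs.injective_of_comm fun _ => rfl)
  obtain ⟨m, hm1, hm⟩ := exists_pow_comap_minimalPrimes_eq hfin σ (hs.injective_of_comm hc)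
  obtain ⟨M, hM⟩ := Ideal.exists_maximal R
  have := hM.isPrime
  obtain ⟨q, hq, -⟩ := Ideal.exists_minimalPrimes_le (I := ⊥) (J := M) bot_le
  have hqp : q.IsPrime := hq.1.1
  refine ⟨R ⧸ q, inferInstance, inferInstance, Ideal.Quotient.mk q,
    Ideal.quotientMap q (Φ ^ d) (hd q hq).ge, Ideal.quotientMap q (σ ^ m) (hm q hq).ge, d, m,
    Ideal.Quotient.mk_surjective, Ideal.quotientMap_injective' (hm q hq).le, hd1, hm1,
    fun _ => rfl, fun _ => rfl⟩

theorem comap_pow_eq {R : Type*} [CommRing R] {σ : R →+* R} {q : Ideal R}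
    (h : Ideal.comap σ q = q) (m : ℕ) : Ideal.comap (σ ^ m) q = q := by
  induction m with
  | zero => exact Ideal.comap_id q
  | succ m ih =>
    rw [pow_succ']
    exact (Ideal.comap_comap (I := q) (σ ^ m) σ).symm.trans ((congrArg _ h).trans ih)

theorem adjoin_range_comp_eq_top {K R D : Type*} [CommRing K] [CommRing R] [CommRing D]
    [Algebra K R] [Algebra K D] {π : R →+* D} (hπ : Function.Surjective π)
    (h : ∀ a, algebraMap K D a = π (algebraMap K R a)) {b : ℕ → R}
    (hb : Algebra.adjoin K (Set.range b) = ⊤) :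
    Algebra.adjoin K (Set.range fun i => π (b i)) = ⊤ := by
  let f : R →ₐ[K] D := { π with commutes' := fun a => (h a).symm }
  rw [← f.range_eq_top.mpr hπ, ← Algebra.map_top, ← hb, AlgHom.map_adjoin, ← Set.range_comp]
  rfl

/-- Two simple pseudo domains that are finitely generated difference algebras over a difference
field have a common periodic specialization to a field. -/
theorem exists_common_specialization {K R₁ R₂ : Type u} [Field K] [CommRing R₁] [CommRing R₂]
    [Algebra K R₁] [Algebra K R₂] {σ : K →+* K} {Φ₁ σ₁ : R₁ →+* R₁} {Φ₂ σ₂ : R₂ →+* R₂}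
    (hs₁ : DiffSimple Φ₁) (hd₁ : PseudoDomain Φ₁) (hc₁ : ∀ x, Φ₁ (σ₁ x) = σ₁ (Φ₁ x))
    (hs₂ : DiffSimple Φ₂) (hd₂ : PseudoDomain Φ₂) (hc₂ : ∀ x, Φ₂ (σ₂ x) = σ₂ (Φ₂ x))
    (hσ₁ : ∀ a, σ₁ (algebraMap K R₁ a) = algebraMap K R₁ (σ a))
    (hσ₂ : ∀ a, σ₂ (algebraMap K R₂ a) = algebraMap K R₂ (σ a))
    {b : ℕ → R₂} {s : ℕ} (hs : 1 ≤ s) (hb : ∀ i, b (i + s) = σ₂ (b i))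
    (htop : Algebra.adjoin K (Set.range b) = ⊤) :
    ∃ (Ω : Type u) (_ : Field Ω) (τ : Ω →+* Ω) (N : ℕ) (p₁ : R₁ →+* Ω) (p₂ : R₂ →+* Ω), 1 ≤ N ∧
      (∀ a, p₁ (algebraMap K R₁ a) = p₂ (algebraMap K R₂ a)) ∧
      (∀ x, p₁ ((σ₁ ^ N) x) = τ (p₁ x)) ∧ ∀ x, p₂ ((σ₂ ^ N) x) = τ (p₂ x) := by
  obtain ⟨D₁, _, _, π₁, -, τ₁, -, m₁, hπ₁, hτ₁inj, -, hm₁, -, hτ₁⟩ :=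
    exists_domain_quotient hs₁ hd₁ hc₁
  obtain ⟨D₂, _, _, π₂, -, τ₂, -, m₂, hπ₂, hτ₂inj, -, hm₂, -, hτ₂⟩ :=
    exists_domain_quotient hs₂ hd₂ hc₂
  have hτ₁' : ∀ x, (τ₁ ^ m₂) (π₁ x) = π₁ ((σ₁ ^ (m₁ * m₂)) x) := fun x => by
    rw [pow_mul]
    exact pow_apply_algebraMap hτ₁ _ _
  have hτ₂' : ∀ x, (τ₂ ^ m₁) (π₂ x) = π₂ ((σ₂ ^ (m₁ * m₂)) x) := fun x => by
    rw [mul_comm m₁, pow_mul]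
    exact pow_apply_algebraMap hτ₂ _ _
  let := (π₂.comp (algebraMap K R₂)).toAlgebra
  have : FaithfulSMul K D₂ := (faithfulSMul_iff_algebraMap_injective K _).mpr
    (algebraMap K D₂).injective
  obtain ⟨q, g, hg, H⟩ := exists_universal_specialization (σ ^ (m₁ * m₂)) (τ₂ ^ m₁)
    (injective_pow hτ₂inj _) (fun a => by
      change (τ₂ ^ m₁) (π₂ (algebraMap K R₂ a)) = π₂ (algebraMap K R₂ _)
      rw [hτ₂', pow_apply_algebraMap hσ₂])
    (b := fun i => π₂ (b i)) (s := s * (m₁ * m₂)) (Nat.mul_pos hs (Nat.mul_pos hm₁ hm₂))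
    (fun i => by rw [iterate_shift_seq σ₂ hb, hτ₂'])
    (adjoin_range_comp_eq_top hπ₂ (fun _ => rfl) htop)
  let ι := algebraMap D₁ (FractionRing D₁)
  let τκ : FractionRing D₁ →+* FractionRing D₁ :=
    IsFractionRing.map (injective_pow hτ₁inj m₂)
  have hτκ : ∀ x, τκ (ι x) = ι ((τ₁ ^ m₂) x) := fun x => IsLocalization.map_eq _ x
  have hτκ' : ∀ x, τκ (ι (π₁ x)) = ι (π₁ ((σ₁ ^ (m₁ * m₂)) x)) := fun x => by rw [hτκ, hτ₁']
  have hτκN : ∀ n x, (τκ ^ n) (ι (π₁ x)) = ι (π₁ ((σ₁ ^ (m₁ * m₂ * n)) x)) := fun n x => by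
    rw [pow_mul]
    exact pow_apply_algebraMap (f := ι.comp π₁) hτκ' n x
  obtain ⟨Ω, _, _, τ, N, a, hN, ha, haτ, hττ, -, -⟩ := H 1 le_rfl (FractionRing D₁) τκ
    ((ι.comp π₁).comp (algebraMap K R₁))
    (fun c => by
      simp only [RingHom.comp_apply, hτκ', pow_one]
      rw [pow_apply_algebraMap hσ₁])
    (fun j => by
      rw [Ne, map_eq_zero, ← RingHom.coe_pow, map_eq_zero]
      exact hg)
  rw [one_mul] at haτ
  refine ⟨Ω, _, τ, m₁ * m₂ * N, (((algebraMap _ Ω).comp ι).comp π₁).comp (σ₁ ^ (m₁ * m₂ * q)),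
    a.comp π₂, Nat.mul_pos (Nat.mul_pos hm₁ hm₂) hN, fun c => ?_, fun x => ?_, fun x => ?_⟩
  · refine Eq.trans ?_ (ha c).symm
    simp only [RingHom.comp_apply]
    rw [pow_apply_algebraMap hσ₁, pow_mul]
  · simp only [RingHom.comp_apply]
    rw [hττ, hτκN]
    exact congrArg (fun y => algebraMap _ Ω (ι (π₁ y))) (pow_apply_comm (fun _ => rfl) _ _ x)
  · simp only [RingHom.comp_apply]
    rw [← haτ, pow_apply_algebraMap hτ₂', ← pow_mul]

/-- The constants of a simple pseudo domain that is finitely generated as a difference algebra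
are the fractions of a finitely generated difference subalgebra in which periodic primes can be
avoided. -/
theorem exists_constants_subalgebra {k K k₁ R : Type u} [Field k] [Field K] [Algebra k K]
    [Field k₁] [Algebra k k₁] [CommRing R] [Algebra K R] [Algebra k₁ R]
    {φ σ : K →+* K} (hcomm : ∀ a, φ (σ a) = σ (φ a))
    (hφ : ∀ c : k, φ (algebraMap k K c) = algebraMap k K c)
    (hper : ∀ (m : ℕ), 1 ≤ m → ∀ a : K, (φ ^ m) a = a → ∃ c, algebraMap k K c = a)
    {σk : k →+* k} (hσk : ∀ c, σ (algebraMap k K c) = algebraMap k K (σk c))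
    {σ₁ : k₁ →+* k₁} (hσ₁ : ∀ c, σ₁ (algebraMap k k₁ c) = algebraMap k k₁ (σk c))
    (hι : ∀ c : k, algebraMap K R (algebraMap k K c) = algebraMap k₁ R (algebraMap k k₁ c))
    {Φ σR : R →+* R} (hs : DiffSimple Φ) (hd : PseudoDomain Φ) (hc : ∀ x, Φ (σR x) = σR (Φ x))
    (hΦK : ∀ a, Φ (algebraMap K R a) = algebraMap K R (φ a))
    (hΦι : ∀ x, Φ (algebraMap k₁ R x) = algebraMap k₁ R x)
    (hσK : ∀ a, σR (algebraMap K R a) = algebraMap K R (σ a))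
    (hσι : ∀ x, σR (algebraMap k₁ R x) = algebraMap k₁ R (σ₁ x))
    {b : ℕ → R} {t : ℕ} (ht : 1 ≤ t) (hb : ∀ i, b (i + t) = σR (b i))
    (htop : Algebra.adjoin K (Set.range b) = ⊤) :
    ∃ (A : Subalgebra k k₁) (σA : A →+* A) (r : ℕ) (g : ℕ → k₁), 1 ≤ r ∧
      (∀ i, g (i + r) = σ₁ (g i)) ∧ Algebra.adjoin k (Set.range g) = A ∧
      (∀ x, (σA x : k₁) = σ₁ x) ∧ (∀ c, ∃ u ∈ A, u ≠ 0 ∧ c * u ∈ A) ∧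
      ∃ x : A, x ≠ 0 ∧ ∀ q : Ideal A, q.IsPrime → ∀ d, 1 ≤ d → Ideal.comap (σA ^ d) q = q →
        (∀ j, (σA ^ j) x ∉ q) → q = ⊥ := by
  obtain ⟨D, _, _, π, Φ', τ, d, m, hπ, hτinj, hd1, hm, hΦ', hτ⟩ := exists_domain_quotient hs hd hc
  let := (π.comp (algebraMap K R)).toAlgebra
  have hDK : ∀ a, algebraMap K D a = π (algebraMap K R a) := fun _ => rfl
  let ι : k₁ →+* D := π.comp (algebraMap k₁ R)
  have hιD : ∀ x, ι x = π (algebraMap k₁ R x) := fun _ => rfl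
  have hΦι' : ∀ x, Φ' (ι x) = ι x := fun x => by
    rw [hιD, hΦ']
    have := pow_apply_algebraMap (f := algebraMap k₁ R) (τ := Φ) (τB := RingHom.id k₁) hΦι d x
    rw [this]
    congr 2
    exact (congrFun (congrArg _ (one_pow (M := k₁ →+* k₁) d)) x)
  have hΦK' : ∀ a, Φ' (algebraMap K D a) = algebraMap K D ((φ ^ d) a) := fun a => by
    rw [hDK, hΦ', pow_apply_algebraMap hΦK, hDK]
  have hτK : ∀ a, τ (algebraMap K D a) = algebraMap K D ((σ ^ m) a) := fun a => by
    rw [hDK, hτ, pow_apply_algebraMap hσK, hDK]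
  have hτι : ∀ x, τ (ι x) = ι ((σ₁ ^ m) x) := fun x => by
    rw [hιD, hτ, pow_apply_algebraMap hσι, hιD]
  have hιc : ∀ c : k, algebraMap K D (algebraMap k K c) = ι (algebraMap k k₁ c) := fun c =>
    congrArg π (hι c)
  have htm : 1 ≤ t * m := Nat.mul_pos ht hm
  have hb' : ∀ i, π (b (i + t * m)) = τ (π (b i)) := fun i => by
    rw [iterate_shift_seq σR hb, hτ]
  have htop' := adjoin_range_comp_eq_top hπ hDK htop
  obtain ⟨S₀, hS₀⟩ := exists_finset_denominators (σ₁ := σ₁ ^ m) hper hιc hd1 hΦK' hΦι' hτinj hτK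
    hτι htm hb' htop'
  obtain ⟨r, g, hr, hg, hrange⟩ := exists_recurrent_sequence σ₁
    (fun o : Option S₀ => o.elim 0 (fun x => (x : k₁)))
  let A := Algebra.adjoin k (Set.range g)
  have hA : ∀ x ∈ A, σ₁ x ∈ A := fun x hx => by
    induction hx using Algebra.adjoin_induction with
    | mem x hx =>
      obtain ⟨i, rfl⟩ := hx
      exact hg i ▸ Algebra.subset_adjoin ⟨_, rfl⟩
    | algebraMap c => exact hσ₁ c ▸ A.algebraMap_mem _
    | add x y _ _ hx hy => exact map_add σ₁ x y ▸ add_mem hx hy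
    | mul x y _ _ hx hy => exact map_mul σ₁ x y ▸ mul_mem hx hy
  let σA : A →+* A := (σ₁.comp A.val.toRingHom).codRestrict A fun x => hA x x.2
  have hσA : ∀ x, (σA x : k₁) = σ₁ x := fun _ => rfl
  have hσApow : ∀ n x, ((σA ^ n) x : k₁) = (σ₁ ^ n) x := fun n x =>
    (pow_apply_algebraMap (f := A.val.toRingHom) (τ := σ₁) (τB := σA) (fun _ => rfl) n x).symm
  have hσAinj : Function.Injective σA := fun x y h =>
    Subtype.ext (σ₁.injective (congrArg Subtype.val h))
  refine ⟨A, σA, r, g, hr, hg, rfl, hσA, hS₀ A (fun x hx => ?_) (fun x hx => ?_), ?_⟩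
  · refine Algebra.subset_adjoin (hrange ▸ ⟨some ⟨x, hx⟩, 0, rfl⟩)
  · exact hσApow m ⟨x, hx⟩ ▸ ((σA ^ m) ⟨x, hx⟩).2
  · obtain ⟨x, hx0, hx⟩ := exists_avoiding_element (σ := σ ^ m) (σk := σk ^ m) (σA := σA ^ m)
      (fun a => by
        have := pow_apply_comm hcomm 1 m a
        rwa [pow_one] at this) hφ hper
      (fun c => pow_apply_algebraMap hσk m c) (injective_pow hσAinj m)
      (fun c => pow_apply_algebraMap (f := algebraMap k A) (fun c => Subtype.ext (hσ₁ c)) m c)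
      (ι := ι.comp A.val.toRingHom) hιc (fun y hy => IsUnit.map ι (isUnit_iff_ne_zero.mpr fun h =>
        hy (Subtype.ext h))) hd1 hΦK' (fun y => hΦι' y) hτinj hτK
      (fun y => (hτι y).trans (congrArg ι (hσApow m y).symm)) htm hb' htop'
    refine ⟨x, hx0, fun q hq e he hqe hqx => hx q hq e he ?_ fun j => ?_⟩
    · rw [← pow_mul, mul_comm, pow_mul]
      exact comap_pow_eq hqe m
    · rw [← pow_mul]
      exact hqx _

end Components

section Specialization

/-- A homomorphism to a field extends to a ring of fractions if it is injective on the
denominators. -/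
theorem exists_extension_of_denominators {A C₀ C L : Type*} [CommRing A] [IsDomain A] [CommRing C₀]
    [CommRing C] [Field L] (j : A →+* C₀) (v : C₀ →+* C) (hv : Function.Injective v)
    (hunit : ∀ a, a ≠ 0 → IsUnit (v (j a))) (hden : ∀ c, ∃ u, u ≠ 0 ∧ ∃ y, c * v (j u) = v y)
    (h : C₀ →+* L) (hj : Function.Injective fun a => h (j a)) :
    ∃ p : C →+* L, ∀ x, p (v x) = h x := by
  let := v.toAlgebra
  let M : Submonoid C₀ := (nonZeroDivisors A).map j
  have hM : IsLocalization M C := by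
    refine ⟨?_, ?_, ?_⟩
    · rintro ⟨_, a, ha, rfl⟩
      exact hunit a (nonZeroDivisors.ne_zero ha)
    · intro c
      obtain ⟨u, hu, y, hy⟩ := hden c
      exact ⟨(y, ⟨j u, u, mem_nonZeroDivisors_of_ne_zero hu, rfl⟩), hy⟩
    · intro x y hxy
      exact ⟨1, by rw [hv hxy]⟩
  have hu : ∀ y : M, IsUnit (h y) := by
    rintro ⟨_, a, ha, rfl⟩
    refine isUnit_iff_ne_zero.mpr fun h0 => nonZeroDivisors.ne_zero ha (hj ?_)
    simpa using h0
  exact ⟨IsLocalization.lift hu, fun x => IsLocalization.lift_eq hu x⟩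

/-- A difference algebra over `k`, finitely generated over a difference field extension `k₁` of
`k`, that has a periodic specialization to a field, has an equivariant homomorphism to a finitely
generated constrained pseudo field over `k`, provided that `k₁` is the field of fractions of a
finitely generated difference algebra in which periodic primes can be avoided. -/
theorem exists_constrained_of_constants {k k₁ C Ω : Type u} [Field k] [Field k₁] [Algebra k k₁]
    [CommRing C] [Algebra k C] [Algebra k₁ C] [IsScalarTower k k₁ C] [Field Ω]
    {σk : k →+* k} (hσk : Function.Surjective σk)
    {σ₁ : k₁ →+* k₁} (hσ₁ : ∀ c, σ₁ (algebraMap k k₁ c) = algebraMap k k₁ (σk c))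
    {A : Subalgebra k k₁} {σA : A →+* A} {r : ℕ} {g : ℕ → k₁} (hr : 1 ≤ r)
    (hg : ∀ i, g (i + r) = σ₁ (g i)) (hA : Algebra.adjoin k (Set.range g) = A)
    (hσA : ∀ x, (σA x : k₁) = σ₁ x) (hden : ∀ c, ∃ u ∈ A, u ≠ 0 ∧ c * u ∈ A)
    {w : A} (hw0 : w ≠ 0)
    (hw : ∀ q : Ideal A, q.IsPrime → ∀ d, 1 ≤ d → Ideal.comap (σA ^ d) q = q →
      (∀ j, (σA ^ j) w ∉ q) → q = ⊥)
    {σC : C →+* C} (hσC : ∀ x, σC (algebraMap k₁ C x) = algebraMap k₁ C (σ₁ x))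
    {z : ℕ → C} {t : ℕ} (hz : ∀ i, z (i + t) = σC (z i)) (ht : 1 ≤ t)
    (htop : Algebra.adjoin k₁ (Set.range z) = ⊤)
    {τ₀ : Ω →+* Ω} {p : C →+* Ω} {N₀ : ℕ} (hN₀ : 1 ≤ N₀)
    (hp : ∀ x, p ((σC ^ N₀) x) = τ₀ (p x)) :
    ∃ (N : ℕ) (_ : NeZero N) (L : Type u) (_ : Field L) (τ : L →+* L) (π : C →+* (Fin N → L)),
      (∀ x, coindEndo τ (π x) = π (σC x)) ∧
      ∀ e : k →+* (Fin N → L), (∀ a, e a = π (algebraMap k C a)) →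
      (∃ S : Finset (Fin N → L), ∀ x : Fin N → L, ∃ a b : Fin N → L,
        a ∈ Subring.closure (Set.range e ∪ {z | ∃ s ∈ S, ∃ m : ℕ, (⇑(coindEndo τ))^[m] s = z}) ∧
        b ∈ Subring.closure (Set.range e ∪ {z | ∃ s ∈ S, ∃ m : ℕ, (⇑(coindEndo τ))^[m] s = z}) ∧
        IsUnit b ∧ x * b = a) ∧
      ∀ (m : ℕ) (a : Fin m → (Fin N → L)),
    ∃ b binv : Fin N → L, b * binv = 1 ∧
          ∃ σV : ↥(Subring.closure (Set.range e ∪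
                    {z | ∃ (j : Fin m) (m' : ℕ), (⇑(coindEndo τ))^[m'] (a j) = z} ∪
                    {z | ∃ m' : ℕ, (⇑(coindEndo τ))^[m'] binv = z})) →+*
                 ↥(Subring.closure (Set.range e ∪
                    {z | ∃ (j : Fin m) (m' : ℕ), (⇑(coindEndo τ))^[m'] (a j) = z} ∪
                    {z | ∃ m' : ℕ, (⇑(coindEndo τ))^[m'] binv = z})),
            (∀ v, ((σV v : Fin N → L)) = coindEndo τ ↑v) ∧
            ∀ p : Ideal ↥(Subring.closure (Set.range e ∪
                    {z | ∃ (j : Fin m) (m' : ℕ), (⇑(coindEndo τ))^[m'] (a j) = z} ∪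
                    {z | ∃ m' : ℕ, (⇑(coindEndo τ))^[m'] binv = z})),
              PseudoPrime σV p → p = ⊥ := by
  have hkC : ∀ a, σC (algebraMap k C a) = algebraMap k C (σk a) := fun a => by
    rw [IsScalarTower.algebraMap_apply k k₁ C, hσC, hσ₁, ← IsScalarTower.algebraMap_apply]
  have hw0' : (w : k₁) ≠ 0 := fun h => hw0 (Subtype.ext h)
  let gen : Fin r ⊕ Fin t ⊕ Unit → C := Sum.elim (fun i => algebraMap k₁ C (g i))
    (Sum.elim (fun i => z i) fun _ => algebraMap k₁ C (w : k₁)⁻¹)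
  obtain ⟨s, c, hs, hc, hrange⟩ := exists_recurrent_sequence σC gen
  let C₀ := Algebra.adjoin k (Set.range c)
  have hgC : ∀ i, algebraMap k₁ C (g i) ∈ C₀ := fun i => Algebra.subset_adjoin (by
    rw [hrange]
    refine ⟨Sum.inl ⟨i % r, Nat.mod_lt _ hr⟩, i / r, ?_⟩
    change (σC ^ _) (algebraMap k₁ C (g _)) = _
    rw [pow_apply_algebraMap hσC, ← iterate_shift_seq σ₁ hg, Nat.mod_add_div])
  have hzC : ∀ i, z i ∈ C₀ := fun i => Algebra.subset_adjoin (by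
    rw [hrange]
    refine ⟨Sum.inr (Sum.inl ⟨i % t, Nat.mod_lt _ ht⟩), i / t, ?_⟩
    change (σC ^ _) (z _) = _
    rw [← iterate_shift_seq σC hz, Nat.mod_add_div])
  have hwC : algebraMap k₁ C (w : k₁)⁻¹ ∈ C₀ := Algebra.subset_adjoin (by
    rw [hrange]
    exact ⟨Sum.inr (Sum.inr ()), 0, rfl⟩)
  have hσ₀mem : ∀ x ∈ C₀, σC x ∈ C₀ := fun x hx => by
    induction hx using Algebra.adjoin_induction with
    | mem x hx =>
      obtain ⟨i, rfl⟩ := hx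
      exact hc i ▸ Algebra.subset_adjoin ⟨_, rfl⟩
    | algebraMap c => exact hkC c ▸ C₀.algebraMap_mem _
    | add x y _ _ hx hy => exact map_add σC x y ▸ add_mem hx hy
    | mul x y _ _ hx hy => exact map_mul σC x y ▸ mul_mem hx hy
  let v : C₀ →+* C := C₀.val.toRingHom
  have hv : Function.Injective v := Subtype.val_injective
  let σ₀ : C₀ →+* C₀ := (σC.comp v).codRestrict C₀ fun x => hσ₀mem x x.2
  have hσ₀ : ∀ x, v (σ₀ x) = σC (v x) := fun _ => rfl
  have hσ₀pow : ∀ n x, v ((σ₀ ^ n) x) = (σC ^ n) (v x) := fun n x =>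
    (pow_apply_algebraMap (fun x => (hσ₀ x).symm) n x).symm
  have hAC : ∀ x ∈ A, algebraMap k₁ C x ∈ C₀ := fun x hx => by
    rw [← hA] at hx
    induction hx using Algebra.adjoin_induction with
    | mem x hx => obtain ⟨i, rfl⟩ := hx; exact hgC i
    | algebraMap c =>
      rw [← IsScalarTower.algebraMap_apply]
      exact C₀.algebraMap_mem _
    | add x y _ _ hx hy => exact map_add (algebraMap k₁ C) x y ▸ add_mem hx hy
    | mul x y _ _ hx hy => exact map_mul (algebraMap k₁ C) x y ▸ mul_mem hx hy
  let j : A →+* C₀ := ((algebraMap k₁ C).comp A.val.toRingHom).codRestrict C₀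
    fun x => hAC x x.2
  have hj : ∀ x, v (j x) = algebraMap k₁ C x := fun _ => rfl
  have hjσ : ∀ x, σ₀ (j x) = j (σA x) := fun x => hv (by rw [hσ₀, hj, hj, hσC, hσA])
  have hkσ : ∀ a, σ₀ (algebraMap k C₀ a) = algebraMap k C₀ (σk a) := fun a => hv (hkC a)
  have hC₀top : Algebra.adjoin k (Set.range fun i => (⟨c i, Algebra.subset_adjoin ⟨i, rfl⟩⟩ : C₀))
      = ⊤ := by
    rw [← Algebra.adjoin_adjoin_coe_preimage (s := Set.range c)]
    congr 1
    ext x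
    constructor
    · rintro ⟨i, rfl⟩
      exact ⟨i, rfl⟩
    · rintro ⟨i, hi⟩
      exact ⟨i, Subtype.ext hi⟩
  obtain ⟨N, hN, L, _, τ, h, hh, H⟩ := exists_constrained hσk hs (fun i => Subtype.ext (hc i))
    hC₀top hkσ hN₀ (τ₀ := τ₀) (h₀ := p.comp v) fun x => by
      rw [RingHom.comp_apply, hσ₀pow, hp]
      rfl
  have hjinj : Function.Injective (h.comp j) := by
    rw [RingHom.injective_iff_ker_eq_bot]
    refine hw _ (RingHom.ker_isPrime _) N (Nat.pos_of_ne_zero (NeZero.ne N)) ?_ fun i hi => ?_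
    · ext x
      rw [Ideal.mem_comap, RingHom.mem_ker, RingHom.mem_ker, RingHom.comp_apply,
        RingHom.comp_apply, ← pow_apply_algebraMap hjσ, hh, map_eq_zero]
    · have h1 : (σ₀ ^ i) (j w) * (σ₀ ^ i) ⟨_, hwC⟩ = 1 := by
        rw [← map_mul, ← map_one (σ₀ ^ i)]
        refine congrArg _ (hv ?_)
        rw [map_mul, hj, map_one]
        change _ * algebraMap k₁ C _ = 1
        rw [← map_mul, mul_inv_cancel₀ hw0', map_one]
      rw [RingHom.mem_ker, RingHom.comp_apply, ← pow_apply_algebraMap hjσ] at hi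
      have h2 := congrArg h h1
      rw [map_mul, hi, zero_mul, map_one] at h2
      exact zero_ne_one h2
  have hunit : ∀ a : A, a ≠ 0 → IsUnit (v (j a)) := fun a ha =>
    (isUnit_iff_ne_zero.mpr fun h0 => ha (Subtype.ext h0)).map (algebraMap k₁ C)
  have hfrac : ∀ x, ∃ u : A, u ≠ 0 ∧ ∃ y, x * v (j u) = v y := fun x => by
    have hx : x ∈ Algebra.adjoin k₁ (Set.range z) := htop ▸ Algebra.mem_top
    induction hx using Algebra.adjoin_induction with
    | mem x hx =>
      obtain ⟨i, rfl⟩ := hx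
      exact ⟨1, one_ne_zero, ⟨z i, hzC i⟩, by rw [map_one, map_one, mul_one]; rfl⟩
    | algebraMap a =>
      obtain ⟨u, huA, hu0, hu⟩ := hden a
      exact ⟨⟨u, huA⟩, fun h0 => hu0 (congrArg Subtype.val h0), j ⟨_, hu⟩, by
        rw [hj, hj, map_mul]⟩
    | add x y _ _ hx hy =>
      obtain ⟨u, hu, x', hx⟩ := hx
      obtain ⟨u', hu', y', hy⟩ := hy
      refine ⟨u * u', mul_ne_zero hu hu', x' * j u' + y' * j u, ?_⟩
      rw [map_mul, map_mul, map_add, map_mul, map_mul, ← hx, ← hy]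
      ring
    | mul x y _ _ hx hy =>
      obtain ⟨u, hu, x', hx⟩ := hx
      obtain ⟨u', hu', y', hy⟩ := hy
      refine ⟨u * u', mul_ne_zero hu hu', x' * y', ?_⟩
      rw [map_mul, map_mul, map_mul, ← hx, ← hy]
      ring
  obtain ⟨π, hπ⟩ := exists_extension_of_denominators j v hv hunit hfrac h hjinj
  have hπσ : ∀ x, π ((σC ^ N) x) = τ (π x) := fun x => by
    obtain ⟨u, hu, y, hy⟩ := hfrac x
    have h1 := congrArg (fun x => π ((σC ^ N) x)) hy
    have h2 := congrArg (fun x => τ (π x)) hy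
    simp only [map_mul, ← hσ₀pow, hπ, hh] at h1 h2
    refine mul_right_cancel₀ ?_ (h1.trans h2.symm)
    rw [Ne, map_eq_zero]
    exact fun h0 => hu (hjinj (h0.trans (map_zero (h.comp j)).symm))
  exact ⟨N, hN, L, _, τ, coindHom N σC π, fun x => coindEndo_coindHom hπσ x, fun e he =>
    H e fun a => (he a).trans (funext fun i => by
      rw [coindHom_apply, coindHom_apply, ← hπ, hσ₀pow]
      rfl)⟩

end Specialization

section FundamentalMatrix

theorem map_pow_det {R : Type*} [CommRing R] {n : ℕ} (σ : R →+* R) (i : ℕ)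
    (Y : Matrix (Fin n) (Fin n) R) : (Y.map (σ ^ i)).det = (σ ^ i) Y.det :=
  (RingHom.map_det (σ ^ i) Y).symm

/-- The inverse of a fundamental matrix, and generation by the orbits of the entries of the
fundamental matrix and of its inverse. -/
theorem exists_inverse_fundamental_matrix {K R : Type*} [Field K] [CommRing R] [Algebra K R]
    {n : ℕ} {A : Matrix (Fin n) (Fin n) K} {Φ σ : R →+* R} {Y : Matrix (Fin n) (Fin n) R}
    {w : ℕ → R} (hY : Y.map Φ = A.map (algebraMap K R) * Y)
    (hw : ∀ i : ℕ, (Y.map ((⇑σ)^[i])).det * w i = 1)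
    (hg : Algebra.adjoin K
      ({x : R | ∃ (i : ℕ) (p q : Fin n), (Y.map ((⇑σ)^[i])) p q = x} ∪ Set.range w) = ⊤) :
    ∃ W : Matrix (Fin n) (Fin n) R, Y * W = 1 ∧ W.map Φ * A.map (algebraMap K R) = W ∧
      Algebra.adjoin K {x | ∃ i p q, (σ ^ i) (Y p q) = x ∨ (σ ^ i) (W p q) = x} = ⊤ := by
  have hdet : Y.det * w 0 = 1 := by simpa using hw 0
  have hYW : Y * (w 0 • Y.adjugate) = 1 := by
    rw [Matrix.mul_smul, Matrix.mul_adjugate, smul_smul, mul_comm, hdet, one_smul]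
  have hWY : (w 0 • Y.adjugate) * Y = 1 := mul_eq_one_comm.mp hYW
  generalize w 0 • Y.adjugate = W at hYW hWY
  have hwi : ∀ i, w i = (σ ^ i) W.det := fun i => by
    have h1 : (Y.map ((⇑σ)^[i])).det * (σ ^ i) W.det = 1 := by
      rw [← RingHom.coe_pow, map_pow_det, ← map_mul, ← Matrix.det_mul, hYW, Matrix.det_one,
        map_one]
    exact (isUnit_iff_exists_inv.mpr ⟨_, hw i⟩).mul_left_cancel ((hw i).trans h1.symm)
  refine ⟨W, hYW, ?_, ?_⟩
  · have h1 : W.map Φ * Y.map Φ = 1 := by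
      rw [← Matrix.map_mul, hWY, Matrix.map_one _ (map_zero Φ) (map_one Φ)]
    calc W.map Φ * A.map (algebraMap K R)
        = W.map Φ * (A.map (algebraMap K R) * Y) * W := by
          rw [Matrix.mul_assoc, Matrix.mul_assoc, hYW, Matrix.mul_one]
      _ = W := by rw [← hY, h1, Matrix.one_mul]
  · rw [eq_top_iff, ← hg]
    refine Algebra.adjoin_le ?_
    rintro x (⟨i, p, q, rfl⟩ | ⟨i, rfl⟩)
    · exact Algebra.subset_adjoin ⟨i, p, q, Or.inl (by rw [RingHom.coe_pow]; rfl)⟩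
    · rw [hwi, ← map_pow_det, Matrix.det_apply]
      refine sum_mem fun s _ => ?_
      rw [Units.smul_def]
      refine zsmul_mem (Subalgebra.prod_mem _ fun j _ => ?_) _
      exact Algebra.subset_adjoin ⟨i, s j, j, Or.inr rfl⟩

theorem exists_recurrent_matrix_entries {R : Type*} [CommRing R] {n : ℕ} (σ : R →+* R)
    (Y W : Matrix (Fin n) (Fin n) R) :
    ∃ (s : ℕ) (b : ℕ → R), 1 ≤ s ∧ (∀ i, b (i + s) = σ (b i)) ∧
      {x | ∃ i p q, (σ ^ i) (Y p q) = x ∨ (σ ^ i) (W p q) = x} ⊆ Set.range b := by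
  obtain ⟨s, b, hs, hb, hrange⟩ := exists_recurrent_sequence σ
    (Sum.elim (fun _ : Unit => 0) (Sum.elim (fun x : Fin n × Fin n => Y x.1 x.2)
      (fun x : Fin n × Fin n => W x.1 x.2)))
  refine ⟨s, b, hs, hb, ?_⟩
  rintro x ⟨i, p, q, rfl | rfl⟩
  · rw [hrange]
    exact ⟨Sum.inr (Sum.inl (p, q)), i, rfl⟩
  · rw [hrange]
    exact ⟨Sum.inr (Sum.inr (p, q)), i, rfl⟩

section TwoSolutions

variable {K R₁ R₂ S : Type*} [Field K] [CommRing R₁] [CommRing R₂] [CommRing S]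
  [Algebra K R₁] [Algebra K R₂] {n : ℕ} {j₁ : R₁ →+* S} {j₂ : R₂ →+* S}
  {Y₁ W₁ : Matrix (Fin n) (Fin n) R₁} {Y₂ W₂ : Matrix (Fin n) (Fin n) R₂}

/-- The quotient of two fundamental matrices has constant entries. -/
theorem quotient_fundamental_constant (hj : ∀ a, j₁ (algebraMap K R₁ a) = j₂ (algebraMap K R₂ a))
    {A : Matrix (Fin n) (Fin n) K} {Φ₁ : R₁ →+* R₁} {Φ₂ : R₂ →+* R₂} {ΦS : S →+* S}
    (hΦ₁ : ∀ x, ΦS (j₁ x) = j₁ (Φ₁ x)) (hΦ₂ : ∀ x, ΦS (j₂ x) = j₂ (Φ₂ x))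
    (hW : W₁.map Φ₁ * A.map (algebraMap K R₁) = W₁)
    (hY : Y₂.map Φ₂ = A.map (algebraMap K R₂) * Y₂) (p q : Fin n) :
    ΦS ((W₁.map j₁ * Y₂.map j₂) p q) = (W₁.map j₁ * Y₂.map j₂) p q := by
  suffices (W₁.map j₁ * Y₂.map j₂).map ΦS = W₁.map j₁ * Y₂.map j₂ from congrFun₂ this p q
  have h1 : (W₁.map j₁).map ΦS = (W₁.map Φ₁).map j₁ := Matrix.ext fun p q => hΦ₁ _
  have h2 : (Y₂.map j₂).map ΦS = (Y₂.map Φ₂).map j₂ := Matrix.ext fun p q => hΦ₂ _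
  have h3 : (A.map (algebraMap K R₂)).map j₂ = (A.map (algebraMap K R₁)).map j₁ :=
    Matrix.ext fun p q => (hj _).symm
  rw [Matrix.map_mul, h1, h2, hY, Matrix.map_mul, h3, ← Matrix.mul_assoc, ← Matrix.map_mul, hW]

/-- A subring containing the first solution ring and the orbits of the quotients of the fundamental
matrices contains the second solution ring. -/
theorem mem_of_quotient_fundamental (hj : ∀ a, j₁ (algebraMap K R₁ a) = j₂ (algebraMap K R₂ a))
    {σ₁ : R₁ →+* R₁} {σ₂ : R₂ →+* R₂} {σS : S →+* S}
    (hσ₁ : ∀ x, σS (j₁ x) = j₁ (σ₁ x)) (hσ₂ : ∀ x, σS (j₂ x) = j₂ (σ₂ x))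
    (hYW : Y₁ * W₁ = 1)
    (hg : Algebra.adjoin K {x | ∃ i p q, (σ₂ ^ i) (Y₂ p q) = x ∨ (σ₂ ^ i) (W₂ p q) = x} = ⊤)
    {V : Subring S} (hV : ∀ x, j₁ x ∈ V)
    (hVZ : ∀ i p q, (σS ^ i) ((W₁.map j₁ * Y₂.map j₂) p q) ∈ V)
    (hVZ' : ∀ i p q, (σS ^ i) ((W₂.map j₂ * Y₁.map j₁) p q) ∈ V) (x : R₂) : j₂ x ∈ V := by
  have hYW' : Y₁.map j₁ * W₁.map j₁ = 1 := by
    rw [← Matrix.map_mul, hYW, Matrix.map_one _ (map_zero j₁) (map_one j₁)]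
  have hx : x ∈ Algebra.adjoin K {x | ∃ i p q, (σ₂ ^ i) (Y₂ p q) = x ∨ (σ₂ ^ i) (W₂ p q) = x} :=
    hg ▸ Algebra.mem_top
  induction hx using Algebra.adjoin_induction with
  | mem x hx =>
    obtain ⟨i, p, q, rfl | rfl⟩ := hx
    · have h1 : Y₂.map j₂ = Y₁.map j₁ * (W₁.map j₁ * Y₂.map j₂) := by
        rw [← Matrix.mul_assoc, hYW', Matrix.one_mul]
      rw [← pow_apply_algebraMap hσ₂]
      change (σS ^ i) (Y₂.map j₂ p q) ∈ V
      rw [h1, Matrix.mul_apply, map_sum]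
      refine sum_mem fun l _ => ?_
      rw [map_mul]
      refine mul_mem ?_ (hVZ i l q)
      rw [Matrix.map_apply, pow_apply_algebraMap hσ₁]
      exact hV _
    · have h1 : W₂.map j₂ = (W₂.map j₂ * Y₁.map j₁) * W₁.map j₁ := by
        rw [Matrix.mul_assoc, hYW', Matrix.mul_one]
      rw [← pow_apply_algebraMap hσ₂]
      change (σS ^ i) (W₂.map j₂ p q) ∈ V
      rw [h1, Matrix.mul_apply, map_sum]
      refine sum_mem fun l _ => ?_
      rw [map_mul]
      refine mul_mem (hVZ' i p l) ?_
      rw [Matrix.map_apply, pow_apply_algebraMap hσ₁]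
      exact hV _
  | algebraMap a => exact hj a ▸ hV _
  | add x y _ _ hx hy => exact map_add j₂ x y ▸ add_mem hx hy
  | mul x y _ _ hx hy => exact map_mul j₂ x y ▸ mul_mem hx hy

end TwoSolutions

end FundamentalMatrix

section BaseChange

theorem eq_top_of_tensor_closure {k R E S : Type*} [Field k] [CommRing R] [Nontrivial R]
    [Algebra k R] [CommRing E] [Algebra k E] [CommRing S] (m : R ⊗[k] E →+* S)
    (hm : Function.Injective m) (B : Subalgebra k E)
    (h : ∀ (V : Subring S), (∀ r, m (r ⊗ₜ 1) ∈ V) → (∀ x ∈ B, m (1 ⊗ₜ x) ∈ V) →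
      ∀ x, m (1 ⊗ₜ x) ∈ V) : B = ⊤ := by
  rw [eq_top_iff]
  intro x _
  by_contra hx
  obtain ⟨l, hlx, hl⟩ := Submodule.exists_le_ker_of_notMem (p := B.toSubmodule) hx
  let f : R ⊗[k] B →+* R ⊗[k] E :=
    (Algebra.TensorProduct.map (AlgHom.id k R) B.val).toRingHom
  have hf : ∀ r y, f (r ⊗ₜ y) = r ⊗ₜ (y : E) := fun _ _ => rfl
  obtain ⟨z, hz⟩ := h (f.range.map m)
    (fun r => ⟨_, ⟨r ⊗ₜ 1, rfl⟩, congrArg m (hf r 1)⟩)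
    (fun y hy => ⟨_, ⟨1 ⊗ₜ ⟨y, hy⟩, rfl⟩, congrArg m (hf 1 ⟨y, hy⟩)⟩) x
  obtain ⟨⟨y, rfl⟩, hz⟩ := hz
  have h1 := hm hz
  have h2 : ∀ y, LinearMap.lTensor R l (f y) = 0 := fun y => by
    induction y with
    | zero => rw [map_zero, map_zero]
    | add a b ha hb => rw [map_add, map_add, ha, hb, add_zero]
    | tmul r y =>
      rw [hf, LinearMap.lTensor_tmul, show l y = 0 from hl y.2, TensorProduct.tmul_zero]
  have h3 := congrArg (fun y => TensorProduct.rid k R (LinearMap.lTensor R l y)) h1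
  rw [h2 y, LinearMap.lTensor_tmul, map_zero, TensorProduct.rid_tmul] at h3
  exact smul_ne_zero hlx one_ne_zero h3.symm

end BaseChange

section Equivalence

/-- If a ring is the tensor product of a simple ring and its constants, a homomorphism on the
constants induces a homomorphism to the base change of the simple ring. -/
theorem exists_base_change {k R C S k' : Type*} [Field k] [CommRing R] [Algebra k R] [CommRing C]
    [Algebra k C] [CommRing S] [CommRing k'] [Algebra k k'] {Φ : R →+* R} (hs : DiffSimple Φ)
    (hk : ∀ a, Φ a = a → ∃ c : k, algebraMap k R c = a) {ΦS : S →+* S} {j : R →+* S} {ι : C →+* S}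
    (hι : Function.Injective ι) (hj : ∀ c, j (algebraMap k R c) = ι (algebraMap k C c))
    (hΦj : ∀ x, ΦS (j x) = j (Φ x)) (hΦι : ∀ x, ΦS (ι x) = ι x)
    (hgen : ∀ V : Subring S, (∀ x, j x ∈ V) → (∀ x, ι x ∈ V) → ∀ x, x ∈ V)
    {π : C →+* k'} (hπ : ∀ c, π (algebraMap k C c) = algebraMap k k' c) :
    ∃ T : S →+* R ⊗[k] k', (∀ r, T (j r) = r ⊗ₜ 1) ∧ ∀ x, T (ι x) = 1 ⊗ₜ π x := by
  let m : R ⊗[k] C →+* S := tensorLift j ι hj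
  have hm : ∀ r x, m (r ⊗ₜ x) = j r * ι x := tensorLift_tmul _ _ _
  have hm1 : ∀ r, m (r ⊗ₜ 1) = j r := fun r => by rw [hm, map_one, mul_one]
  have hm2 : ∀ x, m (1 ⊗ₜ x) = ι x := fun x => by rw [hm, map_one, one_mul]
  have hinj : Function.Injective m := by
    refine injective_of_tensor_constants hs hk ΦS m (fun r => ?_) (fun x => ?_) (fun x hx => ?_)
    · rw [hm1, hm1, hΦj]
    · rw [hm2, hΦι]
    · rw [hm2] at hx
      exact hι (hx.trans (map_zero ι).symm)
  have hsurj : Function.Surjective m :=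
    hgen m.range (fun r => ⟨_, hm1 r⟩) (fun x => ⟨_, hm2 x⟩)
  let e := RingEquiv.ofBijective m ⟨hinj, hsurj⟩
  have he : ∀ y, e.symm (m y) = y := e.symm_apply_apply
  let f : R ⊗[k] C →+* R ⊗[k] k' :=
    (Algebra.TensorProduct.map (AlgHom.id k R) (⟨π, hπ⟩ : C →ₐ[k] k')).toRingHom
  refine ⟨f.comp e.symm.toRingHom, fun r => ?_, fun x => ?_⟩
  · rw [← hm1]
    refine (congrArg f (he _)).trans ?_
    change r ⊗ₜ π 1 = _
    rw [map_one]
  · rw [← hm2]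
    exact congrArg f (he _)

theorem exists_tensor_endo {k R k' : Type*} [CommRing k] [CommRing R] [Algebra k R]
    [CommRing k'] [Algebra k k'] {θk : k → k} {θ : R →+* R} {θ' : k' →+* k'}
    (h : ∀ c, θ (algebraMap k R c) = algebraMap k R (θk c))
    (h' : ∀ c, θ' (algebraMap k k' c) = algebraMap k k' (θk c)) :
    ∃ Θ : R ⊗[k] k' →+* R ⊗[k] k', ∀ r c, Θ (r ⊗ₜ c) = θ r ⊗ₜ θ' c := by
  refine ⟨tensorLift (Algebra.TensorProduct.includeLeftRingHom.comp θ)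
    ((Algebra.TensorProduct.includeRight (R := k) (A := R)).toRingHom.comp θ') (fun c => ?_),
    fun r c => ?_⟩
  · change θ (algebraMap k R c) ⊗ₜ 1 = 1 ⊗ₜ θ' (algebraMap k k' c)
    rw [h, h']
    exact Algebra.TensorProduct.tmul_one_eq_one_tmul _
  · rw [tensorLift_tmul]
    change (θ r ⊗ₜ[k] (1 : k')) * ((1 : R) ⊗ₜ[k] θ' c) = _
    rw [Algebra.TensorProduct.tmul_mul_tmul, mul_one, one_mul]

variable {k₁ k₂ R₁ R₂ C S k' : Type*} [CommRing k₁] [CommRing k₂] [CommRing R₁] [CommRing R₂]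
  [CommRing C] [CommRing S] [CommRing k'] [Algebra k₁ R₁] [Algebra k₂ R₂] [Algebra k₁ k']
  [Algebra k₂ k'] {j₁ : R₁ →+* S} {j₂ : R₂ →+* S} {ι : C →+* S} {π : C →+* k'}

theorem exists_tensor_ringHom {T₂ : S →+* R₂ ⊗[k₂] k'} (hι₂ : ∀ x, T₂ (ι x) = 1 ⊗ₜ π x)
    (hc₁ : ∀ c, ∃ x, ι x = j₁ (algebraMap k₁ R₁ c) ∧ π x = algebraMap k₁ k' c) :
    ∃ ψ : R₁ ⊗[k₁] k' →+* R₂ ⊗[k₂] k',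
      (∀ r, ψ (r ⊗ₜ 1) = T₂ (j₁ r)) ∧ ∀ x, ψ (1 ⊗ₜ x) = 1 ⊗ₜ x := by
  let i : k' →+* R₂ ⊗[k₂] k' :=
    (Algebra.TensorProduct.includeRight (R := k₂) (A := R₂)).toRingHom
  have hi : ∀ x, i x = 1 ⊗ₜ x := fun _ => rfl
  refine ⟨tensorLift (T₂.comp j₁) i (fun c => ?_), fun r => ?_, fun x => ?_⟩
  · obtain ⟨x, hx, hx'⟩ := hc₁ c
    rw [RingHom.comp_apply, ← hx, ← hx', hι₂, hi]
  · rw [tensorLift_tmul, map_one, mul_one, RingHom.comp_apply]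
  · rw [tensorLift_tmul, map_one, one_mul, hi]

theorem tensor_ringHom_comp_eq {T₁ : S →+* R₁ ⊗[k₁] k'} {T₂ : S →+* R₂ ⊗[k₂] k'}
    (hT₁ : ∀ r, T₁ (j₁ r) = r ⊗ₜ 1) (hι₁ : ∀ x, T₁ (ι x) = 1 ⊗ₜ π x)
    (hT₂ : ∀ r, T₂ (j₂ r) = r ⊗ₜ 1) (hι₂ : ∀ x, T₂ (ι x) = 1 ⊗ₜ π x)
    (hgen₂ : ∀ V : Subring S, (∀ x, j₂ x ∈ V) → (∀ x, ι x ∈ V) → ∀ x, x ∈ V)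
    {ψ : R₁ ⊗[k₁] k' →+* R₂ ⊗[k₂] k'} {χ : R₂ ⊗[k₂] k' →+* R₁ ⊗[k₁] k'}
    (hψ : ∀ r, ψ (r ⊗ₜ 1) = T₂ (j₁ r)) (hψ' : ∀ x, ψ (1 ⊗ₜ x) = 1 ⊗ₜ x)
    (hχ : ∀ r, χ (r ⊗ₜ 1) = T₁ (j₂ r)) (hχ' : ∀ x, χ (1 ⊗ₜ x) = 1 ⊗ₜ x) :
    χ.comp ψ = RingHom.id _ := by
  have h1 : ∀ s, χ (T₂ s) = T₁ s :=
    hgen₂ (RingHom.eqLocus (χ.comp T₂) T₁)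
      (fun r => (congrArg χ (hT₂ r)).trans (hχ r))
      (fun x => (congrArg χ (hι₂ x)).trans ((hχ' _).trans (hι₁ x).symm))
  refine tensor_ringHom_ext (fun r => ?_) (fun x => ?_)
  · rw [RingHom.comp_apply, hψ, h1, hT₁, RingHom.id_apply]
  · rw [RingHom.comp_apply, hψ', hχ', RingHom.id_apply]

/-- Two rings `R₁`, `R₂` become isomorphic over a common extension `k'` of their constants, if
the constants of a ring generated by either of them over its constants map to `k'`. -/
theorem exists_tensor_equiv {T₁ : S →+* R₁ ⊗[k₁] k'} {T₂ : S →+* R₂ ⊗[k₂] k'}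
    (hT₁ : ∀ r, T₁ (j₁ r) = r ⊗ₜ 1) (hι₁ : ∀ x, T₁ (ι x) = 1 ⊗ₜ π x)
    (hT₂ : ∀ r, T₂ (j₂ r) = r ⊗ₜ 1) (hι₂ : ∀ x, T₂ (ι x) = 1 ⊗ₜ π x)
    (hgen₁ : ∀ V : Subring S, (∀ x, j₁ x ∈ V) → (∀ x, ι x ∈ V) → ∀ x, x ∈ V)
    (hgen₂ : ∀ V : Subring S, (∀ x, j₂ x ∈ V) → (∀ x, ι x ∈ V) → ∀ x, x ∈ V)
    (hc₁ : ∀ c, ∃ x, ι x = j₁ (algebraMap k₁ R₁ c) ∧ π x = algebraMap k₁ k' c)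
    (hc₂ : ∀ c, ∃ x, ι x = j₂ (algebraMap k₂ R₂ c) ∧ π x = algebraMap k₂ k' c) :
    ∃ ψ : R₁ ⊗[k₁] k' ≃+* R₂ ⊗[k₂] k',
      (∀ r, ψ (r ⊗ₜ 1) = T₂ (j₁ r)) ∧ ∀ x, ψ (1 ⊗ₜ x) = 1 ⊗ₜ x := by
  obtain ⟨ψ, hψ, hψ'⟩ := exists_tensor_ringHom hι₂ hc₁
  obtain ⟨χ, hχ, hχ'⟩ := exists_tensor_ringHom hι₁ hc₂
  exact ⟨RingEquiv.ofRingHom ψ χ (tensor_ringHom_comp_eq hT₂ hι₂ hT₁ hι₁ hgen₁ hχ hχ' hψ hψ')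
    (tensor_ringHom_comp_eq hT₁ hι₁ hT₂ hι₂ hgen₂ hψ hψ' hχ hχ'), hψ, hψ'⟩

theorem tensor_equiv_equivariant {T₂ : S →+* R₂ ⊗[k₂] k'}
    (hT₂ : ∀ r, T₂ (j₂ r) = r ⊗ₜ 1) (hι₂ : ∀ x, T₂ (ι x) = 1 ⊗ₜ π x)
    (hgen₂ : ∀ V : Subring S, (∀ x, j₂ x ∈ V) → (∀ x, ι x ∈ V) → ∀ x, x ∈ V)
    {ψ : R₁ ⊗[k₁] k' →+* R₂ ⊗[k₂] k'}
    (hψ : ∀ r, ψ (r ⊗ₜ 1) = T₂ (j₁ r)) (hψ' : ∀ x, ψ (1 ⊗ₜ x) = 1 ⊗ₜ x)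
    {θ₁ : R₁ →+* R₁} {θ₂ : R₂ →+* R₂} {θS : S →+* S} {θC : C → C} {θ' : k' →+* k'}
    (h₁ : ∀ x, θS (j₁ x) = j₁ (θ₁ x)) (h₂ : ∀ x, θS (j₂ x) = j₂ (θ₂ x))
    (hC : ∀ x, θS (ι x) = ι (θC x)) (hθ' : ∀ x, θ' (π x) = π (θC x))
    {Θ₁ : R₁ ⊗[k₁] k' →+* R₁ ⊗[k₁] k'} {Θ₂ : R₂ ⊗[k₂] k' →+* R₂ ⊗[k₂] k'}
    (hΘ₁ : ∀ r c, Θ₁ (r ⊗ₜ c) = θ₁ r ⊗ₜ θ' c) (hΘ₂ : ∀ r c, Θ₂ (r ⊗ₜ c) = θ₂ r ⊗ₜ θ' c) (t) :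
    ψ (Θ₁ t) = Θ₂ (ψ t) := by
  have h3 : ∀ s, T₂ (θS s) = Θ₂ (T₂ s) :=
    hgen₂ (RingHom.eqLocus (T₂.comp θS) (Θ₂.comp T₂))
      (fun r => by
        change T₂ (θS (j₂ r)) = Θ₂ (T₂ (j₂ r))
        rw [h₂, hT₂, hT₂, hΘ₂, map_one])
      (fun x => by
        change T₂ (θS (ι x)) = Θ₂ (T₂ (ι x))
        rw [hC, hι₂, hι₂, hΘ₂, hθ', map_one])
  suffices ψ.comp Θ₁ = Θ₂.comp ψ from RingHom.congr_fun this t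
  refine tensor_ringHom_ext (fun r => ?_) (fun x => ?_)
  · rw [RingHom.comp_apply, RingHom.comp_apply, hΘ₁, map_one, hψ, hψ, ← h₁, h3]
  · rw [RingHom.comp_apply, RingHom.comp_apply, hΘ₁, map_one, hψ', hψ', hΘ₂, map_one]

end Equivalence

section Constants

/-- The orbits of the entries of the quotients of two fundamental matrices can be enumerated by a
recurrent sequence of constants. -/
theorem exists_recurrent_constants {K R₁ R₂ S C : Type*} [Field K] [CommRing R₁] [CommRing R₂]
    [CommRing S] [CommRing C] [Algebra K R₁] [Algebra K R₂] {n : ℕ} {j₁ : R₁ →+* S}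
    {j₂ : R₂ →+* S} {ι : C →+* S} {Y₁ W₁ : Matrix (Fin n) (Fin n) R₁}
    {Y₂ W₂ : Matrix (Fin n) (Fin n) R₂} {A : Matrix (Fin n) (Fin n) K}
    (hj : ∀ a, j₁ (algebraMap K R₁ a) = j₂ (algebraMap K R₂ a))
    {Φ₁ σ₁ : R₁ →+* R₁} {Φ₂ σ₂ : R₂ →+* R₂} {ΦS σS : S →+* S} {σC : C →+* C}
    (hΦ₁ : ∀ x, ΦS (j₁ x) = j₁ (Φ₁ x)) (hΦ₂ : ∀ x, ΦS (j₂ x) = j₂ (Φ₂ x))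
    (hσ₁ : ∀ x, σS (j₁ x) = j₁ (σ₁ x)) (hσ₂ : ∀ x, σS (j₂ x) = j₂ (σ₂ x))
    (hσC : ∀ x, σS (ι x) = ι (σC x)) (hC : ∀ s, ΦS s = s → ∃ x, ι x = s)
    (hY₁ : Y₁.map Φ₁ = A.map (algebraMap K R₁) * Y₁) (hYW₁ : Y₁ * W₁ = 1)
    (hW₁ : W₁.map Φ₁ * A.map (algebraMap K R₁) = W₁)
    (hg₁ : Algebra.adjoin K {x | ∃ i p q, (σ₁ ^ i) (Y₁ p q) = x ∨ (σ₁ ^ i) (W₁ p q) = x} = ⊤)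
    (hY₂ : Y₂.map Φ₂ = A.map (algebraMap K R₂) * Y₂) (hYW₂ : Y₂ * W₂ = 1)
    (hW₂ : W₂.map Φ₂ * A.map (algebraMap K R₂) = W₂)
    (hg₂ : Algebra.adjoin K {x | ∃ i p q, (σ₂ ^ i) (Y₂ p q) = x ∨ (σ₂ ^ i) (W₂ p q) = x} = ⊤) :
    ∃ (t : ℕ) (z : ℕ → C), 1 ≤ t ∧ (∀ i, z (i + t) = σC (z i)) ∧
      (∀ V : Subring S, (∀ x, j₁ x ∈ V) → (∀ i, ι (z i) ∈ V) → ∀ x, j₂ x ∈ V) ∧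
      ∀ V : Subring S, (∀ x, j₂ x ∈ V) → (∀ i, ι (z i) ∈ V) → ∀ x, j₁ x ∈ V := by
  choose Z hZ using fun p q => hC _ (quotient_fundamental_constant hj hΦ₁ hΦ₂ hW₁ hY₂ p q)
  choose Z' hZ' using fun p q =>
    hC _ (quotient_fundamental_constant (fun a => (hj a).symm) hΦ₂ hΦ₁ hW₂ hY₁ p q)
  obtain ⟨t, z, ht, hz, hsub⟩ := exists_recurrent_matrix_entries σC Z Z'
  have h1 : ∀ V : Subring S, (∀ i, ι (z i) ∈ V) → ∀ i p q,
      (σS ^ i) ((W₁.map j₁ * Y₂.map j₂) p q) ∈ V := fun V hV i p q => by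
    obtain ⟨l, hl⟩ := hsub ⟨i, p, q, Or.inl rfl⟩
    rw [← hZ, pow_apply_algebraMap hσC, ← hl]
    exact hV l
  have h2 : ∀ V : Subring S, (∀ i, ι (z i) ∈ V) → ∀ i p q,
      (σS ^ i) ((W₂.map j₂ * Y₁.map j₁) p q) ∈ V := fun V hV i p q => by
    obtain ⟨l, hl⟩ := hsub ⟨i, p, q, Or.inr rfl⟩
    rw [← hZ', pow_apply_algebraMap hσC, ← hl]
    exact hV l
  exact ⟨t, z, ht, hz,
    fun V hV hVz => mem_of_quotient_fundamental hj hσ₁ hσ₂ hYW₁ hg₂ hV (h1 V hVz) (h2 V hVz),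
    fun V hV hVz => mem_of_quotient_fundamental (fun a => (hj a).symm) hσ₂ hσ₁ hYW₂ hg₁ hV
      (h2 V hVz) (h1 V hVz)⟩

/-- Constants that generate a ring over a simple subring generate the ring of constants over the
constants of the subring. -/
theorem adjoin_constants_eq_top {k R C S : Type*} [Field k] [CommRing R] [Algebra k R] [CommRing C]
    [Algebra k C] [CommRing S] {Φ : R →+* R} (hs : DiffSimple Φ)
    (hk : ∀ a, Φ a = a → ∃ c : k, algebraMap k R c = a) {ΦS : S →+* S} {j : R →+* S} {ι : C →+* S}
    (hι : Function.Injective ι) (hj : ∀ c, j (algebraMap k R c) = ι (algebraMap k C c))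
    (hΦj : ∀ x, ΦS (j x) = j (Φ x)) (hΦι : ∀ x, ΦS (ι x) = ι x) {z : ℕ → C}
    (hgen : ∀ V : Subring S, (∀ x, j x ∈ V) → (∀ i, ι (z i) ∈ V) → ∀ x, x ∈ V) :
    Algebra.adjoin k (Set.range z) = ⊤ := by
  have := hs.nontrivial
  let m : R ⊗[k] C →+* S := tensorLift j ι hj
  have hm : ∀ r x, m (r ⊗ₜ x) = j r * ι x := tensorLift_tmul _ _ _
  have hm1 : ∀ r, m (r ⊗ₜ 1) = j r := fun r => by rw [hm, map_one, mul_one]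
  have hm2 : ∀ x, m (1 ⊗ₜ x) = ι x := fun x => by rw [hm, map_one, one_mul]
  refine eq_top_of_tensor_closure m
    (injective_of_tensor_constants hs hk ΦS m (fun r => ?_) (fun x => ?_) (fun x hx => ?_)) _
    fun V hV hV' x => ?_
  · rw [hm1, hm1, hΦj]
  · rw [hm2, hΦι]
  · rw [hm2] at hx
    exact hι (hx.trans (map_zero ι).symm)
  · exact hgen V (fun x => hm1 x ▸ hV x)
      (fun i => hm2 (z i) ▸ hV' _ (Algebra.subset_adjoin ⟨i, rfl⟩)) _

theorem mem_of_mem_tensor {K R₁ R₂ : Type*} [CommRing K] [CommRing R₁] [CommRing R₂]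
    [Algebra K R₁] [Algebra K R₂] (V : Subring (R₁ ⊗[K] R₂)) (h1 : ∀ x, x ⊗ₜ 1 ∈ V)
    (h2 : ∀ x, 1 ⊗ₜ x ∈ V) (t) : t ∈ V := by
  induction t with
  | zero => exact zero_mem V
  | add a b ha hb => exact add_mem ha hb
  | tmul a b =>
    rw [← mul_one a, ← one_mul b, ← Algebra.TensorProduct.tmul_mul_tmul]
    exact mul_mem (h1 a) (h2 b)

end Constants

section SolutionRings

/-- An equivariant homomorphism from the constants of a ring generated over its constants by either
of two simple subrings identifies the base changes of these subrings. -/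
theorem exists_equivariant_tensor_equiv {k k₁ k₂ R₁ R₂ S C k' : Type*} [Field k] [Field k₁]
    [Field k₂] [CommRing R₁] [CommRing R₂] [CommRing S] [CommRing C] [CommRing k'] [Nontrivial k']
    [Algebra k k₁] [Algebra k k₂] [Algebra k C] [Algebra k₁ C] [Algebra k₂ C]
    [IsScalarTower k k₁ C] [IsScalarTower k k₂ C] [Algebra k₁ R₁] [Algebra k₂ R₂]
    {Φ₁ σ₁ : R₁ →+* R₁} {Φ₂ σ₂ : R₂ →+* R₂} {ΦS σS : S →+* S} {σC : C →+* C} {σ' : k' →+* k'}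
    {κ : k →+* k} {κ₁ : k₁ →+* k₁} {κ₂ : k₂ →+* k₂}
    (hκ : ∀ c, algebraMap k k₁ (κ c) = κ₁ (algebraMap k k₁ c))
    (hs₁ : DiffSimple Φ₁) (hs₂ : DiffSimple Φ₂)
    (hk₁ : ∀ a, Φ₁ a = a → ∃ c : k₁, algebraMap k₁ R₁ c = a)
    (hk₂ : ∀ a, Φ₂ a = a → ∃ c : k₂, algebraMap k₂ R₂ c = a)
    (hΦk₁ : ∀ c, Φ₁ (algebraMap k₁ R₁ c) = algebraMap k₁ R₁ c)
    (hΦk₂ : ∀ c, Φ₂ (algebraMap k₂ R₂ c) = algebraMap k₂ R₂ c)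
    (hκ₁ : ∀ c, σ₁ (algebraMap k₁ R₁ c) = algebraMap k₁ R₁ (κ₁ c))
    (hκ₂ : ∀ c, σ₂ (algebraMap k₂ R₂ c) = algebraMap k₂ R₂ (κ₂ c))
    {j₁ : R₁ →+* S} {j₂ : R₂ →+* S} {ι : C →+* S} (hι : Function.Injective ι)
    (hΦ₁ : ∀ x, ΦS (j₁ x) = j₁ (Φ₁ x)) (hΦ₂ : ∀ x, ΦS (j₂ x) = j₂ (Φ₂ x))
    (hσ₁ : ∀ x, σS (j₁ x) = j₁ (σ₁ x)) (hσ₂ : ∀ x, σS (j₂ x) = j₂ (σ₂ x))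
    (hΦι : ∀ x, ΦS (ι x) = ι x) (hσC : ∀ x, σS (ι x) = ι (σC x))
    (hj₁ : ∀ c, j₁ (algebraMap k₁ R₁ c) = ι (algebraMap k₁ C c))
    (hj₂ : ∀ c, j₂ (algebraMap k₂ R₂ c) = ι (algebraMap k₂ C c))
    (hgen₁ : ∀ V : Subring S, (∀ x, j₁ x ∈ V) → (∀ x, ι x ∈ V) → ∀ x, x ∈ V)
    (hgen₂ : ∀ V : Subring S, (∀ x, j₂ x ∈ V) → (∀ x, ι x ∈ V) → ∀ x, x ∈ V)
    {π : C →+* k'} (hπ : ∀ x, σ' (π x) = π (σC x)) :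
    ∃ (e : k →+* k') (e₁ : k₁ →+* k') (e₂ : k₂ →+* k'),
      (∀ c, e c = π (algebraMap k C c)) ∧
      Function.Injective e ∧ Function.Injective e₁ ∧ Function.Injective e₂ ∧
      (∀ c, e (κ c) = σ' (e c)) ∧ (∀ c, e₁ (κ₁ c) = σ' (e₁ c)) ∧ (∀ c, e₂ (κ₂ c) = σ' (e₂ c)) ∧
      (∀ c, e₁ (algebraMap k k₁ c) = e c) ∧ (∀ c, e₂ (algebraMap k k₂ c) = e c) ∧
      (letI : Algebra k₁ k' := e₁.toAlgebra
       letI : Algebra k₂ k' := e₂.toAlgebra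
       ∃ (ψ : (R₁ ⊗[k₁] k') ≃+* (R₂ ⊗[k₂] k'))
         (Φ₁' σ₁' : (R₁ ⊗[k₁] k') →+* (R₁ ⊗[k₁] k'))
         (Φ₂' σ₂' : (R₂ ⊗[k₂] k') →+* (R₂ ⊗[k₂] k')),
         (∀ (r : R₁) (c : k'), Φ₁' (r ⊗ₜ c) = Φ₁ r ⊗ₜ c) ∧
         (∀ (r : R₂) (c : k'), Φ₂' (r ⊗ₜ c) = Φ₂ r ⊗ₜ c) ∧
         (∀ (r : R₁) (c : k'), σ₁' (r ⊗ₜ c) = σ₁ r ⊗ₜ σ' c) ∧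
         (∀ (r : R₂) (c : k'), σ₂' (r ⊗ₜ c) = σ₂ r ⊗ₜ σ' c) ∧
         (∀ t, ψ (Φ₁' t) = Φ₂' (ψ t)) ∧
         (∀ t, ψ (σ₁' t) = σ₂' (ψ t)) ∧
         (∀ (x : R₁) (y : R₂) (c : k'), j₁ x = j₂ y → ψ (x ⊗ₜ c) = y ⊗ₜ c)) := by
  have hσk₁ : ∀ c, σC (algebraMap k₁ C c) = algebraMap k₁ C (κ₁ c) := fun c => hι <| by
    rw [← hσC, ← hj₁, ← hj₁, hσ₁, hκ₁]
  have hσk₂ : ∀ c, σC (algebraMap k₂ C c) = algebraMap k₂ C (κ₂ c) := fun c => hι <| by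
    rw [← hσC, ← hj₂, ← hj₂, hσ₂, hκ₂]
  refine ⟨π.comp (algebraMap k C), π.comp (algebraMap k₁ C), π.comp (algebraMap k₂ C),
    fun c => rfl, RingHom.injective _, RingHom.injective _, RingHom.injective _,
    fun c => ?_, fun c => ?_, fun c => ?_, fun c => ?_, fun c => ?_, ?_⟩
  · simp only [RingHom.comp_apply]
    rw [hπ, IsScalarTower.algebraMap_apply k k₁ C, IsScalarTower.algebraMap_apply k k₁ C, hσk₁, hκ]
  · exact (congrArg π (hσk₁ c).symm).trans (hπ _).symm
  · exact (congrArg π (hσk₂ c).symm).trans (hπ _).symm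
  · exact congrArg π (IsScalarTower.algebraMap_apply k k₁ C c).symm
  · exact congrArg π (IsScalarTower.algebraMap_apply k k₂ C c).symm
  let : Algebra k₁ k' := (π.comp (algebraMap k₁ C)).toAlgebra
  let : Algebra k₂ k' := (π.comp (algebraMap k₂ C)).toAlgebra
  obtain ⟨T₁, hT₁, hT₁'⟩ := exists_base_change hs₁ hk₁ hι hj₁ hΦ₁ hΦι hgen₁
    (π := π) (k' := k') fun c => rfl
  obtain ⟨T₂, hT₂, hT₂'⟩ := exists_base_change hs₂ hk₂ hι hj₂ hΦ₂ hΦι hgen₂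
    (π := π) (k' := k') fun c => rfl
  obtain ⟨ψ, hψ, hψ'⟩ := exists_tensor_equiv hT₁ hT₁' hT₂ hT₂' hgen₁ hgen₂
    (fun c => ⟨_, (hj₁ c).symm, rfl⟩) (fun c => ⟨_, (hj₂ c).symm, rfl⟩)
  obtain ⟨Φ₁', hΦ₁'⟩ := exists_tensor_endo (θk := id) hΦk₁ (θ' := RingHom.id k') fun c => rfl
  obtain ⟨Φ₂', hΦ₂'⟩ := exists_tensor_endo (θk := id) hΦk₂ (θ' := RingHom.id k') fun c => rfl
  obtain ⟨σ₁', hσ₁'⟩ := exists_tensor_endo hκ₁ (θ' := σ')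
    fun c => (hπ _).trans (congrArg π (hσk₁ c))
  obtain ⟨σ₂', hσ₂'⟩ := exists_tensor_endo hκ₂ (θ' := σ')
    fun c => (hπ _).trans (congrArg π (hσk₂ c))
  refine ⟨ψ, Φ₁', σ₁', Φ₂', σ₂', hΦ₁', hΦ₂', hσ₁', hσ₂', ?_, ?_, fun x y c hxy => ?_⟩
  · exact tensor_equiv_equivariant (ψ := ψ.toRingHom) hT₂ hT₂' hgen₂ hψ hψ' hΦ₁ hΦ₂ (θC := id)
      hΦι (fun _ => rfl) hΦ₁' hΦ₂'
  · exact tensor_equiv_equivariant (ψ := ψ.toRingHom) hT₂ hT₂' hgen₂ hψ hψ' hσ₁ hσ₂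
      hσC hπ hσ₁' hσ₂'
  · have h1 : x ⊗ₜ[k₁] c = (x ⊗ₜ 1) * (1 ⊗ₜ c) := by
      rw [Algebra.TensorProduct.tmul_mul_tmul, mul_one, one_mul]
    rw [h1, map_mul, hψ, hψ', hxy, hT₂, Algebra.TensorProduct.tmul_mul_tmul, mul_one, one_mul]

end SolutionRings

section Uniqueness

/-- An extension of rings with endomorphisms, the larger one consisting of fractions of elements
of a finitely generated subring with endomorphism. -/
def FinitelyGeneratedFractions {k k' : Type*} [CommRing k] [CommRing k'] (e : k →+* k')
    (σ : k' →+* k') : Prop :=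
  ∃ S : Finset k', ∀ x : k', ∃ a b : k',
    a ∈ Subring.closure (Set.range e ∪ {z | ∃ s ∈ S, ∃ m : ℕ, (⇑σ)^[m] s = z}) ∧
    b ∈ Subring.closure (Set.range e ∪ {z | ∃ s ∈ S, ∃ m : ℕ, (⇑σ)^[m] s = z}) ∧
    IsUnit b ∧ x * b = a

/-- A constrained extension of rings with endomorphisms. -/
def ConstrainedExtension {k k' : Type*} [CommRing k] [CommRing k'] (e : k →+* k')
    (σ : k' →+* k') : Prop :=
  ∀ (m : ℕ) (a : Fin m → k'), ∃ b binv : k', b * binv = 1 ∧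
    ∃ σV : ↥(Subring.closure (Set.range e ∪
              {z : k' | ∃ (j : Fin m) (m' : ℕ), (⇑σ)^[m'] (a j) = z} ∪
              {z : k' | ∃ m' : ℕ, (⇑σ)^[m'] binv = z})) →+*
           ↥(Subring.closure (Set.range e ∪
              {z : k' | ∃ (j : Fin m) (m' : ℕ), (⇑σ)^[m'] (a j) = z} ∪
              {z : k' | ∃ m' : ℕ, (⇑σ)^[m'] binv = z})),
      (∀ v, ((σV v : k')) = σ ↑v) ∧ ∀ p, PseudoPrime σV p → p = ⊥

/-- Uniqueness of solution rings, with the constants given as abstract fields. -/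
theorem exists_constrained_extension_and_equiv {k K k₁ k₂ R₁ R₂ : Type u} [Field k] [Field K]
    [Field k₁] [Field k₂] [CommRing R₁] [CommRing R₂] [Algebra k K] [Algebra k k₁] [Algebra k k₂]
    [Algebra K R₁] [Algebra K R₂] [Algebra k₁ R₁] [Algebra k₂ R₂] {n : ℕ}
    {A : Matrix (Fin n) (Fin n) K} {φ σ : K →+* K} (hcomm : ∀ a, φ (σ a) = σ (φ a))
    (hφ : ∀ c : k, φ (algebraMap k K c) = algebraMap k K c)
    (hper : ∀ (m : ℕ), 1 ≤ m → ∀ a : K, (φ ^ m) a = a → ∃ c, algebraMap k K c = a)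
    {κ : k →+* k} (hκsurj : Function.Surjective κ)
    (hκ : ∀ c, σ (algebraMap k K c) = algebraMap k K (κ c))
    {κ₁ : k₁ →+* k₁} (hκκ₁ : ∀ c, κ₁ (algebraMap k k₁ c) = algebraMap k k₁ (κ c))
    {κ₂ : k₂ →+* k₂}
    (hk₁ : ∀ c, algebraMap K R₁ (algebraMap k K c) = algebraMap k₁ R₁ (algebraMap k k₁ c))
    (hk₂ : ∀ c, algebraMap K R₂ (algebraMap k K c) = algebraMap k₂ R₂ (algebraMap k k₂ c))
    {Φ₁ σ₁ : R₁ →+* R₁} (hcomm₁ : ∀ x, Φ₁ (σ₁ x) = σ₁ (Φ₁ x))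
    {Φ₂ σ₂ : R₂ →+* R₂} (hcomm₂ : ∀ x, Φ₂ (σ₂ x) = σ₂ (Φ₂ x))
    (hΦ₁ : ∀ a, Φ₁ (algebraMap K R₁ a) = algebraMap K R₁ (φ a))
    (hσ₁ : ∀ a, σ₁ (algebraMap K R₁ a) = algebraMap K R₁ (σ a))
    (hΦ₂ : ∀ a, Φ₂ (algebraMap K R₂ a) = algebraMap K R₂ (φ a))
    (hσ₂ : ∀ a, σ₂ (algebraMap K R₂ a) = algebraMap K R₂ (σ a))
    (hs₁ : DiffSimple Φ₁) (hs₂ : DiffSimple Φ₂) (hd₁ : PseudoDomain Φ₁) (hd₂ : PseudoDomain Φ₂)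
    (hkΦ₁ : ∀ a, Φ₁ a = a → ∃ c : k₁, algebraMap k₁ R₁ c = a)
    (hkΦ₂ : ∀ a, Φ₂ a = a → ∃ c : k₂, algebraMap k₂ R₂ c = a)
    (hΦk₁ : ∀ c, Φ₁ (algebraMap k₁ R₁ c) = algebraMap k₁ R₁ c)
    (hΦk₂ : ∀ c, Φ₂ (algebraMap k₂ R₂ c) = algebraMap k₂ R₂ c)
    (hκ₁ : ∀ c, σ₁ (algebraMap k₁ R₁ c) = algebraMap k₁ R₁ (κ₁ c))
    (hκ₂ : ∀ c, σ₂ (algebraMap k₂ R₂ c) = algebraMap k₂ R₂ (κ₂ c))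
    {Y₁ W₁ : Matrix (Fin n) (Fin n) R₁} {Y₂ W₂ : Matrix (Fin n) (Fin n) R₂}
    (hY₁ : Y₁.map Φ₁ = A.map (algebraMap K R₁) * Y₁) (hYW₁ : Y₁ * W₁ = 1)
    (hW₁ : W₁.map Φ₁ * A.map (algebraMap K R₁) = W₁)
    (hg₁ : Algebra.adjoin K {x | ∃ i p q, (σ₁ ^ i) (Y₁ p q) = x ∨ (σ₁ ^ i) (W₁ p q) = x} = ⊤)
    (hY₂ : Y₂.map Φ₂ = A.map (algebraMap K R₂) * Y₂) (hYW₂ : Y₂ * W₂ = 1)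
    (hW₂ : W₂.map Φ₂ * A.map (algebraMap K R₂) = W₂)
    (hg₂ : Algebra.adjoin K {x | ∃ i p q, (σ₂ ^ i) (Y₂ p q) = x ∨ (σ₂ ^ i) (W₂ p q) = x} = ⊤) :
    ∃ (k' : Type u) (_ : CommRing k') (σ' : k' →+* k'), PseudoField k' σ' ∧
      ∃ (e : k →+* k') (e₁ : k₁ →+* k') (e₂ : k₂ →+* k'),
        Function.Injective e ∧ Function.Injective e₁ ∧ Function.Injective e₂ ∧
        (∀ c, e (κ c) = σ' (e c)) ∧ (∀ c, e₁ (κ₁ c) = σ' (e₁ c)) ∧ (∀ c, e₂ (κ₂ c) = σ' (e₂ c)) ∧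
        (∀ c, e₁ (algebraMap k k₁ c) = e c) ∧ (∀ c, e₂ (algebraMap k k₂ c) = e c) ∧
        FinitelyGeneratedFractions e σ' ∧ ConstrainedExtension e σ' ∧
        (letI : Algebra k₁ k' := e₁.toAlgebra
         letI : Algebra k₂ k' := e₂.toAlgebra
         ∃ (ψ : (R₁ ⊗[k₁] k') ≃+* (R₂ ⊗[k₂] k'))
           (Φ₁' σ₁' : (R₁ ⊗[k₁] k') →+* (R₁ ⊗[k₁] k'))
           (Φ₂' σ₂' : (R₂ ⊗[k₂] k') →+* (R₂ ⊗[k₂] k')),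
           (∀ (r : R₁) (c : k'), Φ₁' (r ⊗ₜ c) = Φ₁ r ⊗ₜ c) ∧
           (∀ (r : R₂) (c : k'), Φ₂' (r ⊗ₜ c) = Φ₂ r ⊗ₜ c) ∧
           (∀ (r : R₁) (c : k'), σ₁' (r ⊗ₜ c) = σ₁ r ⊗ₜ σ' c) ∧
           (∀ (r : R₂) (c : k'), σ₂' (r ⊗ₜ c) = σ₂ r ⊗ₜ σ' c) ∧
           (∀ t, ψ (Φ₁' t) = Φ₂' (ψ t)) ∧
           (∀ t, ψ (σ₁' t) = σ₂' (ψ t)) ∧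
           (∀ (x : K) (c : k'), ψ (algebraMap K R₁ x ⊗ₜ c) = algebraMap K R₂ x ⊗ₜ c)) := by
  let j₁ : R₁ →+* R₁ ⊗[K] R₂ := Algebra.TensorProduct.includeLeftRingHom
  let j₂ : R₂ →+* R₁ ⊗[K] R₂ :=
    (Algebra.TensorProduct.includeRight : R₂ →ₐ[K] R₁ ⊗[K] R₂).toRingHom
  have hj₁ : ∀ x, j₁ x = x ⊗ₜ 1 := fun _ => rfl
  have hj₂ : ∀ x, j₂ x = 1 ⊗ₜ x := fun _ => rfl
  have hj : ∀ a, j₁ (algebraMap K R₁ a) = j₂ (algebraMap K R₂ a) := fun a =>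
    Algebra.TensorProduct.tmul_one_eq_one_tmul a
  obtain ⟨ΦS, hΦS⟩ := exists_tensor_endo hΦ₁ hΦ₂
  obtain ⟨σS, hσS⟩ := exists_tensor_endo hσ₁ hσ₂
  have hΦS₁ : ∀ x, ΦS (j₁ x) = j₁ (Φ₁ x) := fun x => by rw [hj₁, hΦS, map_one, hj₁]
  have hΦS₂ : ∀ x, ΦS (j₂ x) = j₂ (Φ₂ x) := fun x => by rw [hj₂, hΦS, map_one, hj₂]
  have hσS₁ : ∀ x, σS (j₁ x) = j₁ (σ₁ x) := fun x => by rw [hj₁, hσS, map_one, hj₁]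
  have hσS₂ : ∀ x, σS (j₂ x) = j₂ (σ₂ x) := fun x => by rw [hj₂, hσS, map_one, hj₂]
  have hcommS : ∀ x, ΦS (σS x) = σS (ΦS x) := fun x => by
    refine RingHom.congr_fun (f := ΦS.comp σS) (g := σS.comp ΦS)
      (tensor_ringHom_ext (fun x => ?_) (fun x => ?_)) x
    · rw [RingHom.comp_apply, RingHom.comp_apply, ← hj₁, hσS₁, hΦS₁, hΦS₁, hσS₁, hcomm₁]
    · rw [RingHom.comp_apply, RingHom.comp_apply, ← hj₂, hσS₂, hΦS₂, hΦS₂, hσS₂, hcomm₂]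
  let C := constSubring ΦS
  let ι : C →+* R₁ ⊗[K] R₂ := C.subtype
  have hι : Function.Injective ι := Subtype.val_injective
  have hΦι : ∀ x, ΦS (ι x) = ι x := fun x => x.2
  let σC : C →+* C := resEndo ΦS σS hcommS
  have hσC : ∀ x, σS (ι x) = ι (σC x) := fun _ => rfl
  let i₁ : k₁ →+* C := (j₁.comp (algebraMap k₁ R₁)).codRestrict C fun c =>
    (hΦS₁ _).trans (congrArg j₁ (hΦk₁ c))
  let i₂ : k₂ →+* C := (j₂.comp (algebraMap k₂ R₂)).codRestrict C fun c =>
    (hΦS₂ _).trans (congrArg j₂ (hΦk₂ c))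
  let : Algebra k₁ C := i₁.toAlgebra
  let : Algebra k₂ C := i₂.toAlgebra
  let : Algebra k C := (i₁.comp (algebraMap k k₁)).toAlgebra
  have : IsScalarTower k k₁ C := IsScalarTower.of_algebraMap_eq fun _ => rfl
  have : IsScalarTower k k₂ C := IsScalarTower.of_algebraMap_eq fun c => hι <|
    (congrArg j₁ (hk₁ c).symm).trans ((hj _).trans (congrArg j₂ (hk₂ c)))
  have hi₁ : ∀ c, j₁ (algebraMap k₁ R₁ c) = ι (algebraMap k₁ C c) := fun _ => rfl
  have hi₂ : ∀ c, j₂ (algebraMap k₂ R₂ c) = ι (algebraMap k₂ C c) := fun _ => rfl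
  obtain ⟨t, z, ht, hz, hz₁, hz₂⟩ := exists_recurrent_constants (ι := ι) hj hΦS₁ hΦS₂ hσS₁ hσS₂ hσC
    (fun s hs => ⟨⟨s, hs⟩, rfl⟩) hY₁ hYW₁ hW₁ hg₁ hY₂ hYW₂ hW₂ hg₂
  have htop : Algebra.adjoin k₁ (Set.range z) = ⊤ :=
    adjoin_constants_eq_top hs₁ hkΦ₁ hι hi₁ hΦS₁ hΦι fun V hV hVz =>
      mem_of_mem_tensor V hV (hz₁ V hV hVz)
  obtain ⟨s₁, b₁, hs₁', hb₁, hsub₁⟩ := exists_recurrent_matrix_entries σ₁ Y₁ W₁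
  have htop₁ : Algebra.adjoin K (Set.range b₁) = ⊤ :=
    eq_top_iff.mpr (hg₁ ▸ Algebra.adjoin_mono hsub₁)
  obtain ⟨s₂, b₂, hs₂', hb₂, hsub₂⟩ := exists_recurrent_matrix_entries σ₂ Y₂ W₂
  have htop₂ : Algebra.adjoin K (Set.range b₂) = ⊤ :=
    eq_top_iff.mpr (hg₂ ▸ Algebra.adjoin_mono hsub₂)
  obtain ⟨Ω, _, τ₀, N₀, p₁, p₂, hN₀, hp, hp₁, hp₂⟩ := exists_common_specialization hs₁ hd₁ hcomm₁
    hs₂ hd₂ hcomm₂ hσ₁ hσ₂ hs₂' hb₂ htop₂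
  let P : R₁ ⊗[K] R₂ →+* Ω := tensorLift p₁ p₂ hp
  have hP₁ : ∀ x, P (j₁ x) = p₁ x := fun x => by
    rw [hj₁, tensorLift_tmul, map_one, mul_one]
  have hP₂ : ∀ x, P (j₂ x) = p₂ x := fun x => by
    rw [hj₂, tensorLift_tmul, map_one, one_mul]
  have hP : ∀ x, P ((σS ^ N₀) x) = τ₀ (P x) := fun x => by
    refine RingHom.congr_fun (f := P.comp (σS ^ N₀)) (g := τ₀.comp P)
      (tensor_ringHom_ext (fun x => ?_) (fun x => ?_)) x
    · rw [RingHom.comp_apply, RingHom.comp_apply, ← hj₁, pow_apply_algebraMap hσS₁, hP₁, hP₁, hp₁]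
    · rw [RingHom.comp_apply, RingHom.comp_apply, ← hj₂, pow_apply_algebraMap hσS₂, hP₂, hP₂, hp₂]
  obtain ⟨B, σB, r, g, hr, hg, hB, hσB, hden, w, hw0, hw⟩ := exists_constants_subalgebra hcomm hφ
    hper hκ hκκ₁ hk₁ hs₁ hd₁ hcomm₁ hΦ₁ hΦk₁ hσ₁ hκ₁ hs₁' hb₁ htop₁
  obtain ⟨N, _, L, _, τ, π, hπ, hfin⟩ := exists_constrained_of_constants hκsurj hκκ₁ hr hg hB hσB
    hden hw0 hw (fun x => hι (by rw [← hσC, ← hi₁, hσS₁, hκ₁, hi₁])) hz ht htop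
    (p := P.comp ι) (τ₀ := τ₀) hN₀ fun x =>
      (congrArg P (pow_apply_algebraMap hσC N₀ x).symm).trans (hP (ι x))
  obtain ⟨e, e₁, e₂, he, h1, h2, h3, h4, h5, h6, h7, h8, ψ, Φ₁', σ₁', Φ₂', σ₂', h9, h10, h11, h12,
      h13, h14, h15⟩ :=
    exists_equivariant_tensor_equiv (fun c => (hκκ₁ c).symm) hs₁ hs₂ hkΦ₁ hkΦ₂ hΦk₁ hΦk₂ hκ₁ hκ₂ hι
      hΦS₁ hΦS₂ hσS₁ hσS₂ hΦι hσC hi₁ hi₂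
      (fun V hV hV' => mem_of_mem_tensor V hV (hz₁ V hV fun i => hV' _))
      (fun V hV hV' => mem_of_mem_tensor V (hz₂ V hV fun i => hV' _) hV) hπ
  exact ⟨Fin N → L, inferInstance, coindEndo τ, pseudoField_coind τ, e, e₁, e₂, h1, h2, h3, h4, h5,
    h6, h7, h8, (hfin e he).1, (hfin e he).2, ψ, Φ₁', σ₁', Φ₂', σ₂', h9, h10, h11, h12, h13, h14,
    fun x c => h15 _ _ c (hj x)⟩

end Uniqueness

/-- Uniqueness of `σ`-Picard–Vessiot rings: two `σ`-PV rings `R₁`, `R₂` for the same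
equation `φ(y) = Ay` over a `φσ`-field `K` with `K^{φ^∞} = K^φ` and `σ : K^φ → K^φ`
surjective become isomorphic after a base change to a suitable finitely `σ`-generated
constrained `σ`-pseudo field extension `k'` of `k = K^φ` containing `k₁ = R₁^{Φ₁}` and
`k₂ = R₂^{Φ₂}`. -/
theorem sigma_pv_ring_unique_up_to_constrained_extension
    {K R₁ R₂ : Type u} [Field K] [CommRing R₁] [CommRing R₂]
    [Algebra K R₁] [Algebra K R₂] {n : ℕ}
    (φ σ : K →+* K) (hcomm : ∀ a : K, φ (σ a) = σ (φ a))
    (hper : ∀ (a : K) (m : ℕ), 1 ≤ m → (⇑φ)^[m] a = a → φ a = a)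
    (honto : ∀ a : K, φ a = a → ∃ b : K, φ b = b ∧ σ b = a)
    (A : Matrix (Fin n) (Fin n) K) (hA : IsUnit A.det)
    (Φ₁ σ₁ : R₁ →+* R₁) (hcomm₁ : ∀ x : R₁, Φ₁ (σ₁ x) = σ₁ (Φ₁ x))
    (Φ₂ σ₂ : R₂ →+* R₂) (hcomm₂ : ∀ x : R₂, Φ₂ (σ₂ x) = σ₂ (Φ₂ x))
    (hΦ₁ : ∀ a : K, Φ₁ (algebraMap K R₁ a) = algebraMap K R₁ (φ a))
    (hσ₁ : ∀ a : K, σ₁ (algebraMap K R₁ a) = algebraMap K R₁ (σ a))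
    (hΦ₂ : ∀ a : K, Φ₂ (algebraMap K R₂ a) = algebraMap K R₂ (φ a))
    (hσ₂ : ∀ a : K, σ₂ (algebraMap K R₂ a) = algebraMap K R₂ (σ a))
    (hs₁ : DiffSimple Φ₁) (hs₂ : DiffSimple Φ₂)
    (hd₁ : PseudoDomain Φ₁) (hd₂ : PseudoDomain Φ₂)
    (Y₁ : Matrix (Fin n) (Fin n) R₁) (Y₂ : Matrix (Fin n) (Fin n) R₂)
    (w₁ : ℕ → R₁) (w₂ : ℕ → R₂)
    (hY₁ : Y₁.map ⇑Φ₁ = A.map ⇑(algebraMap K R₁) * Y₁)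
    (hY₂ : Y₂.map ⇑Φ₂ = A.map ⇑(algebraMap K R₂) * Y₂)
    (hw₁ : ∀ i : ℕ, (Y₁.map ((⇑σ₁)^[i])).det * w₁ i = 1)
    (hw₂ : ∀ i : ℕ, (Y₂.map ((⇑σ₂)^[i])).det * w₂ i = 1)
    (hg₁ : Algebra.adjoin K
      ({x : R₁ | ∃ (i : ℕ) (p q : Fin n), (Y₁.map ((⇑σ₁)^[i])) p q = x} ∪ Set.range w₁) = ⊤)
    (hg₂ : Algebra.adjoin K
      ({x : R₂ | ∃ (i : ℕ) (p q : Fin n), (Y₂.map ((⇑σ₂)^[i])) p q = x} ∪ Set.range w₂) = ⊤) :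
    ∃ (k' : Type u) (_ : CommRing k') (σ'' : k' →+* k'),
      -- `k'` is a `σ`-pseudo field
      PseudoField k' σ'' ∧
      ∃ (e : ↥(constSubring φ) →+* k')
        (e₁ : ↥(constSubring Φ₁) →+* k') (e₂ : ↥(constSubring Φ₂) →+* k'),
        -- embeddings commuting with the `σ`-actions
        Function.Injective e ∧ Function.Injective e₁ ∧ Function.Injective e₂ ∧
        (∀ x : ↥(constSubring φ), e (resEndo φ σ hcomm x) = σ'' (e x)) ∧
        (∀ x : ↥(constSubring Φ₁), e₁ (resEndo Φ₁ σ₁ hcomm₁ x) = σ'' (e₁ x)) ∧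
        (∀ x : ↥(constSubring Φ₂), e₂ (resEndo Φ₂ σ₂ hcomm₂ x) = σ'' (e₂ x)) ∧
        -- compatibility over `k`
        (∀ (a : K) (ha : φ a = a),
          e₁ ⟨algebraMap K R₁ a, (hΦ₁ a).trans (congrArg (algebraMap K R₁) ha)⟩
            = e ⟨a, ha⟩) ∧
        (∀ (a : K) (ha : φ a = a),
          e₂ ⟨algebraMap K R₂ a, (hΦ₂ a).trans (congrArg (algebraMap K R₂) ha)⟩
            = e ⟨a, ha⟩) ∧
        -- `k'` is finitely `σ`-generated over `k`
        (∃ S : Finset k', ∀ x : k', ∃ a b : k',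
          a ∈ Subring.closure
            (Set.range e ∪ {z : k' | ∃ s ∈ S, ∃ m : ℕ, (⇑σ'')^[m] s = z}) ∧
          b ∈ Subring.closure
            (Set.range e ∪ {z : k' | ∃ s ∈ S, ∃ m : ℕ, (⇑σ'')^[m] s = z}) ∧
          IsUnit b ∧ x * b = a) ∧
        -- `k'` is constrained over `k`
        (∀ (m : ℕ) (a : Fin m → k'), ∃ b binv : k', b * binv = 1 ∧
          ∃ σV : ↥(Subring.closure (Set.range e ∪
                    {z : k' | ∃ (j : Fin m) (m' : ℕ), (⇑σ'')^[m'] (a j) = z} ∪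
                    {z : k' | ∃ m' : ℕ, (⇑σ'')^[m'] binv = z})) →+*
                 ↥(Subring.closure (Set.range e ∪
                    {z : k' | ∃ (j : Fin m) (m' : ℕ), (⇑σ'')^[m'] (a j) = z} ∪
                    {z : k' | ∃ m' : ℕ, (⇑σ'')^[m'] binv = z})),
            (∀ v, ((σV v : k')) = σ'' ↑v) ∧
            ∀ p : Ideal ↥(Subring.closure (Set.range e ∪
                    {z : k' | ∃ (j : Fin m) (m' : ℕ), (⇑σ'')^[m'] (a j) = z} ∪
                    {z : k' | ∃ m' : ℕ, (⇑σ'')^[m'] binv = z})),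
              PseudoPrime σV p → p = ⊥) ∧
        -- the base-changed `σ`-PV rings are isomorphic
        (letI : Algebra ↥(constSubring Φ₁) k' := e₁.toAlgebra
         letI : Algebra ↥(constSubring Φ₂) k' := e₂.toAlgebra
         ∃ (ψ : (R₁ ⊗[↥(constSubring Φ₁)] k') ≃+* (R₂ ⊗[↥(constSubring Φ₂)] k'))
           (Φ₁' σ₁' : (R₁ ⊗[↥(constSubring Φ₁)] k') →+* (R₁ ⊗[↥(constSubring Φ₁)] k'))
           (Φ₂' σ₂' : (R₂ ⊗[↥(constSubring Φ₂)] k') →+* (R₂ ⊗[↥(constSubring Φ₂)] k')),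
           (∀ (r : R₁) (c : k'), Φ₁' (r ⊗ₜ c) = Φ₁ r ⊗ₜ c) ∧
           (∀ (r : R₂) (c : k'), Φ₂' (r ⊗ₜ c) = Φ₂ r ⊗ₜ c) ∧
           (∀ (r : R₁) (c : k'), σ₁' (r ⊗ₜ c) = σ₁ r ⊗ₜ σ'' c) ∧
           (∀ (r : R₂) (c : k'), σ₂' (r ⊗ₜ c) = σ₂ r ⊗ₜ σ'' c) ∧
           (∀ t, ψ (Φ₁' t) = Φ₂' (ψ t)) ∧
           (∀ t, ψ (σ₁' t) = σ₂' (ψ t)) ∧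
           (∀ (x : K) (c : k'), ψ (algebraMap K R₁ x ⊗ₜ c) = algebraMap K R₂ x ⊗ₜ c)) := by
  let := (diffSimple_of_field φ).isField_constSubring.toField
  let := hs₁.isField_constSubring.toField
  let := hs₂.isField_constSubring.toField
  let : Algebra (constSubring φ) (constSubring Φ₁) :=
    (((algebraMap K R₁).comp (constSubring φ).subtype).codRestrict (constSubring Φ₁) fun x =>
      (hΦ₁ x).trans (congrArg (algebraMap K R₁) x.2)).toAlgebra
  let : Algebra (constSubring φ) (constSubring Φ₂) :=
    (((algebraMap K R₂).comp (constSubring φ).subtype).codRestrict (constSubring Φ₂) fun x =>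
      (hΦ₂ x).trans (congrArg (algebraMap K R₂) x.2)).toAlgebra
  obtain ⟨W₁, hYW₁, hW₁, hg₁'⟩ := exists_inverse_fundamental_matrix hY₁ hw₁ hg₁
  obtain ⟨W₂, hYW₂, hW₂, hg₂'⟩ := exists_inverse_fundamental_matrix hY₂ hw₂ hg₂
  obtain ⟨k', _, σ'', hk', e, e₁, e₂, he, he₁, he₂, hσ, hσ', hσ'', hc₁, hc₂, hfg, hconstr, hψ⟩ :=
    exists_constrained_extension_and_equiv (k := constSubring φ) (k₁ := constSubring Φ₁)
      (k₂ := constSubring Φ₂) (κ := resEndo φ σ hcomm) (κ₁ := resEndo Φ₁ σ₁ hcomm₁)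
      (κ₂ := resEndo Φ₂ σ₂ hcomm₂) hcomm (fun c => c.2)
      (fun m hm a ha => ⟨⟨a, hper a m hm (RingHom.coe_pow φ m ▸ ha)⟩, rfl⟩)
      (fun c => by
        obtain ⟨b, hb, hbc⟩ := honto c c.2
        exact ⟨⟨b, hb⟩, Subtype.ext hbc⟩)
      (fun c => rfl) (fun c => Subtype.ext (hσ₁ c)) (fun c => rfl) (fun c => rfl) hcomm₁ hcomm₂
      hΦ₁ hσ₁ hΦ₂ hσ₂ hs₁ hs₂ hd₁ hd₂ (fun a ha => ⟨⟨a, ha⟩, rfl⟩) (fun a ha => ⟨⟨a, ha⟩, rfl⟩)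
      (fun c => c.2) (fun c => c.2) (fun c => rfl) (fun c => rfl)
      hY₁ hYW₁ hW₁ hg₁' hY₂ hYW₂ hW₂ hg₂'
  exact ⟨k', _, σ'', hk', e, e₁, e₂, he, he₁, he₂, hσ, hσ', hσ'', fun a ha => hc₁ ⟨a, ha⟩,
    fun a ha => hc₂ ⟨a, ha⟩, hfg, hconstr, hψ⟩
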